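/- Under the same hypotheses (d ≥ 3, closure(I) = m, ē₃(I) = 0), if moreover t(R) ≠ λ(closure(I²)/(J·closure(I))), then the strict inequality ē₁(I) < e₀(I) − 1 + t(R) holds. -/

import Mathlib

set_option synthInstance.maxHeartbeats 1000000
set_option maxHeartbeats 2000000

open IsLocalRing Polynomial Finset

variable {R : Type*}

/-- `x` is integral over the ideal `I`: it satisfies an equation
`x^n + a₁ x^{n-1} + ⋯ + aₙ = 0` with `aᵢ ∈ Iⁱ`. -/
def IsIntegralOverIdeal [CommRing R] (I : Ideal R) (x : R) : Prop :=
  ∃ n : ℕ, 0 < n ∧ ∃ a : ℕ → R, (∀ i ∈ Finset.Icc 1 n, a i ∈ I ^ i) ∧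
    x ^ n + ∑ i ∈ Finset.Icc 1 n, a i * x ^ (n - i) = 0

/-- The integral closure of an ideal (the set of integral elements is an ideal,
so the span equals it). -/
def intCl [CommRing R] (I : Ideal R) : Ideal R :=
  Ideal.span {x | IsIntegralOverIdeal I x}

/-- Length of a module, as the Krull dimension of its lattice of submodules. -/
noncomputable def mlen (R M : Type*) [CommRing R] [AddCommGroup M] [Module R M] :
    WithBot ℕ∞ :=
  Order.krullDim (Submodule R M)

/-- The quotient module `N/(K ∩ N)` for ideals `N K`. -/
abbrev idealQuot [CommRing R] (N K : Ideal R) :=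
  N ⧸ (Submodule.comap N.subtype K)

/-- Depth of `M` with respect to the ideal `J`: sup of lengths of `M`-regular
sequences contained in `J`. -/
noncomputable def rdepth (A : Type*) [CommRing A] (J : Ideal A)
    (M : Type*) [AddCommGroup M] [Module A M] : ℕ∞ :=
  sSup {n : ℕ∞ | ∃ rs : List A, (rs.length : ℕ∞) = n ∧ (∀ x ∈ rs, x ∈ J) ∧
    RingTheory.Sequence.IsRegular M rs}

/-- A local ring is Cohen-Macaulay if its depth equals its Krull dimension. -/
def IsCMLocal (R : Type*) [CommRing R] [IsLocalRing R] : Prop :=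
  (rdepth R (maximalIdeal R) R : WithBot ℕ∞) = ringKrullDim R

/-- A local ring is analytically unramified if its `m`-adic completion is reduced. -/
def AnalyticallyUnramified (R : Type*) [CommRing R] [IsLocalRing R] : Prop :=
  IsReduced (AdicCompletion (maximalIdeal R) R)

/-- An ideal is `m`-primary. -/
def IsMPrimary [CommRing R] [IsLocalRing R] (I : Ideal R) : Prop :=
  I.radical = maximalIdeal R

/-- `J ⊆ I` is a minimal reduction: generated by `d = dim R` elements and
`I^{n+1} = J I^n` for `n ≫ 0`. -/
def IsMinimalReduction [CommRing R] (d : ℕ) (J I : Ideal R) : Prop :=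
  J ≤ I ∧ (∃ s : Fin d → R, J = Ideal.span (Set.range s)) ∧
    ∃ N : ℕ, ∀ n ≥ N, I ^ (n + 1) = J * I ^ n

/-- Normal Hilbert data: `L n = λ(R/ intCl(I^{n+1}))` and for `n ≫ 0` this agrees
with the polynomial whose normalized coefficients are the `e i`. -/
def NormalHilbertData [CommRing R] (d : ℕ) (I : Ideal R) (L : ℕ → ℕ) (e : ℕ → ℤ) : Prop :=
  (∀ n, mlen R (R ⧸ intCl (I ^ (n + 1))) = (L n : WithBot ℕ∞)) ∧
    ∃ N : ℕ, ∀ n ≥ N, (L n : ℤ) =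
      ∑ i ∈ Finset.range (d + 1), (-1 : ℤ) ^ i * e i * ((n + d - i).choose (d - i))

/-- `t` is the Cohen-Macaulay type of the local ring `R` of dimension `d`:
`t = λ((Q : m)/Q)` for every ideal `Q` generated by a maximal regular sequence in `m`. -/
def CMTypeData (R : Type*) [CommRing R] [IsLocalRing R] (d t : ℕ) : Prop :=
  ∀ s : List R, s.length = d → (∀ x ∈ s, x ∈ maximalIdeal R) →
    RingTheory.Sequence.IsRegular R s →
      mlen R (idealQuot ((Ideal.span {x | x ∈ s}).colon (maximalIdeal R))
        (Ideal.span {x | x ∈ s})) = (t : WithBot ℕ∞)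

/-- The quotient module `N/(K ∩ N)` for submodules `N K` of a module. -/
abbrev submoduleQuot {A M : Type*} [CommRing A] [AddCommGroup M] [Module A M]
    (N K : Submodule A M) :=
  N ⧸ (Submodule.comap N.subtype K)


namespace E1

/-! ### Lengths of quotients by ideals -/

section length
universe u
variable {R : Type u} [CommRing R]

/-- `len I = λ(R/I)`. -/
noncomputable def len (I : Ideal R) : ℕ∞ := Module.length R (R ⧸ I)

theorem len_anti {I K : Ideal R} (h : I ≤ K) : len K ≤ len I :=
  Module.length_le_of_surjective (Submodule.factor h) (Submodule.factor_surjective h)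

theorem mem_colon1 {I : Ideal R} {f x : R} : x ∈ I.colon ({f} : Set R) ↔ x * f ∈ I := by
  rw [Submodule.mem_colon_singleton, smul_eq_mul]

theorem len_colon_add (I : Ideal R) (f : R) :
    len I = len (I.colon ({f} : Set R)) + len (I ⊔ Ideal.span {f}) := by
  let g : (R ⧸ I.colon ({f} : Set R)) →ₗ[R] R ⧸ I :=
    Submodule.mapQ _ _ (LinearMap.mulLeft R f) (by
      intro x hx
      have := mem_colon1.1 hx
      simpa [mul_comm] using this)
  refine Module.length_eq_add_of_exact g (Submodule.factor (le_sup_left)) ?_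
    (Submodule.factor_surjective le_sup_left) ?_
  · rw [← LinearMap.ker_eq_bot, LinearMap.ker_eq_bot']
    intro x
    obtain ⟨x, rfl⟩ := Submodule.mkQ_surjective _ x
    intro hx
    have : f * x ∈ I := (Submodule.Quotient.mk_eq_zero _).1 hx
    have h2 : x ∈ I.colon ({f} : Set R) := by
      rw [mem_colon1, mul_comm]; exact this
    exact (Submodule.Quotient.mk_eq_zero _).2 h2
  · intro y
    obtain ⟨y, rfl⟩ := Submodule.mkQ_surjective _ y
    constructor
    · intro hy
      have : y ∈ I ⊔ Ideal.span {f} := (Submodule.Quotient.mk_eq_zero _).1 hy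
      obtain ⟨i, hi, z, hz, rfl⟩ := Submodule.mem_sup.1 this
      obtain ⟨c, rfl⟩ := Ideal.mem_span_singleton'.1 hz
      refine ⟨Submodule.mkQ _ c, ?_⟩
      simp only [g, Submodule.mkQ_apply, Submodule.mapQ_apply, LinearMap.mulLeft_apply]
      rw [Submodule.Quotient.eq]
      have := I.neg_mem hi
      convert this using 1; ring
    · rintro ⟨x, hx⟩
      obtain ⟨x, rfl⟩ := Submodule.mkQ_surjective _ x
      rw [← hx]
      simp only [g, Submodule.mkQ_apply, Submodule.mapQ_apply, LinearMap.mulLeft_apply]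
      refine (Submodule.Quotient.mk_eq_zero _).2 ?_
      exact Ideal.mem_sup_right (Ideal.mem_span_singleton.2 (dvd_mul_right _ _))

theorem len_eq_zero {I : Ideal R} : len I = 0 ↔ I = ⊤ := by
  rw [len, Module.length_eq_zero_iff]
  exact Submodule.Quotient.subsingleton_iff

theorem len_lt {I K : Ideal R} (h : I < K) (hI : len I ≠ ⊤) : len K < len I := by
  obtain ⟨f, hfK, hfI⟩ := SetLike.exists_of_lt h
  have h1 := len_colon_add I f
  have h2 : len K ≤ len (I ⊔ Ideal.span {f}) :=
    len_anti (sup_le h.le (by rwa [Ideal.span_singleton_le_iff_mem]))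
  have h3 : len (I.colon ({f} : Set R)) ≠ 0 := by
    intro h0
    have : (1 : R) ∈ I.colon ({f} : Set R) := by rw [len_eq_zero.1 h0]; trivial
    rw [mem_colon1, one_mul] at this
    exact hfI this
  have h4 : len (I ⊔ Ideal.span {f}) ≠ ⊤ := ne_top_of_le_ne_top hI (len_anti le_sup_left)
  refine h2.trans_lt ?_
  rw [h1]
  exact lt_of_lt_of_le (ENat.lt_add_one_iff h4 |>.2 le_rfl)
    (by rw [add_comm]; exact add_le_add_left (ENat.one_le_iff_ne_zero.2 h3) _)

theorem eq_of_len_le {I K : Ideal R} (h : I ≤ K) (hI : len I ≠ ⊤) (hl : len I ≤ len K) : I = K := by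
  by_contra hne
  exact absurd (len_lt (lt_of_le_of_ne h hne) hI) (not_lt.2 hl)

/-- Lower bound for lengths from independence. -/
theorem len_lower {ι : Type*} (s : Finset ι) (x : ι → R) (L : ι → Ideal R) :
    ∀ (K : Ideal R), (∀ c : ι → R, ∑ i ∈ s, c i * x i ∈ K → ∀ i ∈ s, c i ∈ L i) →
      len (K ⊔ Ideal.span (x '' s)) + ∑ i ∈ s, len (L i) ≤ len K := by
  classical
  induction s using Finset.induction_on with
  | empty => intro K _; simp
  | insert i s hi ih =>
    intro K h
    have h1 := ih (K ⊔ Ideal.span {x i}) (by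
      intro c hc j hj
      obtain ⟨y, hy, z, hz, hyz⟩ := Submodule.mem_sup.1 hc
      obtain ⟨b, rfl⟩ := Ideal.mem_span_singleton'.1 hz
      have := h (fun j => if j = i then -b else c j) (by
        rw [Finset.sum_insert hi]
        have : ∑ j ∈ s, (if j = i then -b else c j) * x j = ∑ j ∈ s, c j * x j := by
          refine Finset.sum_congr rfl fun j hj => ?_
          rw [if_neg]; rintro rfl; exact hi hj
        rw [this, ← hyz]
        simpa using hy) j (Finset.mem_insert_of_mem hj)
      have hji : j ≠ i := by rintro rfl; exact hi hj
      simpa [hji] using this)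
    have h2 : len (L i) ≤ len (K.colon ({x i} : Set R)) := by
      refine len_anti fun b hb => ?_
      rw [mem_colon1] at hb
      have := h (fun j => if j = i then b else 0) (by
        rw [Finset.sum_insert hi]
        have : ∑ j ∈ s, (if j = i then b else 0) * x j = 0 := by
          refine Finset.sum_eq_zero fun j hj => ?_
          rw [if_neg, zero_mul]; rintro rfl; exact hi hj
        rw [this]; simpa using hb) i (Finset.mem_insert_self _ _)
      simpa using this
    rw [len_colon_add K (x i), Finset.sum_insert hi]
    have h3 : K ⊔ Ideal.span {x i} ⊔ Ideal.span (x '' ↑s)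
        = K ⊔ Ideal.span (x '' ↑(insert i s)) := by
      rw [sup_assoc, ← Ideal.span_union, Finset.coe_insert, Set.image_insert_eq,
        Set.insert_eq]
    rw [h3] at h1
    calc _ = len (L i) + (len (K ⊔ Ideal.span (x '' ↑(insert i s))) + ∑ i ∈ s, len (L i)) := by
            abel
      _ ≤ _ := add_le_add h2 h1

/-- Upper bound for lengths from generation. -/
theorem len_upper {ι : Type*} (s : Finset ι) (x : ι → R) (L : ι → Ideal R) :
    ∀ (K : Ideal R), (∀ i ∈ s, ∀ c ∈ L i, c * x i ∈ K) →
      len K ≤ len (K ⊔ Ideal.span (x '' s)) + ∑ i ∈ s, len (L i) := by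
  classical
  induction s using Finset.induction_on with
  | empty => intro K _; simp
  | insert i s hi ih =>
    intro K h
    have h1 := ih (K ⊔ Ideal.span {x i}) (fun j hj c hc =>
      Ideal.mem_sup_left (h j (Finset.mem_insert_of_mem hj) c hc))
    have h2 : len (K.colon ({x i} : Set R)) ≤ len (L i) := by
      refine len_anti fun b hb => ?_
      rw [mem_colon1]
      exact h i (Finset.mem_insert_self _ _) b hb
    rw [len_colon_add K (x i), Finset.sum_insert hi]
    have h3 : K ⊔ Ideal.span {x i} ⊔ Ideal.span (x '' ↑s)
        = K ⊔ Ideal.span (x '' ↑(insert i s)) := by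
      rw [sup_assoc, ← Ideal.span_union, Finset.coe_insert, Set.image_insert_eq,
        Set.insert_eq]
    rw [h3] at h1
    calc _ ≤ len (L i) + (len (K ⊔ Ideal.span (x '' ↑(insert i s))) + ∑ i ∈ s, len (L i)) :=
            add_le_add h2 h1
      _ = _ := by abel

theorem len_maximal [IsLocalRing R] : len (maximalIdeal R) = 1 := by
  rw [len, Module.length_eq_one_iff]
  have : Ideal.IsMaximal (maximalIdeal R) := inferInstance
  exact isSimpleModule_iff_isCoatom.2 (Ideal.isMaximal_def.1 this)

theorem len_ne_top [IsLocalRing R] [IsNoetherianRing R] {I : Ideal R} {n : ℕ}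
    (h : maximalIdeal R ^ n ≤ I) : len I ≠ ⊤ := by
  refine ne_top_of_le_ne_top ?_ (len_anti h)
  clear h
  induction n with
  | zero => rw [pow_zero, Ideal.one_eq_top, len_eq_zero.2 rfl]; simp
  | succ n ih =>
    obtain ⟨s, hs⟩ := (isNoetherianRing_iff_ideal_fg R).1 inferInstance (maximalIdeal R ^ n)
    have h1 := len_upper s id (fun _ => maximalIdeal R) (maximalIdeal R ^ (n + 1)) (by
      intro i hi c hc
      rw [pow_succ', id]
      refine Ideal.mul_mem_mul hc ?_
      rw [← hs]; exact Ideal.subset_span hi)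
    refine ne_top_of_le_ne_top ?_ h1
    rw [Ne, ENat.add_eq_top, not_or]
    constructor
    · refine ne_top_of_le_ne_top ih (len_anti ?_)
      rw [Set.image_id, ← hs]; exact le_sup_right
    · simp [len_maximal]

/-- bridging with `mlen` -/
theorem mlen_eq_length (R M : Type*) [CommRing R] [AddCommGroup M] [Module R M] :
    mlen R M = (Module.length R M : WithBot ℕ∞) := by
  rw [mlen, Module.coe_length]

theorem mlen_quot (I : Ideal R) : mlen R (R ⧸ I) = (len I : WithBot ℕ∞) := by
  rw [mlen_eq_length, len]

theorem mlen_idealQuot (N K : Ideal R) :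
    (Module.length R (idealQuot N K)) + len (N ⊔ K) = len K := by
  symm
  refine Module.length_eq_add_of_exact
    (Submodule.mapQ (Submodule.comap N.subtype K) K N.subtype le_rfl)
    (Submodule.factor (le_sup_right : K ≤ N ⊔ K)) ?_
    (Submodule.factor_surjective _) ?_
  · rw [← LinearMap.ker_eq_bot, Submodule.ker_mapQ]
    rw [← LinearMap.le_ker_iff_map, Submodule.ker_mkQ]
  · intro y
    obtain ⟨y, rfl⟩ := Submodule.mkQ_surjective _ y
    constructor
    · intro hy
      have : y ∈ N ⊔ K := (Submodule.Quotient.mk_eq_zero _).1 hy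
      obtain ⟨n, hn, k, hk, rfl⟩ := Submodule.mem_sup.1 this
      refine ⟨Submodule.mkQ _ ⟨n, hn⟩, ?_⟩
      refine (Submodule.Quotient.eq _).2 ?_
      have := K.neg_mem hk
      convert this using 1
      simp
    · rintro ⟨x, hx⟩
      obtain ⟨x, rfl⟩ := Submodule.mkQ_surjective _ x
      rw [← hx]
      exact (Submodule.Quotient.mk_eq_zero _).2 (Ideal.mem_sup_left x.2)

end length
end E1

namespace E1

/-! ### Integral closure of powers of an ideal -/

section intcl
universe u
variable {R : Type u} [CommRing R]

theorem pow_mem_of_int {J : Ideal R} {k : ℕ} {x : R} (h : IsIntegralOverIdeal (J ^ k) x) :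
    ∃ N, ∀ n, x ^ n ∈ J ^ (k * n - N) := by
  obtain ⟨n0, hn0, a, ha, hx⟩ := h
  refine ⟨k * n0, fun n => ?_⟩
  induction n using Nat.strong_induction_on with
  | _ n ih =>
    by_cases hn : n < n0
    · have : k * n - k * n0 = 0 := Nat.sub_eq_zero_of_le (Nat.mul_le_mul_left _ hn.le)
      rw [this, pow_zero, Ideal.one_eq_top]; trivial
    · push Not at hn
      have h1 : x ^ n = - ∑ i ∈ Finset.Icc 1 n0, a i * x ^ (n - i) := by
        have : x ^ n = x ^ (n - n0) * x ^ n0 := by rw [← pow_add]; congr 1; omega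
        rw [this, eq_neg_of_add_eq_zero_left hx, mul_neg, Finset.mul_sum]
        congr 1
        refine Finset.sum_congr rfl fun i hi => ?_
        rw [Finset.mem_Icc] at hi
        have : n - i = (n - n0) + (n0 - i) := by omega
        rw [this, pow_add]; ring
      rw [h1]
      refine neg_mem (Ideal.sum_mem _ fun i hi => ?_)
      have h2 := ha i hi
      rw [Finset.mem_Icc] at hi
      have h3 := Ideal.mul_mem_mul h2 (ih (n - i) (by omega))
      rw [← pow_mul, ← pow_add] at h3
      refine Ideal.pow_le_pow_right ?_ h3
      rw [Nat.mul_sub]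
      have : k * i ≤ k * n := Nat.mul_le_mul_left _ (by omega)
      omega

/-- polynomial expressions in `x` with coefficients in powers of `I` -/
def PolyRep (I : Ideal R) (x : R) (n : ℕ) (y : R) : Prop :=
  ∃ b : ℕ → R, (∀ m ≤ n, b m ∈ I ^ m) ∧ y = ∑ m ∈ Finset.range (n + 1), b m * x ^ (n - m)

theorem PolyRep.add {I : Ideal R} {x : R} {n : ℕ} {y z : R} (hy : PolyRep I x n y)
    (hz : PolyRep I x n z) : PolyRep I x n (y + z) := by
  obtain ⟨b, hb, rfl⟩ := hy
  obtain ⟨c, hc, rfl⟩ := hz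
  exact ⟨fun m => b m + c m, fun m hm => add_mem (hb m hm) (hc m hm), by
    rw [← Finset.sum_add_distrib]; refine Finset.sum_congr rfl fun _ _ => by ring⟩

theorem PolyRep.mul_left {I : Ideal R} {x : R} {n : ℕ} {y z : R} (hz : z ∈ I)
    (hy : PolyRep I x n y) : PolyRep I x (n + 1) (z * y) := by
  obtain ⟨b, hb, rfl⟩ := hy
  refine ⟨fun m => if m = 0 then 0 else z * b (m - 1), fun m hm => ?_, ?_⟩
  · rcases m with _ | m
    · simp
    · simp only [Nat.succ_ne_zero, if_false, Nat.add_sub_cancel]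
      rw [pow_succ']
      exact Ideal.mul_mem_mul hz (hb m (by omega))
  · rw [Finset.sum_range_succ' _ (n + 1), Finset.mul_sum]
    simp only [Nat.succ_ne_zero, if_false, Nat.add_sub_cancel, if_true, zero_mul, add_zero]
    refine Finset.sum_congr rfl fun m _ => ?_
    rw [Nat.add_sub_add_right]; ring

theorem PolyRep.mul_x {I : Ideal R} {x : R} {n : ℕ} {y : R} (c : R)
    (hy : PolyRep I x n y) : PolyRep I x (n + 1) (c * x * y) := by
  obtain ⟨b, hb, rfl⟩ := hy
  refine ⟨fun m => if m ≤ n then c * b m else 0, fun m hm => ?_, ?_⟩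
  · dsimp only
    split_ifs with h
    · exact Ideal.mul_mem_left _ _ (hb m h)
    · exact zero_mem _
  · rw [Finset.sum_range_succ _ (n + 1), Finset.mul_sum]
    dsimp only
    rw [if_neg (by omega), zero_mul, add_zero]
    refine Finset.sum_congr rfl fun m hm => ?_
    rw [Finset.mem_range] at hm
    rw [if_pos (by omega)]
    have : n + 1 - m = (n - m) + 1 := by omega
    rw [this, pow_succ]; ring

theorem polyRep_of_mem {I : Ideal R} {x : R} : ∀ {n : ℕ} {y : R}
    (_ : y ∈ (I ⊔ Ideal.span {x}) ^ n), PolyRep I x n y := by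
  intro n
  induction n with
  | zero => intro y _; exact ⟨fun _ => y, fun m hm => by simp_all, by simp⟩
  | succ n ih =>
    intro y hy
    rw [pow_succ'] at hy
    refine Submodule.mul_induction_on hy (fun z hz w hw => ?_) (fun a b ha hb => ha.add hb)
    obtain ⟨u, hu, v, hv, rfl⟩ := Submodule.mem_sup.1 hz
    obtain ⟨c, rfl⟩ := Ideal.mem_span_singleton'.1 hv
    rw [add_mul]
    exact ((ih hw).mul_left hu).add ((ih hw).mul_x c)

theorem int_of_pow_mem [IsNoetherianRing R] {J : Ideal R} {k : ℕ} {x : R} {N : ℕ}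
    (h : ∀ n, x ^ n ∈ J ^ (k * n - N)) : IsIntegralOverIdeal (J ^ k) x := by
  let I := J ^ k
  let F : I.Filtration R :=
    { N := fun n => J ^ (k * n - N)
      mono := fun n => Ideal.pow_le_pow_right (Nat.sub_le_sub_right (Nat.mul_le_mul_left _ (by omega)) _)
      smul_le := fun n => by
        rw [smul_eq_mul, ← pow_add]
        refine Ideal.pow_le_pow_right ?_
        rw [Nat.mul_add]; omega }
  let F' : I.Filtration R :=
    { N := fun n => (I ⊔ Ideal.span {x}) ^ n
      mono := fun n => Ideal.pow_le_pow_right (by omega)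
      smul_le := fun n => by
        rw [smul_eq_mul, pow_succ']
        exact Ideal.mul_mono_left le_sup_left }
  have hF : F.Stable := by
    refine ⟨N, fun n hn => ?_⟩
    change J ^ k • J ^ (k * n - N) = J ^ (k * (n + 1) - N)
    rw [smul_eq_mul, ← pow_add]
    rcases Nat.eq_zero_or_pos k with rfl | hk
    · simp
    · have : n ≤ k * n := Nat.le_mul_of_pos_left _ hk
      congr 1
      rw [Nat.mul_add]; omega
  have hle : F' ≤ F := by
    intro n y hy
    obtain ⟨b, hb, rfl⟩ := polyRep_of_mem hy
    refine Ideal.sum_mem _ fun m hm => ?_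
    rw [Finset.mem_range] at hm
    have h1 := hb m (by omega)
    have h2 := Ideal.mul_mem_mul h1 (h (n - m))
    simp only [I] at h2
    rw [← pow_mul, ← pow_add] at h2
    refine Ideal.pow_le_pow_right ?_ h2
    rw [Nat.mul_sub]
    have : k * m ≤ k * n := Nat.mul_le_mul_left _ (by omega)
    omega
  obtain ⟨n0, hn0⟩ := Ideal.Filtration.Stable.of_le hF hle
  have h3 : I * (I ⊔ Ideal.span {x}) ^ n0 = (I ⊔ Ideal.span {x}) ^ (n0 + 1) := hn0 n0 le_rfl
  have h4 : x ^ (n0 + 1) ∈ I * (I ⊔ Ideal.span {x}) ^ n0 := by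
    rw [h3]
    exact Ideal.pow_mem_pow (Ideal.mem_sup_right (Ideal.mem_span_singleton_self x)) _
  have h5 : ∃ b : ℕ → R, (∀ m ≤ n0, b m ∈ I ^ (m + 1)) ∧
      x ^ (n0 + 1) = ∑ m ∈ Finset.range (n0 + 1), b m * x ^ (n0 - m) := by
    refine Submodule.mul_induction_on h4 (fun z hz w hw => ?_) ?_
    · obtain ⟨b, hb, rfl⟩ := polyRep_of_mem hw
      refine ⟨fun m => z * b m, fun m hm => ?_, ?_⟩
      · rw [pow_succ']; exact Ideal.mul_mem_mul hz (hb m hm)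
      · rw [Finset.mul_sum]; exact Finset.sum_congr rfl fun _ _ => by ring
    · rintro y z ⟨b, hb, rfl⟩ ⟨c, hc, rfl⟩
      exact ⟨fun m => b m + c m, fun m hm => add_mem (hb m hm) (hc m hm), by
        rw [← Finset.sum_add_distrib]; refine Finset.sum_congr rfl fun _ _ => by ring⟩
  obtain ⟨b, hb, hx⟩ := h5
  refine ⟨n0 + 1, by omega, fun i => - b (i - 1), fun i hi => ?_, ?_⟩
  · rw [Finset.mem_Icc] at hi
    refine neg_mem ?_
    have := hb (i - 1) (by omega)
    rwa [Nat.sub_add_cancel hi.1] at this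
  · rw [hx, ← Finset.Ico_add_one_right_eq_Icc, Finset.sum_Ico_eq_sum_range, Nat.add_sub_cancel, ← Finset.sum_add_distrib]
    refine Finset.sum_eq_zero fun m _ => ?_
    have h1 : 1 + m - 1 = m := by omega
    have h2 : n0 + 1 - (1 + m) = n0 - m := by omega
    dsimp only; rw [h1, h2]; ring

/-- `Fr J p q` is the ideal of elements `x` of asymptotic order at least `p/q` (attained). -/
def Fr (J : Ideal R) (p q : ℕ) : Ideal R where
  carrier := {x | ∃ N, ∀ n, x ^ n ∈ J ^ (p * n / q - N)}
  zero_mem' := ⟨p, fun n => by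
    rcases n with _ | n
    · simp
    · simp⟩
  add_mem' := by
    rintro x y ⟨N, hN⟩ ⟨M, hM⟩
    refine ⟨N + M + 1, fun n => ?_⟩
    rw [add_pow]
    refine Ideal.sum_mem _ fun i hi => Ideal.mul_mem_right _ _ ?_
    rw [Finset.mem_range] at hi
    have := Ideal.mul_mem_mul (hN i) (hM (n - i))
    rw [← pow_add] at this
    refine Ideal.pow_le_pow_right ?_ this
    have h1 : p * n / q ≤ p * i / q + p * (n - i) / q + 1 := by
      have : p * n = p * i + p * (n - i) := by rw [← Nat.mul_add]; congr 1; omega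
      rw [this]
      rcases Nat.eq_zero_or_pos q with rfl | hq
      · simp
      · rw [Nat.add_div hq]; split_ifs <;> omega
    omega
  smul_mem' := by
    rintro c x ⟨N, hN⟩
    refine ⟨N, fun n => ?_⟩
    rw [smul_eq_mul, mul_pow]
    exact Ideal.mul_mem_left _ _ (hN n)

theorem mem_Fr {J : Ideal R} {p q : ℕ} {x : R} :
    x ∈ Fr J p q ↔ ∃ N, ∀ n, x ^ n ∈ J ^ (p * n / q - N) := Iff.rfl

/-- `F J n` : asymptotic order at least `n`; it is the integral closure of `J ^ n`. -/
def F (J : Ideal R) (k : ℕ) : Ideal R := Fr J k 1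

theorem mem_F {J : Ideal R} {k : ℕ} {x : R} :
    x ∈ F J k ↔ ∃ N, ∀ n, x ^ n ∈ J ^ (k * n - N) := by
  simp [F, mem_Fr]

theorem F_eq_intCl [IsNoetherianRing R] (J : Ideal R) (k : ℕ) : F J k = intCl (J ^ k) := by
  apply le_antisymm
  · intro x hx
    obtain ⟨N, hN⟩ := mem_F.1 hx
    exact Ideal.subset_span (int_of_pow_mem hN)
  · rw [intCl, Ideal.span_le]
    intro x hx
    exact mem_F.2 (pow_mem_of_int hx)

theorem pow_le_F (J : Ideal R) (k : ℕ) : J ^ k ≤ F J k := fun x hx =>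
  mem_F.2 ⟨0, fun n => by rw [Nat.sub_zero, pow_mul]; exact Ideal.pow_mem_pow hx n⟩

theorem F_zero (J : Ideal R) : F J 0 = ⊤ := by
  rw [eq_top_iff]; have := pow_le_F J 0; simpa using this

theorem F_anti (J : Ideal R) {k l : ℕ} (h : k ≤ l) : F J l ≤ F J k := fun x hx => by
  obtain ⟨N, hN⟩ := mem_F.1 hx
  refine mem_F.2 ⟨N, fun n => Ideal.pow_le_pow_right ?_ (hN n)⟩
  exact Nat.sub_le_sub_right (Nat.mul_le_mul_right _ h) _

theorem mul_mem_F {J : Ideal R} {k l : ℕ} {x y : R} (hx : x ∈ F J k) (hy : y ∈ F J l) :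
    x * y ∈ F J (k + l) := by
  obtain ⟨N, hN⟩ := mem_F.1 hx
  obtain ⟨M, hM⟩ := mem_F.1 hy
  refine mem_F.2 ⟨N + M, fun n => ?_⟩
  rw [mul_pow]
  have := Ideal.mul_mem_mul (hN n) (hM n)
  rw [← pow_add] at this
  refine Ideal.pow_le_pow_right ?_ this
  rw [add_mul]; omega

theorem mul_F_le (J : Ideal R) (k l : ℕ) : F J k * F J l ≤ F J (k + l) :=
  Ideal.mul_le.2 fun _ hx _ hy => mul_mem_F hx hy

theorem pow_mem_F {J : Ideal R} {k : ℕ} {x : R} (hx : x ∈ F J k) (m : ℕ) :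
    x ^ m ∈ F J (k * m) := by
  induction m with
  | zero => simp [F_zero]
  | succ m ih => rw [pow_succ, Nat.mul_succ]; exact mul_mem_F ih hx

/-- Cancelling powers. -/
theorem F_of_pow_mem {J : Ideal R} {k m : ℕ} (hm : 0 < m) {x : R} (hx : x ^ m ∈ F J (k * m)) :
    x ∈ F J k := by
  obtain ⟨N, hN⟩ := mem_F.1 hx
  refine mem_F.2 ⟨N + k * m, fun n => ?_⟩
  have h1 := hN (n / m)
  have h2 : x ^ n = x ^ (n % m) * (x ^ m) ^ (n / m) := by
    rw [← pow_mul, ← pow_add, Nat.mod_add_div]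
  rw [h2]
  refine Ideal.mul_mem_left _ _ (Ideal.pow_le_pow_right ?_ h1)
  have h3 : n < m * (n / m) + m := by
    have := Nat.mod_add_div n m; have := Nat.mod_lt n hm; omega
  have h4 : k * n ≤ k * (m * (n / m) + m) := Nat.mul_le_mul_left _ h3.le
  rw [mul_add, ← mul_assoc] at h4
  omega

/-- reduction: same closures -/
theorem F_eq_of_reduction {J I : Ideal R} (hJI : J ≤ I) {N : ℕ}
    (h : ∀ n ≥ N, I ^ (n + 1) = J * I ^ n) (k : ℕ) : F I k = F J k := by
  have h1 : ∀ n, I ^ (n + N) ≤ J ^ n := by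
    intro n
    have : I ^ (n + N) = J ^ n * I ^ N := by
      induction n with
      | zero => simp
      | succ n ih =>
        rw [show n + 1 + N = (n + N) + 1 by omega, h _ (by omega), ih, pow_succ']; ring
    rw [this]; exact Ideal.mul_le_left
  apply le_antisymm
  · intro x hx
    obtain ⟨M, hM⟩ := mem_F.1 hx
    refine mem_F.2 ⟨M + N, fun n => ?_⟩
    by_cases hn : k * n - M ≤ N
    · have : k * n - (M + N) = 0 := by omega
      rw [this]; simp
    · refine h1 _ (Ideal.pow_le_pow_right ?_ (hM n)); omega
  · intro x hx
    obtain ⟨M, hM⟩ := mem_F.1 hx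
    exact mem_F.2 ⟨M, fun n => (Ideal.pow_right_mono hJI _) (hM n)⟩

end intcl
end E1

namespace E1

/-! ### Quasi-regular sequences and symbols -/

section qr
universe u v
variable {R : Type u} [CommRing R] {ι : Type v} [Finite ι]

/-- A ring in which each element is a unit or nilpotent. -/
def UN (A : Type u) [CommRing A] : Prop := ∀ a : A, IsUnit a ∨ IsNilpotent a

theorem nzd_of_unit_coeff {A : Type u} [CommRing A] (hA : UN A) (φ ψ : MvPolynomial ι A)
    (hφ : ∃ α, IsUnit (φ.coeff α)) (h : φ * ψ = 0) : ψ = 0 := by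
  classical
  by_contra hψ
  haveI : Nontrivial A := by
    by_contra hn
    rw [not_nontrivial_iff_subsingleton] at hn
    exact hψ (Subsingleton.elim _ _)
  letI : Fintype ι := Fintype.ofFinite ι
  letI : LinearOrder ι := LinearOrder.lift' (Fintype.equivFin ι) (Fintype.equivFin ι).injective
  let φ1 : MvPolynomial ι A := ∑ α ∈ φ.support with IsUnit (φ.coeff α), MvPolynomial.monomial α (φ.coeff α)
  have c1 : ∀ α, φ1.coeff α = if IsUnit (φ.coeff α) then φ.coeff α else 0 := by
    intro α
    simp only [φ1, MvPolynomial.coeff_sum, MvPolynomial.coeff_monomial, Finset.sum_ite_eq',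
      Finset.mem_filter, MvPolynomial.mem_support_iff]
    by_cases hu : IsUnit (φ.coeff α)
    · rw [if_pos ⟨hu.ne_zero, hu⟩, if_pos hu]
    · rw [if_neg (fun h => hu h.2), if_neg hu]
  have hn : IsNilpotent (φ1 - φ) := by
    rw [MvPolynomial.isNilpotent_iff]
    intro α
    rw [MvPolynomial.coeff_sub, c1]
    split_ifs with hu
    · simp
    · rw [zero_sub]; exact ((hA (φ.coeff α)).resolve_left hu).neg
  have h1 : φ1 ≠ 0 := by
    obtain ⟨α, hα⟩ := hφ
    intro h0
    have := c1 α
    rw [h0, if_pos hα] at this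
    rw [← this] at hα
    simp at hα
  have hlead : IsUnit ((MonomialOrder.lex (σ := ι)).leadingCoeff φ1) := by
    have h2 : (MonomialOrder.lex (σ := ι)).leadingCoeff φ1 ≠ 0 := by
      rwa [Ne, MonomialOrder.leadingCoeff_eq_zero_iff]
    rw [MonomialOrder.leadingCoeff, c1] at h2 ⊢
    split_ifs at h2 ⊢ with hu
    · exact hu
    · exact absurd rfl h2
  have hreg : ∀ χ, φ1 * χ = 0 → χ = 0 := by
    intro χ hχ
    by_contra hne
    have h3 := (MonomialOrder.lex (σ := ι)).leadingCoeff_mul_of_left_mem_nonZeroDivisors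
      (f := φ1) (g := χ) hlead.mem_nonZeroDivisors
    rw [hχ, MonomialOrder.leadingCoeff_zero] at h3
    have h4 := (hlead.mul_right_eq_zero).1 h3.symm
    rw [MonomialOrder.leadingCoeff_eq_zero_iff] at h4
    exact hne h4
  obtain ⟨n, hn⟩ := hn
  have key : ∀ m, φ1 ^ m * ψ = (φ1 - φ) ^ m * ψ := by
    intro m
    induction m with
    | zero => simp
    | succ m ih =>
      rw [pow_succ, pow_succ', mul_assoc (φ1 - φ), ← ih, mul_assoc]
      have : φ1 * ψ = (φ1 - φ) * ψ := by rw [sub_mul, h, sub_zero]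
      rw [this]; ring
  have h5 : φ1 ^ n * ψ = 0 := by rw [key, hn, zero_mul]
  have h6 : ∀ m, φ1 ^ m * ψ = 0 → ψ = 0 := by
    intro m
    induction m with
    | zero => simp
    | succ m ih => intro hm; rw [pow_succ', mul_assoc] at hm; exact ih (hreg _ hm)
  exact hψ (h6 n h5)

/-- the ideal generated by the sequence -/
abbrev sp (a : ι → R) : Ideal R := Ideal.span (Set.range a)

/-- quasi-regular sequences -/
def QR (a : ι → R) : Prop := ∀ (n : ℕ) (φ : MvPolynomial ι R), φ.IsHomogeneous n →
  MvPolynomial.eval a φ ∈ sp a ^ (n + 1) → ∀ α, φ.coeff α ∈ sp a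

/-- `σ` is the degree `n` symbol of `x`. -/
def IsSym (a : ι → R) (n : ℕ) (x : R) (σ : MvPolynomial ι (R ⧸ sp a)) : Prop :=
  ∃ Φ : MvPolynomial ι R, Φ.IsHomogeneous n ∧ MvPolynomial.map (Ideal.Quotient.mk (sp a)) Φ = σ ∧
    x - MvPolynomial.eval a Φ ∈ sp a ^ (n + 1)

variable {a : ι → R}

theorem eval_mem_pow {n : ℕ} {Φ : MvPolynomial ι R} (h : Φ.IsHomogeneous n) :
    MvPolynomial.eval a Φ ∈ sp a ^ n :=
  (Ideal.mem_span_pow_iff_exists_isHomogeneous a _).2 ⟨Φ, h, rfl⟩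

theorem eval_mem_pow_succ {n : ℕ} {Φ : MvPolynomial ι R} (h : Φ.IsHomogeneous n)
    (hc : ∀ α, Φ.coeff α ∈ sp a) : MvPolynomial.eval a Φ ∈ sp a ^ (n + 1) := by
  rw [MvPolynomial.eval_eq]
  refine Ideal.sum_mem _ fun α hα => ?_
  rw [pow_succ']
  refine Ideal.mul_mem_mul (hc α) ?_
  have := eval_mem_pow (a := a) (MvPolynomial.isHomogeneous_monomial (1 : R) (rfl : α.degree = _))
  have hd : α.degree = n := by
    by_contra hne
    exact (MvPolynomial.mem_support_iff.1 hα) (h.coeff_eq_zero hne)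
  rw [hd] at this
  simpa [MvPolynomial.eval_monomial, Finsupp.prod] using this

theorem map_eq_zero_iff {Φ : MvPolynomial ι R} :
    MvPolynomial.map (Ideal.Quotient.mk (sp a)) Φ = 0 ↔ ∀ α, Φ.coeff α ∈ sp a := by
  rw [MvPolynomial.ext_iff]
  refine forall_congr' fun α => ?_
  rw [MvPolynomial.coeff_map, MvPolynomial.coeff_zero, Ideal.Quotient.eq_zero_iff_mem]

theorem IsSym.homog {n : ℕ} {x : R} {σ} (h : IsSym a n x σ) : σ.IsHomogeneous n := by
  obtain ⟨Φ, h1, rfl, _⟩ := h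
  exact h1.map _

theorem IsSym.mem {n : ℕ} {x : R} {σ} (h : IsSym a n x σ) : x ∈ sp a ^ n := by
  obtain ⟨Φ, h1, rfl, h2⟩ := h
  have := add_mem (Ideal.pow_le_pow_right (Nat.le_succ n) h2) (eval_mem_pow (a := a) h1)
  simpa using this

theorem exists_isSym {n : ℕ} {x : R} (h : x ∈ sp a ^ n) : ∃ σ, IsSym a n x σ := by
  obtain ⟨Φ, h1, rfl⟩ := (Ideal.mem_span_pow_iff_exists_isHomogeneous a _).1 h
  exact ⟨_, Φ, h1, rfl, by simp⟩

theorem isSym_eval {n : ℕ} {Φ : MvPolynomial ι R} (h : Φ.IsHomogeneous n) :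
    IsSym a n (MvPolynomial.eval a Φ) (MvPolynomial.map (Ideal.Quotient.mk (sp a)) Φ) :=
  ⟨Φ, h, rfl, by simp⟩

theorem isSym_X (i : ι) : IsSym a 1 (a i) (MvPolynomial.X i) := by
  have := isSym_eval (a := a) (MvPolynomial.isHomogeneous_X R i)
  simpa using this

theorem isSym_C (r : R) : IsSym a 0 r (MvPolynomial.C (Ideal.Quotient.mk (sp a) r)) := by
  have := isSym_eval (a := a) (MvPolynomial.isHomogeneous_C ι r)
  simpa using this

theorem IsSym.add {n : ℕ} {x y : R} {σ τ} (h : IsSym a n x σ) (h' : IsSym a n y τ) :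
    IsSym a n (x + y) (σ + τ) := by
  obtain ⟨Φ, h1, rfl, h2⟩ := h
  obtain ⟨Ψ, h3, rfl, h4⟩ := h'
  refine ⟨Φ + Ψ, h1.add h3, by simp, ?_⟩
  have := add_mem h2 h4
  rw [map_add]; convert this using 1; ring

theorem IsSym.neg {n : ℕ} {x : R} {σ} (h : IsSym a n x σ) : IsSym a n (-x) (-σ) := by
  obtain ⟨Φ, h1, rfl, h2⟩ := h
  refine ⟨-Φ, h1.neg, by simp, ?_⟩
  have := neg_mem h2
  rw [map_neg]; convert this using 1; ring

theorem IsSym.mul {n m : ℕ} {x y : R} {σ τ} (h : IsSym a n x σ) (h' : IsSym a m y τ) :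
    IsSym a (n + m) (x * y) (σ * τ) := by
  have hx := h.mem
  obtain ⟨Φ, h1, rfl, h2⟩ := h
  obtain ⟨Ψ, h3, rfl, h4⟩ := h'
  refine ⟨Φ * Ψ, h1.mul h3, by simp, ?_⟩
  have e1 := Ideal.mul_mem_mul hx h4
  have e2 := Ideal.mul_mem_mul h2 (eval_mem_pow (a := a) h3)
  rw [← pow_add] at e1 e2
  rw [show n + 1 + m = n + m + 1 by omega] at e2
  have := add_mem e1 e2
  rw [map_mul]
  have e3 : x * y - MvPolynomial.eval a Φ * MvPolynomial.eval a Ψ = x * (y - MvPolynomial.eval a Ψ)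
    + (x - MvPolynomial.eval a Φ) * MvPolynomial.eval a Ψ := by ring
  rw [e3]; exact this

theorem IsSym.pow {n : ℕ} {x : R} {σ} (h : IsSym a n x σ) (k : ℕ) :
    IsSym a (n * k) (x ^ k) (σ ^ k) := by
  induction k with
  | zero => simpa using isSym_C (a := a) 1
  | succ k ih => rw [pow_succ, pow_succ, Nat.mul_succ]; exact ih.mul h

theorem isSym_zero_of_mem {n : ℕ} {x : R} (h : x ∈ sp a ^ (n + 1)) : IsSym a n x 0 :=
  ⟨0, MvPolynomial.isHomogeneous_zero _ _ _, by simp, by simpa using h⟩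

theorem IsSym.mem_succ {n : ℕ} {x : R} (h : IsSym a n x 0) : x ∈ sp a ^ (n + 1) := by
  obtain ⟨Φ, h1, h2, h3⟩ := h
  rw [map_eq_zero_iff] at h2
  have := add_mem h3 (eval_mem_pow_succ h1 h2)
  simpa using this

theorem IsSym.unique (hQ : QR a) {n : ℕ} {x : R} {σ τ} (h : IsSym a n x σ) (h' : IsSym a n x τ) :
    σ = τ := by
  have := h.add h'.neg
  rw [add_neg_cancel] at this
  obtain ⟨Φ, h1, h2, h3⟩ := this
  rw [zero_sub, neg_mem_iff] at h3
  have h4 := map_eq_zero_iff.2 (hQ n Φ h1 h3)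
  rw [h2] at h4
  exact (add_neg_eq_zero.1 h4)

theorem IsSym.eq_zero (hQ : QR a) {n : ℕ} {x : R} {σ} (h : IsSym a n x σ)
    (hx : x ∈ sp a ^ (n + 1)) : σ = 0 := h.unique hQ (isSym_zero_of_mem hx)

/-- multiplication by a form with nzd symbol is strict -/
theorem mem_pow_of_mul_mem (hQ : QR a) {s : ℕ} {f : R} {σ} (hf : IsSym a s f σ)
    (hσ : ∀ τ, σ * τ = 0 → τ = 0) {x : R} : ∀ {n : ℕ}, f * x ∈ sp a ^ (n + s) → x ∈ sp a ^ n := by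
  intro n
  induction n with
  | zero => intro _; simp
  | succ n ih =>
    intro h
    have h1 := ih (Ideal.pow_le_pow_right (by omega) h)
    obtain ⟨τ, hτ⟩ := exists_isSym h1
    have h2 := (hf.mul hτ).eq_zero hQ (by convert h using 2; omega)
    have h3 := hσ _ h2
    subst h3
    exact hτ.mem_succ

theorem mem_F_of_mul_mem (hQ : QR a) {s : ℕ} {f : R} {σ} (hf : IsSym a s f σ)
    (hσ : ∀ τ, σ * τ = 0 → τ = 0) {x : R} {n : ℕ} (h : f * x ∈ F (sp a) (n + s)) :
    x ∈ F (sp a) n := by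
  obtain ⟨N, hN⟩ := mem_F.1 h
  refine mem_F.2 ⟨N, fun m => ?_⟩
  have hσm : ∀ τ, σ ^ m * τ = 0 → τ = 0 := by
    induction m with
    | zero => simp
    | succ m ih => intro τ hτ; rw [pow_succ', mul_assoc] at hτ; exact ih _ (hσ _ hτ)
  by_cases hm : n * m ≤ N
  · rw [Nat.sub_eq_zero_of_le hm]; simp
  refine mem_pow_of_mul_mem hQ (hf.pow m) hσm ?_
  have := hN m
  rw [mul_pow] at this
  convert this using 2
  rw [add_mul]; omega

end qr
end E1

namespace E1

/-! ### The vanishing lemma -/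

section hi
universe u v
variable {R : Type u} [CommRing R] {ι : Type v} [Finite ι] {a : ι → R}

theorem X_pow_nzd {A : Type u} [CommRing A] (i : ι) (k : ℕ) (τ : MvPolynomial ι A)
    (h : MvPolynomial.X i ^ k * τ = 0) : τ = 0 :=
  ((MvPolynomial.isRegular_X (R := A) (n := i)).pow k).left.mul_left_eq_zero_iff.1 h

theorem isSym_X_pow (i : ι) (k : ℕ) : IsSym a k (a i ^ k) (MvPolynomial.X i ^ k) := by
  have := (isSym_X (a := a) i).pow k
  rwa [one_mul] at this

theorem mem_pow_of_X_mul (hQ : QR a) (i : ι) {k n : ℕ} {x : R}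
    (h : a i ^ k * x ∈ sp a ^ (n + k)) : x ∈ sp a ^ n :=
  mem_pow_of_mul_mem hQ (isSym_X_pow i k) (X_pow_nzd i k) h

theorem mem_F_of_X_mul (hQ : QR a) (i : ι) {k n : ℕ} {x : R}
    (h : a i ^ k * x ∈ F (sp a) (n + k)) : x ∈ F (sp a) n :=
  mem_F_of_mul_mem hQ (isSym_X_pow i k) (X_pow_nzd i k) h

theorem a_pow_mem (i : ι) (k : ℕ) : a i ^ k ∈ sp a ^ k :=
  Ideal.pow_mem_pow (Ideal.subset_span (Set.mem_range_self i)) k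

theorem poly_step {A : Type u} [CommRing A] {i j : ι} (hij : i ≠ j) {P Q s : ℕ}
    (hs : s < Q) {σ τ : MvPolynomial ι A} (hσ : σ.IsHomogeneous s)
    (h : MvPolynomial.X i ^ P * σ + MvPolynomial.X j ^ Q * τ = 0) : σ = 0 := by
  classical
  ext α
  rw [MvPolynomial.coeff_zero]
  by_cases hα : α.degree = s
  swap
  · exact hσ.coeff_eq_zero hα
  have h1 := congrArg (MvPolynomial.coeff (Finsupp.single i P + α)) h
  rw [MvPolynomial.coeff_add, MvPolynomial.X_pow_eq_monomial, MvPolynomial.X_pow_eq_monomial,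
    MvPolynomial.coeff_monomial_mul, MvPolynomial.coeff_monomial_mul', if_neg, add_zero, one_mul,
    MvPolynomial.coeff_zero] at h1
  · exact h1
  · intro hle
    have := hle j
    rw [Finsupp.single_eq_same, Finsupp.add_apply, Finsupp.single_eq_of_ne (Ne.symm hij), zero_add] at this
    have h2 := Finsupp.le_degree j α
    omega

theorem hi0 (hQ : QR a) {i j : ι} (hij : i ≠ j) {P Q D : ℕ} {x y : R}
    (h : a i ^ P * x + a j ^ Q * y ∈ sp a ^ (P + Q - D)) : x ∈ sp a ^ (Q - D) := by
  have key : ∀ s, s ≤ Q - D → x ∈ sp a ^ s := by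
    intro s
    induction s with
    | zero => intro _; simp
    | succ s ih =>
      intro hs
      have h1 := ih (by omega)
      have h2 : a i ^ P * x ∈ sp a ^ (P + s) := by
        rw [pow_add]; exact Ideal.mul_mem_mul (a_pow_mem i P) h1
      have h3 : a i ^ P * x + a j ^ Q * y ∈ sp a ^ (P + s + 1) :=
        Ideal.pow_le_pow_right (by omega) h
      by_cases hPs : Q ≤ P + s
      · have h4 : a j ^ Q * y ∈ sp a ^ (P + s) := by
          have := sub_mem (Ideal.pow_le_pow_right (Nat.le_succ _) h3) h2
          simpa using this
        have h5 : y ∈ sp a ^ (P + s - Q) := by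
          refine mem_pow_of_X_mul hQ j (k := Q) ?_
          rwa [Nat.sub_add_cancel hPs]
        obtain ⟨σ, hσ⟩ := exists_isSym h1
        obtain ⟨τ, hτ⟩ := exists_isSym h5
        have h6 := (isSym_X_pow (a := a) j Q).mul hτ
        rw [Nat.add_sub_cancel' hPs] at h6
        have h7 := (((isSym_X_pow (a := a) i P).mul hσ).add h6).eq_zero hQ h3
        have h8 := poly_step hij (by omega) hσ.homog h7
        subst h8
        exact hσ.mem_succ
      · have h4 : a j ^ Q * y ∈ sp a ^ (P + s + 1) :=
          Ideal.pow_le_pow_right (by omega) (Ideal.mul_mem_right _ _ (a_pow_mem j Q))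
        have h5 := sub_mem h3 h4
        rw [add_sub_cancel_right] at h5
        refine mem_pow_of_X_mul hQ i (k := P) ?_
        rwa [show s + 1 + P = P + s + 1 by omega]
  exact key _ le_rfl

/-- Boundedness of the integral closure filtration. -/
def Bdd (J : Ideal R) : Prop := ∃ c, ∀ n, F J (n + c) ≤ J ^ n

theorem Bdd.stable [IsNoetherianRing R] {J : Ideal R} (h : Bdd J) :
    ∃ n0, ∀ n, F J (n0 + n) = J ^ n * F J n0 := by
  obtain ⟨c, hc⟩ := h
  let G : J.Filtration R :=
    { N := fun n => J ^ (n - c)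
      mono := fun n => Ideal.pow_le_pow_right (by omega)
      smul_le := fun n => by
        rw [smul_eq_mul, ← pow_succ']
        exact Ideal.pow_le_pow_right (by omega) }
  let G' : J.Filtration R :=
    { N := fun n => F J n
      mono := fun n => F_anti J (Nat.le_succ n)
      smul_le := fun n => by
        rw [smul_eq_mul, mul_comm]
        refine (Ideal.mul_mono_right ?_).trans (mul_F_le J n 1)
        have := pow_le_F J 1
        rwa [pow_one] at this }
  have hG : G.Stable := ⟨c, fun n hn => by
    change J • J ^ (n - c) = J ^ (n + 1 - c)
    rw [smul_eq_mul, ← pow_succ']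
    congr 1; omega⟩
  have hle : G' ≤ G := by
    intro n
    change F J n ≤ J ^ (n - c)
    by_cases hn : n ≤ c
    · rw [Nat.sub_eq_zero_of_le hn]; simp
    · have := hc (n - c)
      rwa [Nat.sub_add_cancel (by omega)] at this
  obtain ⟨n0, hn0⟩ := Ideal.Filtration.Stable.of_le hG hle
  refine ⟨n0, fun n => ?_⟩
  induction n with
  | zero => simp
  | succ n ih =>
    have := hn0 (n0 + n) (by omega)
    change J • F J (n0 + n) = F J (n0 + n + 1) at this
    rw [show n0 + (n + 1) = n0 + n + 1 by omega, ← this, ih, smul_eq_mul, pow_succ']; ring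

theorem hi1 [IsNoetherianRing R] (hQ : QR a) (hB : Bdd (sp a)) {i j : ι} (hij : i ≠ j) {p q : ℕ}
    {x y : R} (hz : a i ^ p * x + a j ^ q * y ∈ F (sp a) (p + q)) :
    ∃ K, ∀ m n, ∀ e ∈ F (sp a) n, ∀ k ≤ m,
      x ^ k * y ^ (m - k) * e ∈ sp a ^ (q * k + p * (m - k) + n - K) := by
  obtain ⟨n0, hn0⟩ := hB.stable
  obtain ⟨c, hc⟩ := hB
  refine ⟨n0 + c, fun m => ?_⟩
  induction m with
  | zero =>
    intro n e he k hk
    obtain rfl : k = 0 := by omega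
    simp only [pow_zero, one_mul, mul_zero, zero_add, Nat.sub_zero]
    by_cases hn : n ≤ n0 + c
    · rw [Nat.sub_eq_zero_of_le hn]; simp
    · refine hc _ ((F_anti _ ?_) he); omega
  | succ m ih =>
    -- reduction to small `n`
    suffices H : ∀ n ≤ n0, ∀ e ∈ F (sp a) n, ∀ k ≤ m + 1,
        x ^ k * y ^ (m + 1 - k) * e ∈ sp a ^ (q * k + p * (m + 1 - k) + n - (n0 + c)) by
      intro n e he k hk
      by_cases hn : n ≤ n0
      · exact H n hn e he k hk
      · have h1 := hn0 (n - n0)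
        rw [Nat.add_sub_cancel' (by omega)] at h1
        rw [h1] at he
        refine Submodule.mul_induction_on he (fun g hg f hf => ?_) (fun f g hf hg => ?_)
        · have h2 := Ideal.mul_mem_mul hg (H n0 le_rfl f hf k hk)
          rw [← pow_add] at h2
          have e3 : x ^ k * y ^ (m + 1 - k) * (g * f) = g * (x ^ k * y ^ (m + 1 - k) * f) := by ring
          rw [e3]
          exact Ideal.pow_le_pow_right (by omega) h2
        · rw [mul_add]; exact add_mem hf hg
    intro n hn e he
    have hze : ∀ k ≤ m, x ^ k * y ^ (m - k) * ((a i ^ p * x + a j ^ q * y) * e) ∈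
        sp a ^ (q * k + p * (m - k) + (p + q + n) - (n0 + c)) := fun k hk =>
      ih _ _ (mul_mem_F hz he) k hk
    have top : x ^ (m + 1) * e ∈ sp a ^ (q * (m + 1) - (n0 + c - n)) := by
      refine hi0 hQ hij (P := p * (m + 1)) (y := - ((-1) ^ (m + 1) * (y ^ (m + 1) * e))) ?_
      have e1 : a i ^ (p * (m + 1)) * (x ^ (m + 1) * e)
          + a j ^ (q * (m + 1)) * (- ((-1) ^ (m + 1) * (y ^ (m + 1) * e)))
          = (∑ k ∈ Finset.range (m + 1), (a i ^ p * x) ^ k * (-(a j ^ q * y)) ^ (m + 1 - 1 - k))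
            * (a i ^ p * x - (-(a j ^ q * y))) * e := by
        rw [geom_sum₂_mul, mul_pow, neg_pow (a j ^ q * y), mul_pow, ← pow_mul, ← pow_mul]; ring
      rw [e1, Finset.sum_mul, Finset.sum_mul]
      refine Ideal.sum_mem _ fun k hk => ?_
      rw [Finset.mem_range] at hk
      have e2 : (a i ^ p * x) ^ k * (-(a j ^ q * y)) ^ (m + 1 - 1 - k) *
          (a i ^ p * x - (-(a j ^ q * y))) * e = (-1) ^ (m - k) * ((a i ^ (p * k) * a j ^ (q * (m - k)))
            * (x ^ k * y ^ (m - k) * ((a i ^ p * x + a j ^ q * y) * e))) := by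
        rw [mul_pow, neg_pow (a j ^ q * y), mul_pow, ← pow_mul, ← pow_mul, Nat.add_sub_cancel]; ring
      rw [e2]
      refine Ideal.mul_mem_left _ _ ?_
      have h1 := Ideal.mul_mem_mul (Ideal.mul_mem_mul (a_pow_mem (a := a) i (p * k))
        (a_pow_mem (a := a) j (q * (m - k)))) (hze k (by omega))
      rw [← pow_add, ← pow_add] at h1
      refine Ideal.pow_le_pow_right ?_ h1
      obtain ⟨l, rfl⟩ : ∃ l, m = k + l := ⟨m - k, by omega⟩
      rw [Nat.add_sub_cancel_left]
      have : p * (k + l + 1) + q * (k + l + 1) = p * k + q * l + q * k + p * l + p + q := by ring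
      omega
    intro k hk
    obtain ⟨l, hl⟩ : ∃ l, m + 1 = k + l := ⟨m + 1 - k, by omega⟩
    rw [hl, Nat.add_sub_cancel_left]
    clear hk
    induction l generalizing k with
    | zero =>
      rw [add_zero] at hl
      rw [← hl, pow_zero, mul_one, mul_zero, add_zero]
      refine Ideal.pow_le_pow_right ?_ top
      omega
    | succ l ihl =>
      have h1 := ihl (k + 1) (by omega)
      have h2 := hze k (by omega)
      have hml : m - k = l := by omega
      rw [hml] at h2
      by_cases hle : q * k + p * (l + 1) + n ≤ n0 + c
      · rw [Nat.sub_eq_zero_of_le hle]; simp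
      refine mem_pow_of_X_mul hQ j (k := q) ?_
      have h3 := Ideal.mul_mem_mul (a_pow_mem (a := a) i p) h1
      rw [← pow_add] at h3
      have e1 : q * (k + 1) + p * l = q * k + p * l + q := by ring
      have e2 : q * k + p * (l + 1) = q * k + p * l + p := by ring
      have h4 := sub_mem (Ideal.pow_le_pow_right
        (show q * k + p * (l + 1) + n - (n0 + c) + q ≤ _ by omega) h2)
        (Ideal.pow_le_pow_right (show q * k + p * (l + 1) + n - (n0 + c) + q ≤ _ by omega) h3)
      convert h4 using 1
      ring

/-- Vanishing lemma. -/
theorem hi [IsNoetherianRing R] (hQ : QR a) (hB : Bdd (sp a)) {i j : ι} (hij : i ≠ j) {p q : ℕ}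
    {x y : R} (hz : a i ^ p * x + a j ^ q * y ∈ F (sp a) (p + q)) : x ∈ F (sp a) q := by
  obtain ⟨K, hK⟩ := hi1 hQ hB hij hz
  refine mem_F.2 ⟨K, fun n => ?_⟩
  have := hK n 0 1 (by rw [F_zero]; trivial) n le_rfl
  simpa using this

end hi
end E1

namespace E1

/-! ### The three-dimensional core -/

section core
universe u v
variable {R : Type u} [CommRing R]

theorem mul_ne_topE {x y : ℕ∞} (hx : x ≠ ⊤) (hy : y ≠ ⊤) : x * y ≠ ⊤ := by
  lift x to ℕ using hx
  lift y to ℕ using hy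
  exact_mod_cast ENat.natCast_ne_top (x * y)

theorem le_colon1 {I K : Ideal R} {f : R} : K ≤ I.colon ({f} : Set R) ↔ ∀ x ∈ K, x * f ∈ I :=
  ⟨fun h x hx => mem_colon1.1 (h hx), fun h x hx => mem_colon1.2 (h x hx)⟩

theorem len_le_of_colon {I K : Ideal R} {f : R} (h : ∀ x ∈ K, x * f ∈ I) :
    len I ≤ len K + len (I ⊔ Ideal.span {f}) := by
  rw [len_colon_add I f]
  gcongr
  exact len_anti (le_colon1.2 h)

theorem le_len_of_colon {I K : Ideal R} {f : R} (h : ∀ x, x * f ∈ I → x ∈ K) :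
    len K + len (I ⊔ Ideal.span {f}) ≤ len I := by
  rw [len_colon_add I f]
  gcongr
  exact len_anti (fun x hx => h x (mem_colon1.1 hx))

theorem span_pow_le (b : R) {k l : ℕ} (h : k ≤ l) :
    Ideal.span {b ^ l} ≤ Ideal.span ({b ^ k} : Set R) := by
  rw [Ideal.span_singleton_le_span_singleton]
  exact pow_dvd_pow b h

theorem colon_step (I : Ideal R) (b : R) (k : ℕ) (x : R) (hx : x ∈ I ⊔ Ideal.span {b}) :
    x * b ^ k ∈ I ⊔ Ideal.span {b ^ (k + 1)} := by
  obtain ⟨y, hy, z, hz, rfl⟩ := Submodule.mem_sup.1 hx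
  obtain ⟨w, rfl⟩ := Ideal.mem_span_singleton'.1 hz
  rw [add_mul]
  refine add_mem (Ideal.mem_sup_left (Ideal.mul_mem_right _ _ hy)) (Ideal.mem_sup_right ?_)
  rw [mul_assoc, ← pow_succ']
  exact Ideal.mul_mem_left _ _ (Ideal.mem_span_singleton_self _)

theorem len_pow_le (I : Ideal R) (b : R) (k : ℕ) :
    len (I ⊔ Ideal.span {b ^ k}) ≤ k * len (I ⊔ Ideal.span {b}) := by
  induction k with
  | zero => simp [len_eq_zero]
  | succ k ih =>
    refine (len_le_of_colon (colon_step I b k)).trans ?_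
    push_cast
    rw [add_mul, one_mul, add_comm]
    gcongr
    refine le_trans (len_anti ?_) ih
    exact sup_le (le_sup_left.trans le_sup_left) le_sup_right

theorem pow_colon_eq (I : Ideal R) (b : R) (k : ℕ) (hfin : len (I ⊔ Ideal.span {b}) ≠ ⊤)
    (h : (k + 1 : ℕ) * len (I ⊔ Ideal.span {b}) ≤ len (I ⊔ Ideal.span {b ^ (k + 1)}))
    {x : R} (hx : x * b ^ k ∈ I ⊔ Ideal.span {b ^ (k + 1)}) : x ∈ I ⊔ Ideal.span {b} := by
  have h1 := len_colon_add (I ⊔ Ideal.span {b ^ (k + 1)}) (b ^ k)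
  have h2 := len_pow_le I b k
  have h3 : I ⊔ Ideal.span {b ^ (k + 1)} ⊔ Ideal.span {b ^ k} = I ⊔ Ideal.span {b ^ k} := by
    rw [sup_assoc, sup_eq_right.2 (span_pow_le b (Nat.le_succ k))]
  rw [h3] at h1
  have h4 : I ⊔ Ideal.span {b} ≤ (I ⊔ Ideal.span {b ^ (k + 1)}).colon ({b ^ k} : Set R) :=
    le_colon1.2 (colon_step I b k)
  have h5 : len (I ⊔ Ideal.span {b}) ≤ len ((I ⊔ Ideal.span {b ^ (k + 1)}).colon ({b ^ k} : Set R)) := by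
    rw [h1] at h
    lift len (I ⊔ Ideal.span {b}) to ℕ using hfin with p hp
    have hq : len (I ⊔ Ideal.span {b ^ k}) ≠ ⊤ :=
      ne_top_of_le_ne_top (by exact_mod_cast ENat.natCast_ne_top (k * p)) h2
    lift len (I ⊔ Ideal.span {b ^ k}) to ℕ using hq with q hq
    have h6 : (((k + 1) * p : ℕ) : ℕ∞) ≤
      len ((I ⊔ Ideal.span {b ^ (k + 1)}).colon ({b ^ k} : Set R)) + q := by exact_mod_cast h
    have h2' : q ≤ k * p := by exact_mod_cast h2
    by_cases ht : len ((I ⊔ Ideal.span {b ^ (k + 1)}).colon ({b ^ k} : Set R)) = ⊤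
    · rw [ht]; exact le_top
    · lift len ((I ⊔ Ideal.span {b ^ (k + 1)}).colon ({b ^ k} : Set R)) to ℕ using ht with r hr
      have h7 : (k + 1) * p ≤ r + q := by exact_mod_cast h6
      have : p ≤ r := by nlinarith
      exact_mod_cast this
  rw [eq_of_len_le h4 hfin h5]
  exact mem_colon1.2 hx

variable {a : Fin 3 → R}

theorem sp_fin3 (a : Fin 3 → R) :
    sp a = Ideal.span {a 0} ⊔ Ideal.span {a 1} ⊔ Ideal.span {a 2} := by
  rw [sp, ← Ideal.span_union, ← Ideal.span_union]
  congr 1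
  ext x
  simp [Fin.exists_fin_succ, eq_comm]
  tauto

def Q3 (a : Fin 3 → R) (i j k : ℕ) : Ideal R :=
  Ideal.span {a 0 ^ i} ⊔ Ideal.span {a 1 ^ j} ⊔ Ideal.span {a 2 ^ k}

theorem a_pow_mul_mem_F {ι : Type v} [Finite ι] {a : ι → R} (i : ι) {m n k : ℕ} (h : k = m + n)
    {x : R} (hx : x ∈ F (sp a) m) :
    x * a i ^ n ∈ F (sp a) k := by
  subst h
  exact mul_mem_F hx (pow_le_F _ _ (a_pow_mem i n))

theorem core_ineq [IsNoetherianRing R] (hQ : QR a) (hB : Bdd (sp a)) (K : ℕ)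
    (hf : ∀ n, len (F (sp a) n) ≠ ⊤) :
    len (F (sp a) (3 * K)) + 3 * len (F (sp a) K) ≤
      3 * len (F (sp a) (2 * K)) + len (Q3 a K K K ⊔ F (sp a) (3 * K)) := by
  set A := F (sp a) (3 * K) ⊔ Ideal.span {a 0 ^ K} with hA
  set A' := F (sp a) (2 * K) ⊔ Ideal.span {a 0 ^ K} with hA'
  set B := A ⊔ Ideal.span {a 1 ^ K} with hBB
  set B' := A' ⊔ Ideal.span {a 1 ^ K} with hB'
  have h1 : len (F (sp a) (3 * K)) ≤ len (F (sp a) (2 * K)) + len A :=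
    len_le_of_colon fun x hx => a_pow_mul_mem_F 0 (by ring) hx
  have hA1 : ∀ (i : Fin 3), ∀ x ∈ A', x * a i ^ K ∈ A := by
    intro i x hx
    obtain ⟨y, hy, z, hz, rfl⟩ := Submodule.mem_sup.1 hx
    rw [add_mul]
    exact add_mem (Ideal.mem_sup_left (a_pow_mul_mem_F i (by ring) hy))
      (Ideal.mem_sup_right (Ideal.mul_mem_right _ _ hz))
  have h2 : len A ≤ len A' + len B := len_le_of_colon (hA1 1)
  have h3 : len B ≤ len B' + len (B ⊔ Ideal.span {a 2 ^ K}) := len_le_of_colon (by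
    intro x hx
    obtain ⟨y, hy, z, hz, rfl⟩ := Submodule.mem_sup.1 hx
    rw [add_mul]
    exact add_mem (Ideal.mem_sup_left (hA1 2 y hy))
      (Ideal.mem_sup_right (Ideal.mul_mem_right _ _ hz)))
  have h4 : len (F (sp a) K) + len A' ≤ len (F (sp a) (2 * K)) := le_len_of_colon (by
    intro x hx
    refine mem_F_of_X_mul hQ 0 (k := K) ?_
    rwa [mul_comm, ← two_mul])
  have h5 : len (F (sp a) K) + len B' ≤ len A' := le_len_of_colon (by
    intro x hx
    obtain ⟨y, hy, z, hz, he⟩ := Submodule.mem_sup.1 hx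
    obtain ⟨w, rfl⟩ := Ideal.mem_span_singleton'.1 hz
    refine hi hQ hB (i := 1) (j := 0) (p := K) (by decide) (y := -w) ?_
    rw [← two_mul]
    convert hy using 1
    linear_combination -he)
  have h6 : Q3 a K K K ⊔ F (sp a) (3 * K) = B ⊔ Ideal.span {a 2 ^ K} := by
    rw [hBB, hA, Q3]; ac_rfl
  rw [h6]
  lift len (F (sp a) K) to ℕ using hf _ with p hp
  lift len (F (sp a) (2 * K)) to ℕ using hf _ with q hq
  lift len (F (sp a) (3 * K)) to ℕ using hf _ with r hr
  have fA' : len A' ≠ ⊤ := ne_top_of_le_ne_top (ENat.natCast_ne_top q) (le_trans le_add_self h4)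
  lift len A' to ℕ using fA' with s hs
  have fB' : len B' ≠ ⊤ := ne_top_of_le_ne_top (ENat.natCast_ne_top s) (le_trans le_add_self h5)
  lift len B' to ℕ using fB' with t ht
  by_cases hl : len (B ⊔ Ideal.span {a 2 ^ K}) = ⊤
  · rw [hl]; simp
  lift len (B ⊔ Ideal.span {a 2 ^ K}) to ℕ using hl with w hw
  have fB : len B ≠ ⊤ := ne_top_of_le_ne_top (ENat.natCast_ne_top (t + w)) (by exact_mod_cast h3)
  lift len B to ℕ using fB with w' hw'
  have fA : len A ≠ ⊤ := ne_top_of_le_ne_top (ENat.natCast_ne_top (s + w')) (by exact_mod_cast h2)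
  lift len A to ℕ using fA with w'' hw''
  norm_cast at *
  omega

theorem core3 [IsNoetherianRing R] (hQ : QR a) (hB : Bdd (sp a))
    (hf : ∀ n, len (F (sp a) n) ≠ ⊤) (hJ : len (sp a) ≠ ⊤) (K0 : ℕ)
    (hH : ∀ K ≥ K0, len (F (sp a) (3 * K)) + 3 * len (F (sp a) K) =
      3 * len (F (sp a) (2 * K)) + (K ^ 3 : ℕ) * len (sp a)) :
    ∀ n, F (sp a) (n + 2) ≤ sp a ^ n := by
  have hle : ∀ i j k, len (Q3 a i j k) ≤ (i * j * k : ℕ) * len (sp a) := by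
    intro i j k
    have h1 := len_pow_le (Ideal.span {a 0 ^ i} ⊔ Ideal.span {a 1 ^ j}) (a 2) k
    have h2 := len_pow_le (Ideal.span {a 0 ^ i} ⊔ Ideal.span {a 2}) (a 1) j
    have h3 := len_pow_le (Ideal.span {a 1} ⊔ Ideal.span {a 2}) (a 0) i
    have e1 : Ideal.span {a 0 ^ i} ⊔ Ideal.span {a 1 ^ j} ⊔ Ideal.span {a 2} =
      Ideal.span {a 0 ^ i} ⊔ Ideal.span {a 2} ⊔ Ideal.span {a 1 ^ j} := by ac_rfl
    have e2 : Ideal.span {a 0 ^ i} ⊔ Ideal.span {a 2} ⊔ Ideal.span {a 1} =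
      Ideal.span {a 1} ⊔ Ideal.span {a 2} ⊔ Ideal.span {a 0 ^ i} := by ac_rfl
    have e3 : Ideal.span {a 1} ⊔ Ideal.span {a 2} ⊔ Ideal.span {a 0} = sp a := by
      rw [sp_fin3]; ac_rfl
    rw [e1] at h1
    rw [e2] at h2
    rw [e3] at h3
    refine h1.trans ((mul_le_mul_right (h2.trans (mul_le_mul_right h3 _)) _).trans (le_of_eq ?_))
    push_cast
    ring
  -- the main equality
  have hmain : ∀ K ≥ K0, (K ^ 3 : ℕ) * len (sp a) ≤ len (Q3 a K K K) ∧
      F (sp a) (3 * K) ≤ Q3 a K K K := by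
    intro K hK
    have h1 := core_ineq hQ hB K hf
    rw [hH K hK] at h1
    have h2 : (K ^ 3 : ℕ) * len (sp a) ≤ len (Q3 a K K K ⊔ F (sp a) (3 * K)) := by
      refine (ENat.add_le_add_iff_left ?_).1 h1
      exact mul_ne_topE (by exact_mod_cast ENat.natCast_ne_top 3) (hf _)
    have h3 : len (Q3 a K K K ⊔ F (sp a) (3 * K)) ≤ len (Q3 a K K K) := len_anti le_sup_left
    have h4 := hle K K K
    have h5 : (K ^ 3 : ℕ) = K * K * K := by ring
    refine ⟨h2.trans h3, ?_⟩
    have h6 : Q3 a K K K = Q3 a K K K ⊔ F (sp a) (3 * K) := by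
      refine eq_of_len_le le_sup_left ?_ ?_
      · refine ne_top_of_le_ne_top ?_ h4
        exact mul_ne_topE (ENat.natCast_ne_top _) hJ
      · rw [h5] at h2; exact h4.trans h2
    rw [h6]; exact le_sup_right
  have hcolon : ∀ K ≥ K0, ∀ x, x * (a 0 ^ K * a 1 ^ K * a 2 ^ K) ∈ Q3 a (K + 1) (K + 1) (K + 1) →
      x ∈ sp a := by
    intro K hK x hx
    obtain ⟨h1, -⟩ := hmain (K + 1) (by omega)
    have f1 : ∀ i j k, len (Q3 a i j k) ≠ ⊤ := fun i j k =>
      ne_top_of_le_ne_top (mul_ne_topE (ENat.natCast_ne_top _) hJ) (hle i j k)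
    have e0 : ∀ i j k, Ideal.span {a 1 ^ j} ⊔ Ideal.span {a 2 ^ k} ⊔ Ideal.span {a 0 ^ i} = Q3 a i j k := by
      intro i j k; rw [Q3]; ac_rfl
    have e1 : ∀ i j k, Ideal.span {a 0 ^ i} ⊔ Ideal.span {a 2 ^ k} ⊔ Ideal.span {a 1 ^ j} = Q3 a i j k := by
      intro i j k; rw [Q3]; ac_rfl
    have e2 : ∀ i j k, Ideal.span {a 0 ^ i} ⊔ Ideal.span {a 1 ^ j} ⊔ Ideal.span {a 2 ^ k} = Q3 a i j k := by
      intro i j k; rw [Q3]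
    have e0' := fun j k => e0 1 j k
    have e1' := fun i k => e1 i 1 k
    have e2' := fun i j => e2 i j 1
    rw [pow_one] at e0' e1' e2'
    -- lower bounds
    have l1 : len (Q3 a (K+1) (K+1) (K+1)) ≤ (K + 1 : ℕ) * len (Q3 a 1 (K+1) (K+1)) := by
      rw [← e0, ← e0']; exact len_pow_le _ _ _
    have l2 : len (Q3 a 1 (K+1) (K+1)) ≤ (K + 1 : ℕ) * len (Q3 a 1 1 (K+1)) := by
      rw [← e1, ← e1']; exact len_pow_le _ _ _
    have l3 : len (Q3 a 1 1 (K+1)) ≤ (K + 1 : ℕ) * len (Q3 a 1 1 1) := by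
      rw [← e2, ← e2']; exact len_pow_le _ _ _
    have hJ1 : Q3 a 1 1 1 = sp a := by rw [Q3, sp_fin3]; simp
    have b1 := hle 1 (K+1) (K+1)
    have b2 := hle 1 1 (K+1)
    have c1 : (K + 1 : ℕ) * len (Q3 a 1 (K+1) (K+1)) ≤ len (Q3 a (K+1) (K+1) (K+1)) := by
      refine le_trans (mul_le_mul_right b1 _) (le_trans (le_of_eq ?_) h1)
      push_cast; ring
    have p0 : 0 < K + 1 := by omega
    have c2 : (K + 1 : ℕ) * len (Q3 a 1 1 (K+1)) ≤ len (Q3 a 1 (K+1) (K+1)) := by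
      have := h1.trans l1
      have h7 : (K+1 : ℕ) * ((K+1 : ℕ) * len (Q3 a 1 1 (K+1))) ≤
          (K+1 : ℕ) * len (Q3 a 1 (K+1) (K+1)) :=
        le_trans (mul_le_mul_right (mul_le_mul_right b2 _) _)
          (le_trans (le_of_eq (by push_cast; ring)) this)
      lift len (Q3 a 1 1 (K+1)) to ℕ using f1 _ _ _ with p hp
      lift len (Q3 a 1 (K+1) (K+1)) to ℕ using f1 _ _ _ with q hq
      norm_cast at *
      exact Nat.le_of_mul_le_mul_left h7 p0
    have c3 : (K + 1 : ℕ) * len (Q3 a 1 1 1) ≤ len (Q3 a 1 1 (K+1)) := by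
      have := h1.trans (l1.trans (mul_le_mul_right l2 _))
      rw [hJ1]
      lift len (Q3 a 1 1 (K+1)) to ℕ using f1 _ _ _ with p hp
      lift len (sp a) to ℕ using hJ with q hq
      norm_cast at *
      have h8 : (K+1) * ((K+1) * ((K+1) * q)) ≤ (K+1) * ((K+1) * p) := by
        refine le_trans (le_of_eq ?_) this; ring
      exact Nat.le_of_mul_le_mul_left (Nat.le_of_mul_le_mul_left h8 p0) p0
    have d1 : x * a 1 ^ K * a 2 ^ K ∈ Q3 a 1 (K+1) (K+1) := by
      rw [← e0']
      refine pow_colon_eq _ (a 0) K (by rw [e0']; exact f1 _ _ _) (by rw [e0, e0']; exact c1) ?_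
      rw [e0]; convert hx using 1; ring
    have d2 : x * a 2 ^ K ∈ Q3 a 1 1 (K+1) := by
      rw [← e1']
      refine pow_colon_eq _ (a 1) K (by rw [e1']; exact f1 _ _ _) (by rw [e1, e1']; exact c2) ?_
      rw [e1]; convert d1 using 1; ring
    rw [← hJ1, ← e2']
    refine pow_colon_eq _ (a 2) K (by rw [e2']; exact f1 _ _ _) (by rw [e2, e2']; exact c3) ?_
    rw [e2]; exact d2
  -- conclusion
  intro n x hx
  suffices H : ∀ j ≤ n, x ∈ sp a ^ j from H n le_rfl
  intro j
  induction j with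
  | zero => intro _; simp
  | succ j ih =>
    intro hj
    have hxj := ih (by omega)
    rw [sp, Ideal.mem_span_pow_iff_exists_isHomogeneous] at hxj
    obtain ⟨p, hp, hpx⟩ := hxj
    have hcoef : ∀ α ∈ p.support, p.coeff α ∈ sp a := by
      intro α hα
      have hdα : α.degree = j := by
        by_contra hne
        exact (MvPolynomial.mem_support_iff.1 hα) (hp.coeff_eq_zero hne)
      set K := K0 + j with hK
      have hαK : ∀ i, α i ≤ K := fun i => (Finsupp.le_degree i α).trans (by omega)
      apply hcolon K (by omega)
      have key : x * ∏ i, a i ^ (K - α i) ∈ Q3 a (K+1) (K+1) (K+1) := by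
        refine (hmain (K+1) (by omega)).2 ?_
        have h1 : (∏ i, a i ^ (K - α i)) ∈ F (sp a) (3 * K - j) := by
          refine pow_le_F _ _ ?_
          have h2 : ∑ i, (K - α i) = 3 * K - j := by
            rw [Finset.sum_tsub_distrib _ (fun i _ => hαK i), ← Finsupp.degree_eq_sum, hdα]; simp
          rw [← h2, ← Finset.prod_pow_eq_pow_sum]
          exact Ideal.prod_mem_prod fun i _ => a_pow_mem i _
        refine F_anti _ ?_ (mul_mem_F hx h1)
        omega
      rw [← hpx, MvPolynomial.eval_eq', Finset.sum_mul] at key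
      rw [← Finset.add_sum_erase _ _ hα] at key
      have hrest : ∑ x ∈ p.support.erase α, ((p.coeff x) * ∏ i, a i ^ x i) *
          ∏ i, a i ^ (K - α i) ∈ Q3 a (K+1) (K+1) (K+1) := by
        refine Ideal.sum_mem _ fun β hβ => ?_
        rw [Finset.mem_erase] at hβ
        have hdβ : β.degree = j := by
          by_contra hne
          exact (MvPolynomial.mem_support_iff.1 hβ.2) (hp.coeff_eq_zero hne)
        obtain ⟨i, hi⟩ : ∃ i, α i < β i := by
          by_contra hcon
          push Not at hcon
          apply hβ.1
          have hle' : β ≤ α := fun i => hcon i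
          have h3 : (α - β).degree = 0 := by
            have := congrArg Finsupp.degree (tsub_add_cancel_of_le hle')
            rw [map_add] at this; omega
          rw [Finsupp.degree_eq_zero_iff] at h3
          exact le_antisymm hle' (tsub_eq_zero_iff_le.1 h3)
        rw [mul_assoc, ← Finset.prod_mul_distrib]
        refine Ideal.mul_mem_left _ _ ?_
        refine Ideal.mem_of_dvd _ (Finset.dvd_prod_of_mem _ (Finset.mem_univ i)) ?_
        rw [← pow_add]
        have h4 : a i ^ (K+1) ∈ Q3 a (K+1) (K+1) (K+1) := by
          rw [Q3]
          fin_cases i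
          · exact Ideal.mem_sup_left (Ideal.mem_sup_left (Ideal.mem_span_singleton_self _))
          · exact Ideal.mem_sup_left (Ideal.mem_sup_right (Ideal.mem_span_singleton_self _))
          · exact Ideal.mem_sup_right (Ideal.mem_span_singleton_self _)
        have := hαK i
        exact Ideal.mem_of_dvd _ (pow_dvd_pow _ (by omega)) h4
      have key2 := (Submodule.add_mem_iff_left _ hrest).1 key
      convert key2 using 1
      have h5 : ∀ i, a i ^ α i * a i ^ (K - α i) = a i ^ K := fun i => by
        rw [← pow_add, Nat.add_sub_cancel' (hαK i)]
      rw [mul_assoc (p.coeff α), ← Finset.prod_mul_distrib, Finset.prod_congr rfl (fun i _ => h5 i),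
        Fin.prod_univ_three]
    rw [← hpx, MvPolynomial.eval_eq', pow_succ']
    refine Ideal.sum_mem _ fun α hα => ?_
    refine Ideal.mul_mem_mul (hcoef α hα) ?_
    have hdα : α.degree = j := by
      by_contra hne
      exact (MvPolynomial.mem_support_iff.1 hα) (hp.coeff_eq_zero hne)
    rw [← hdα, Finsupp.degree_eq_sum, ← Finset.prod_pow_eq_pow_sum]
    exact Ideal.prod_mem_prod fun i _ => a_pow_mem i _

end core
end E1

namespace E1

/-! ### Counting with monomials -/

section count
universe u v
variable {R : Type u} [CommRing R] {d : ℕ} {a : Fin d → R}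

/-- exponents of degree `n` -/
def Ex (d n : ℕ) : Finset (Fin d →₀ ℕ) := Finset.finsuppAntidiag Finset.univ n

theorem mem_Ex {d n : ℕ} {α : Fin d →₀ ℕ} : α ∈ Ex d n ↔ α.degree = n := by
  rw [Ex, Finset.mem_finsuppAntidiag, Finsupp.degree_eq_sum]
  simp

theorem card_Ex (d n : ℕ) (hd : 0 < d) : (Ex d n).card = (n + d - 1).choose (d - 1) := by
  rw [Ex, Finset.card_finsuppAntidiag_nat_eq_choose, Finset.card_univ, Fintype.card_fin]
  rw [← Nat.choose_symm (by omega)]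
  congr 1 <;> omega

def mon (a : Fin d → R) (α : Fin d →₀ ℕ) : R := ∏ i, a i ^ α i

theorem mon_mem (α : Fin d →₀ ℕ) : mon a α ∈ sp a ^ α.degree := by
  rw [mon, Finsupp.degree_eq_sum, ← Finset.prod_pow_eq_pow_sum]
  exact Ideal.prod_mem_prod fun i _ => a_pow_mem i _

/-- the form with given coefficients -/
noncomputable def form (n : ℕ) (c : (Fin d →₀ ℕ) → R) : MvPolynomial (Fin d) R :=
  ∑ α ∈ Ex d n, MvPolynomial.monomial α (c α)

theorem form_homog (n : ℕ) (c : (Fin d →₀ ℕ) → R) : (form n c).IsHomogeneous n :=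
  MvPolynomial.IsHomogeneous.sum _ _ _ fun α hα =>
    MvPolynomial.isHomogeneous_monomial _ (mem_Ex.1 hα)

theorem form_coeff {n : ℕ} {c : (Fin d →₀ ℕ) → R} {α} (hα : α ∈ Ex d n) :
    (form n c).coeff α = c α := by
  simp [form, MvPolynomial.coeff_sum, MvPolynomial.coeff_monomial, hα]

theorem form_eval (n : ℕ) (c : (Fin d →₀ ℕ) → R) :
    MvPolynomial.eval a (form n c) = ∑ α ∈ Ex d n, c α * mon a α := by
  rw [form, map_sum]
  refine Finset.sum_congr rfl fun α _ => ?_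
  rw [MvPolynomial.eval_monomial, mon, Finsupp.prod_fintype _ _ (by simp)]

theorem exists_form {n : ℕ} {x : R} (hx : x ∈ sp a ^ n) :
    ∃ c : (Fin d →₀ ℕ) → R, ∑ α ∈ Ex d n, c α * mon a α = x := by
  obtain ⟨Φ, h1, rfl⟩ := (Ideal.mem_span_pow_iff_exists_isHomogeneous a _).1 hx
  refine ⟨fun α => Φ.coeff α, ?_⟩
  rw [← form_eval]
  congr 1
  ext α
  by_cases hα : α ∈ Ex d n
  · rw [form_coeff hα]
  · rw [(form_homog n _).coeff_eq_zero (fun h => hα (mem_Ex.2 h)),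
      h1.coeff_eq_zero (fun h => hα (mem_Ex.2 h))]

theorem pow_eq_span (n : ℕ) : sp a ^ n = Ideal.span (mon a '' (Ex d n : Set (Fin d →₀ ℕ))) := by
  apply le_antisymm
  · intro x hx
    obtain ⟨c, rfl⟩ := exists_form hx
    exact Ideal.sum_mem _ fun α hα => Ideal.mul_mem_left _ _
      (Ideal.subset_span ⟨α, hα, rfl⟩)
  · rw [Ideal.span_le]
    rintro _ ⟨α, hα, rfl⟩
    have := mon_mem (a := a) α
    rwa [mem_Ex.1 hα] at this

theorem len_pow_succ (hQ : QR a) (n : ℕ) :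
    len (sp a ^ (n + 1)) = len (sp a ^ n) + (Ex d n).card * len (sp a) := by
  have e : sp a ^ (n + 1) ⊔ Ideal.span (mon a '' (Ex d n : Set (Fin d →₀ ℕ))) = sp a ^ n := by
    rw [← pow_eq_span, sup_eq_right]
    exact Ideal.pow_le_pow_right (Nat.le_succ n)
  apply le_antisymm
  · have := len_upper (Ex d n) (mon a) (fun _ => sp a) (sp a ^ (n + 1)) (by
      intro α hα c hc
      rw [pow_succ']
      refine Ideal.mul_mem_mul hc ?_
      have := mon_mem (a := a) α
      rwa [mem_Ex.1 hα] at this)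
    rw [e] at this
    simpa using this
  · have := len_lower (Ex d n) (mon a) (fun _ => sp a) (sp a ^ (n + 1)) (by
      intro c hc α hα
      rw [← form_eval] at hc
      have := hQ n _ (form_homog n c) hc α
      rwa [form_coeff hα] at this)
    rw [e] at this
    simpa using this

theorem len_pow_eq (hQ : QR a) (hd : 0 < d) (n : ℕ) :
    len (sp a ^ n) = ((n + d - 1).choose d : ℕ) * len (sp a) := by
  induction n with
  | zero =>
    rw [pow_zero, Ideal.one_eq_top, len_eq_zero.2 rfl, Nat.choose_eq_zero_of_lt (by omega)]
    simp
  | succ n ih =>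
    rw [len_pow_succ hQ, ih, card_Ex d n hd, ← add_mul]
    congr 1
    have h1 : n + 1 + d - 1 = (n + d - 1) + 1 := by omega
    obtain ⟨d', rfl⟩ : ∃ d', d = d' + 1 := ⟨d - 1, by omega⟩
    rw [h1, Nat.choose_succ_succ]
    push_cast
    rw [add_comm]

theorem un_quot [IsLocalRing R] {J : Ideal R} {N : ℕ} (h : maximalIdeal R ^ N ≤ J) :
    UN (R ⧸ J) := by
  intro x
  obtain ⟨x, rfl⟩ := Ideal.Quotient.mk_surjective x
  by_cases hx : IsUnit x
  · exact Or.inl (hx.map _)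
  · right
    refine ⟨N, ?_⟩
    rw [← map_pow, Ideal.Quotient.eq_zero_iff_mem]
    exact h (Ideal.pow_mem_pow ((mem_maximalIdeal x).2 hx) N)

/-- residual coefficients -/
theorem coeff_mem_max [IsLocalRing R] (hQ : QR a) (hJm : sp a ≤ maximalIdeal R)
    {n : ℕ} {Φ : MvPolynomial (Fin d) R} (hΦ : Φ.IsHomogeneous n)
    (h : MvPolynomial.eval a Φ ∈ F (sp a) (n + 1)) (α) : Φ.coeff α ∈ maximalIdeal R := by
  obtain ⟨N, hN⟩ := mem_F.1 h
  have h1 := (isSym_eval (a := a) hΦ).pow (N + 1)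
  have h2 := hN (N + 1)
  have h3 := h1.eq_zero hQ (Ideal.pow_le_pow_right (by
    have : (n + 1) * (N + 1) = n * (N + 1) + N + 1 := by ring
    omega) h2)
  have h4 : IsNilpotent (MvPolynomial.map (Ideal.Quotient.mk (sp a)) Φ) := ⟨_, h3⟩
  rw [MvPolynomial.isNilpotent_iff] at h4
  obtain ⟨k, hk⟩ := h4 α
  rw [MvPolynomial.coeff_map, ← map_pow, Ideal.Quotient.eq_zero_iff_mem] at hk
  exact (Ideal.IsPrime.mem_of_pow_mem inferInstance _ (hJm hk))

theorem coeff_mem_max' [IsLocalRing R] (hQ : QR a) (hJm : sp a ≤ maximalIdeal R)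
    {n : ℕ} {c : (Fin d →₀ ℕ) → R} 
    (h : ∑ α ∈ Ex d n, c α * mon a α ∈ F (sp a) (n + 1)) (α) (hα : α ∈ Ex d n) :
    c α ∈ maximalIdeal R := by
  rw [← form_eval] at h
  have := coeff_mem_max hQ hJm (form_homog n c) h α
  rwa [form_coeff hα] at this

theorem dvd_of_int {A : Type u} [CommRing A] [IsDomain A] [IsIntegrallyClosed A] {f g : A}
    (hf : f ≠ 0) {N : ℕ} (hN : 0 < N) (b : ℕ → A)
    (h : g ^ N + ∑ i ∈ Finset.Icc 1 N, b i * f ^ i * g ^ (N - i) = 0) : f ∣ g := by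
  let K := FractionRing A
  have hf' : algebraMap A K f ≠ 0 := by
    rwa [Ne, FaithfulSMul.algebraMap_eq_zero_iff]
  have hIntg : IsIntegral A (algebraMap A K g / algebraMap A K f) := by
    refine ⟨X ^ N + ∑ i ∈ Finset.Icc 1 N, C (b i) * X ^ (N - i), ?_, ?_⟩
    · refine monic_X_pow_add ?_
      refine lt_of_le_of_lt (degree_sum_le _ _) ?_
      rw [Finset.sup_lt_iff (by exact_mod_cast WithBot.bot_lt_coe N)]
      intro i hi
      rw [Finset.mem_Icc] at hi
      refine lt_of_le_of_lt (degree_C_mul_X_pow_le _ _) ?_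
      exact_mod_cast (by omega : N - i < N)
    · rw [eval₂_add, eval₂_pow, eval₂_X, eval₂_finsetSum]
      have h2 := congrArg (fun z => algebraMap A K z / algebraMap A K f ^ N) h
      simp only [map_add, map_pow, map_sum, map_mul, map_zero, zero_div, add_div, Finset.sum_div] at h2
      rw [← h2, div_pow]
      congr 1
      refine Finset.sum_congr rfl fun i hi => ?_
      rw [Finset.mem_Icc] at hi
      rw [eval₂_mul, eval₂_C, eval₂_pow, eval₂_X, div_pow]
      have e : algebraMap A K f ^ N = algebraMap A K f ^ i * algebraMap A K f ^ (N - i) := by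
        rw [← pow_add]; congr 1; omega
      rw [e, mul_right_comm, mul_comm (algebraMap A K f ^ i) (algebraMap A K f ^ (N - i)),
        mul_div_mul_right _ _ (pow_ne_zero _ hf'), mul_div_assoc]
  obtain ⟨h, hh⟩ := IsIntegrallyClosed.isIntegral_iff.1 hIntg
  refine ⟨h, ?_⟩
  apply FaithfulSMul.algebraMap_injective A K
  rw [map_mul, hh, mul_div_cancel₀ _ hf']

theorem hc_mul {A : Type u} [CommRing A] {s : ℕ} {P : MvPolynomial (Fin d) A}
    (hP : P.IsHomogeneous s) (θ : MvPolynomial (Fin d) A) :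
    MvPolynomial.homogeneousComponent (s + 1) (P * θ) =
      P * MvPolynomial.homogeneousComponent 1 θ := by
  have h : ∀ i, MvPolynomial.homogeneousComponent (s + 1)
      (P * MvPolynomial.homogeneousComponent i θ) =
      if i = 1 then P * MvPolynomial.homogeneousComponent 1 θ else 0 := by
    intro i
    rw [MvPolynomial.homogeneousComponent_of_mem
      (hP.mul (MvPolynomial.homogeneousComponent_isHomogeneous i θ))]
    by_cases hi : i = 1
    · subst hi; simp
    · rw [if_neg hi, if_neg (by omega)]
  conv_lhs => rw [← MvPolynomial.sum_homogeneousComponent θ, Finset.mul_sum, map_sum]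
  simp only [h]
  rw [Finset.sum_ite_eq']
  split_ifs with h1
  · rfl
  · rw [MvPolynomial.homogeneousComponent_eq_zero, mul_zero]
    rw [Finset.mem_range] at h1; omega

/-- the key non-membership -/
theorem z_indep [IsLocalRing R] [IsNoetherianRing R] (hQ : QR a) (hm : F (sp a) 1 = maximalIdeal R)
    {N0 : ℕ} (hN0 : maximalIdeal R ^ N0 ≤ sp a) {z : R} (hzm : z ∈ maximalIdeal R)
    (hz : z ∉ F (sp a) 2 ⊔ sp a) {s : ℕ} (c : (Fin d →₀ ℕ) → R)
    (hc : ∑ α ∈ Ex d s, c α * (z * mon a α) ∈ F (sp a) (s + 2) ⊔ sp a ^ (s + 1)) :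
    ∀ α ∈ Ex d s, c α ∈ maximalIdeal R := by
  by_contra hcon
  push Not at hcon
  obtain ⟨α0, hα0, hcα⟩ := hcon
  have hJm : sp a ≤ maximalIdeal R := by
    rw [← hm]; have := pow_le_F (sp a) 1; rwa [pow_one] at this
  set f := ∑ α ∈ Ex d s, c α * mon a α with hf
  have e1 : ∑ α ∈ Ex d s, c α * (z * mon a α) = f * z := by
    rw [hf, Finset.sum_mul]; exact Finset.sum_congr rfl fun _ _ => by ring
  rw [e1] at hc
  obtain ⟨w, hw, g, hg, hwg⟩ := Submodule.mem_sup.1 hc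
  obtain ⟨Γ, hΓ, rfl⟩ := (Ideal.mem_span_pow_iff_exists_isHomogeneous a _).1 hg
  set Φ := form s c with hΦ
  have hfΦ : MvPolynomial.eval a Φ = f := form_eval s c
  let π := MvPolynomial.map (σ := Fin d) (IsLocalRing.residue R)
  -- integral equation for `z`
  have hzF : z ∈ F (sp a) 1 := by rwa [hm]
  obtain ⟨M, hM⟩ := mem_F.1 hzF
  obtain ⟨N, hN, b, hb, hzb⟩ := int_of_pow_mem hM
  have hB : ∀ i, ∃ B : MvPolynomial (Fin d) R, i ∈ Finset.Icc 1 N → B.IsHomogeneous i ∧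
      MvPolynomial.eval a B = b i := by
    intro i
    by_cases hi : i ∈ Finset.Icc 1 N
    · have := hb i hi
      rw [pow_one] at this
      obtain ⟨B, h1, h2⟩ := (Ideal.mem_span_pow_iff_exists_isHomogeneous a _).1 this
      exact ⟨B, fun _ => ⟨h1, h2⟩⟩
    · exact ⟨0, fun h => absurd h hi⟩
  choose B hB using hB
  set Ψ := Γ ^ N + ∑ i ∈ Finset.Icc 1 N, B i * Φ ^ i * Γ ^ (N - i) with hΨ
  have hΨh : Ψ.IsHomogeneous ((s + 1) * N) := by
    refine (hΓ.pow N).add (MvPolynomial.IsHomogeneous.sum _ _ _ fun i hi => ?_)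
    have := (((hB i hi).1.mul ((form_homog s c).pow i)).mul (hΓ.pow (N - i)))
    rw [Finset.mem_Icc] at hi
    convert this using 1
    obtain ⟨j, rfl⟩ : ∃ j, N = i + j := ⟨N - i, by omega⟩
    rw [Nat.add_sub_cancel_left]; ring
  set γ := MvPolynomial.eval a Γ with hγ
  have hγw : γ = f * z - w := by rw [← hwg]; ring
  have hΨe : MvPolynomial.eval a Ψ ∈ F (sp a) ((s + 1) * N + 1) := by
    have e2 : MvPolynomial.eval a Ψ = γ ^ N + ∑ i ∈ Finset.Icc 1 N, b i * f ^ i * γ ^ (N - i) := by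
      rw [hΨ, map_add, map_pow, map_sum]
      congr 1
      refine Finset.sum_congr rfl fun i hi => ?_
      rw [map_mul, map_mul, map_pow, map_pow, (hB i hi).2, hfΦ]
    have e3 : (f * z) ^ N + ∑ i ∈ Finset.Icc 1 N, b i * f ^ i * (f * z) ^ (N - i) = 0 := by
      rw [← mul_zero (f ^ N), ← hzb, mul_add, mul_pow, Finset.mul_sum]
      congr 1
      refine Finset.sum_congr rfl fun i hi => ?_
      rw [Finset.mem_Icc] at hi
      obtain ⟨j, rfl⟩ : ∃ j, N = i + j := ⟨N - i, by omega⟩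
      rw [Nat.add_sub_cancel_left, mul_pow, pow_add]; ring
    have hfF : f ∈ F (sp a) s := by
      rw [← hfΦ]; exact pow_le_F _ _ (eval_mem_pow (form_homog s c))
    have hγF : γ ∈ F (sp a) (s + 1) := pow_le_F _ _ hg
    have hfz : f * z ∈ F (sp a) (s + 1) := mul_mem_F hfF hzF
    have hdiff : ∀ k, γ ^ k - (f * z) ^ k ∈ F (sp a) ((s + 1) * k + 1) := by
      intro k
      cases k with
      | zero => simp
      | succ k =>
        rw [← geom_sum₂_mul, Finset.sum_mul]
        refine Ideal.sum_mem _ fun i hi => ?_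
        rw [Finset.mem_range] at hi
        have h1 : γ - f * z ∈ F (sp a) (s + 2) := by
          rw [hγw]; simpa using hw
        refine F_anti _ ?_ (mul_mem_F (mul_mem_F (pow_mem_F hγF i) (pow_mem_F hfz (k + 1 - 1 - i))) h1)
        obtain ⟨j, rfl⟩ : ∃ j, k = i + j := ⟨k - i, by omega⟩
        have : i + j + 1 - 1 - i = j := by omega
        rw [this]
        apply le_of_eq; ring
    have e4 : MvPolynomial.eval a Ψ = (γ ^ N - (f * z) ^ N) +
        ∑ i ∈ Finset.Icc 1 N, (b i * f ^ i * γ ^ (N - i) - b i * f ^ i * (f * z) ^ (N - i)) := by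
      rw [Finset.sum_sub_distrib, e2]
      linear_combination e3
    rw [e4]
    refine add_mem (hdiff N) (Ideal.sum_mem _ fun i hi => ?_)
    rw [← mul_sub]
    have hbi : b i ∈ F (sp a) i := by
      have := hb i hi
      rw [pow_one] at this
      exact pow_le_F _ _ this
    refine F_anti _ ?_ (mul_mem_F (mul_mem_F hbi (pow_mem_F hfF i)) (hdiff (N - i)))
    rw [Finset.mem_Icc] at hi
    obtain ⟨j, rfl⟩ : ∃ j, N = i + j := ⟨N - i, by omega⟩
    rw [Nat.add_sub_cancel_left]
    apply le_of_eq; ring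
  have hπΨ : π Ψ = 0 := by
    ext α
    rw [MvPolynomial.coeff_map, MvPolynomial.coeff_zero, IsLocalRing.residue_eq_zero_iff]
    exact coeff_mem_max hQ hJm hΨh hΨe α
  have hπΦ : π Φ ≠ 0 := by
    intro h0
    have := congrArg (MvPolynomial.coeff α0) h0
    rw [MvPolynomial.coeff_map, MvPolynomial.coeff_zero, IsLocalRing.residue_eq_zero_iff,
      form_coeff hα0] at this
    exact hcα this
  have hdvd : π Φ ∣ π Γ := by
    refine dvd_of_int hπΦ hN (fun i => π (B i)) ?_
    rw [← hπΨ, hΨ]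
    simp only [map_add, map_pow, map_sum, map_mul]
  obtain ⟨θ, hθ⟩ := hdvd
  -- take the linear part of `θ`
  have hθ1 : π Γ = π Φ * MvPolynomial.homogeneousComponent 1 θ := by
    have h1 : (π Φ).IsHomogeneous s := (form_homog s c).map _
    have h2 : (π Γ).IsHomogeneous (s + 1) := hΓ.map _
    rw [← hc_mul h1 θ, ← hθ, MvPolynomial.homogeneousComponent_eq_self h2]
  obtain ⟨Θ, hΘh, hΘ⟩ : ∃ Θ : MvPolynomial (Fin d) R, Θ.IsHomogeneous 1 ∧
      π Θ = MvPolynomial.homogeneousComponent 1 θ := by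
    obtain ⟨Θ, hΘ⟩ := MvPolynomial.map_surjective (σ := Fin d) (IsLocalRing.residue R)
      IsLocalRing.residue_surjective θ
    refine ⟨MvPolynomial.homogeneousComponent 1 Θ, MvPolynomial.homogeneousComponent_isHomogeneous 1 Θ, ?_⟩
    ext α
    rw [MvPolynomial.coeff_map, MvPolynomial.coeff_homogeneousComponent, MvPolynomial.coeff_homogeneousComponent, ← hΘ,
      MvPolynomial.coeff_map]
    split_ifs <;> simp
  apply hz
  set h := MvPolynomial.eval a Θ with hh
  have hhJ : h ∈ sp a := by
    have := eval_mem_pow (a := a) hΘh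
    rwa [pow_one] at this
  have hfin : f * (z - h) ∈ F (sp a) (2 + s) := by
    have h1 : f * h - γ ∈ F (sp a) (s + 2) := by
      have h2 : (Φ * Θ - Γ).IsHomogeneous (s + 1) := ((form_homog s c).mul hΘh).sub hΓ
      have h3 : ∀ α, (Φ * Θ - Γ).coeff α ∈ maximalIdeal R := by
        intro α
        rw [← IsLocalRing.residue_eq_zero_iff, ← MvPolynomial.coeff_map]
        have : π (Φ * Θ - Γ) = 0 := by
          rw [map_sub, map_mul, hΘ, hθ1, sub_self]
        change MvPolynomial.coeff α (π _) = 0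
        rw [this]; simp
      have h4 : f * h - γ = MvPolynomial.eval a (Φ * Θ - Γ) := by
        rw [map_sub, map_mul, hfΦ]
      rw [h4, MvPolynomial.eval_eq]
      refine Ideal.sum_mem _ fun α hα => ?_
      have h5 : α.degree = s + 1 := by
        by_contra hne
        exact (MvPolynomial.mem_support_iff.1 hα) (h2.coeff_eq_zero hne)
      have h6 := mul_mem_F (hm.symm ▸ h3 α : _ ∈ F (sp a) 1) (pow_le_F _ _ (mon_mem (a := a) α))
      rw [h5] at h6
      refine F_anti _ (by omega) (k := s + 2) (l := 1 + (s + 1)) ?_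
      convert h6 using 2
      rw [mon]
      exact (Finset.prod_subset (Finset.subset_univ _) (fun i _ hi => by
        simp [Finsupp.notMem_support_iff.1 hi]))
    have h2 := sub_mem hw h1
    rw [add_comm 2 s]
    convert h2 using 1
    rw [mul_sub, ← hwg]; ring
  have hfsym := isSym_eval (a := a) (form_homog s c)
  rw [hfΦ] at hfsym
  have := mem_F_of_mul_mem hQ hfsym (fun τ hτ => nzd_of_unit_coeff (un_quot hN0) _ τ ⟨α0, by
    rw [MvPolynomial.coeff_map, form_coeff hα0]
    refine IsUnit.map _ ?_
    by_contra hu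
    exact hcα ((mem_maximalIdeal _).2 hu)⟩ hτ) hfin
  have h8 : z = (z - h) + h := by ring
  rw [h8]
  exact add_mem (Ideal.mem_sup_left this) (Ideal.mem_sup_right hhJ)

end count
end E1

namespace E1

section final
universe u v
variable {R : Type u} [CommRing R] {d : ℕ} {a : Fin d → R}

theorem exists_socle_gens [IsLocalRing R] (S : Ideal R) (t : ℕ) : ∀ (J : Ideal R), J ≤ S →
    len J ≠ ⊤ → (∀ r ∈ maximalIdeal R, ∀ s ∈ S, r * s ∈ J) → len J = len S + t →
    ∃ w : Fin t → R, (∀ i, w i ∈ S) ∧ S = J ⊔ Ideal.span (Set.range w) := by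
  induction t with
  | zero =>
    intro J hJS hJ _ h
    refine ⟨Fin.elim0, fun i => i.elim0, ?_⟩
    have := eq_of_len_le hJS hJ (by simpa using h.le)
    simp [this]
  | succ t ih =>
    intro J hJS hJ hm h
    have hSt : len S ≠ ⊤ := ne_top_of_le_ne_top hJ (len_anti hJS)
    have hne : ¬ S ≤ J := by
      intro hle
      have h1 := len_anti hle
      rw [h] at h1
      lift len S to ℕ using hSt with l
      have h1 : l + (t + 1) ≤ l := by exact_mod_cast h1
      omega
    obtain ⟨w, hwS, hwJ⟩ := Set.not_subset.1 hne
    have hcol : J.colon ({w} : Set R) = maximalIdeal R := by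
      apply le_antisymm
      · apply le_maximalIdeal
        rw [Ne, Ideal.eq_top_iff_one, mem_colon1, one_mul]
        exact hwJ
      · intro r hr
        rw [mem_colon1]; exact hm r hr w hwS
    have h2 := len_colon_add J w
    rw [hcol, len_maximal, h] at h2
    have hle : J ⊔ Ideal.span {w} ≤ S := sup_le hJS (by rwa [Ideal.span_singleton_le_iff_mem])
    have hJ' : len (J ⊔ Ideal.span {w}) ≠ ⊤ := ne_top_of_le_ne_top hJ (len_anti le_sup_left)
    obtain ⟨w', h3, h4⟩ := ih (J ⊔ Ideal.span {w}) hle hJ'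
      (fun r hr s hs => Ideal.mem_sup_left (hm r hr s hs)) (by
        lift len S to ℕ using hSt with l
        lift len (J ⊔ Ideal.span {w}) to ℕ using hJ' with l'
        have h2 : l + (t + 1) = 1 + l' := by exact_mod_cast h2
        have : l' = l + t := by omega
        exact_mod_cast this)
    refine ⟨Fin.cons w w', ?_, ?_⟩
    · intro i
      refine Fin.cases ?_ (fun i => ?_) i
      · exact hwS
      · exact h3 i
    · rw [h4, Fin.range_cons, sup_assoc, ← Ideal.span_union, Set.singleton_union]

/-- `λ(m-quotient)` count with `a`. -/
theorem len_add_card [IsLocalRing R] (hQ : QR a) (hm : F (sp a) 1 = maximalIdeal R) (n : ℕ)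
    (K : Ideal R) (hK : K ≤ F (sp a) (n + 1))
    (hK' : ∀ c ∈ maximalIdeal R, ∀ x ∈ sp a ^ n, c * x ∈ K) :
    len (K ⊔ sp a ^ n) + (Ex d n).card = len K := by
  have hJm : sp a ≤ maximalIdeal R := by
    rw [← hm]; have := pow_le_F (sp a) 1; rwa [pow_one] at this
  apply le_antisymm
  · have := len_lower (Ex d n) (mon a) (fun _ => maximalIdeal R) K (fun c hc =>
      coeff_mem_max' hQ hJm (hK hc))
    rw [← pow_eq_span] at this
    simpa [len_maximal] using this
  · have := len_upper (Ex d n) (mon a) (fun _ => maximalIdeal R) K (fun α hα c hc => by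
      refine hK' c hc _ ?_
      have := mon_mem (a := a) α
      rwa [mem_Ex.1 hα] at this)
    rw [← pow_eq_span] at this
    simpa [len_maximal] using this

theorem final_count [IsLocalRing R] [IsNoetherianRing R] (hQ : QR a) (hd : 0 < d)
    (hm : F (sp a) 1 = maximalIdeal R) {N0 : ℕ} (hN0 : maximalIdeal R ^ N0 ≤ sp a)
    (hA : ∀ n, F (sp a) (n + 2) ≤ sp a ^ n) (S : Ideal R)
    (hS : ∀ x, x ∈ S ↔ ∀ r ∈ maximalIdeal R, r * x ∈ sp a) (t ℓ : ℕ)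
    (ht : len (sp a) = len S + t)
    (hℓ : len (sp a * maximalIdeal R) = len (F (sp a) 2) + ℓ) (hne : t ≠ ℓ) (n : ℕ) :
    ((n + d).choose d : ℕ) * len (sp a) + (Ex d (n + 1)).card + (Ex d n).card ≤
      len (F (sp a) (n + 2)) + (t * (Ex d n).card : ℕ) := by
  classical
  have hJm : sp a ≤ maximalIdeal R := by
    rw [← hm]; have := pow_le_F (sp a) 1; rwa [pow_one] at this
  have hJ : len (sp a) ≠ ⊤ := len_ne_top hN0
  have hJS : sp a ≤ S := fun x hx => (hS x).2 fun r _ => Ideal.mul_mem_left _ _ hx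
  have hmF : ∀ k, ∀ r ∈ maximalIdeal R, ∀ x ∈ F (sp a) k, r * x ∈ F (sp a) (k + 1) := by
    intro k r hr x hx
    rw [← hm] at hr
    have := mul_mem_F hr hx
    rwa [add_comm] at this
  have hF2S : F (sp a) 2 ≤ S := fun x hx => (hS x).2 fun r hr => by
    have := hA 1 (hmF 2 r hr x hx)
    rwa [pow_one] at this
  -- the strict inclusion
  have hstrict : ¬ S ≤ F (sp a) 2 ⊔ sp a := by
    intro hle
    have hSe : S = F (sp a) 2 ⊔ sp a := le_antisymm hle (sup_le hF2S hJS)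
    have hmJ : sp a * maximalIdeal R ≤ F (sp a) 2 := by
      rw [Ideal.mul_le]
      intro x hx y hy
      rw [mul_comm]
      refine hmF 1 y hy x ?_
      rw [hm]; exact hJm hx
    have h1 := len_add_card hQ hm 1 (F (sp a) 2) le_rfl (fun c hc x hx => by
      rw [pow_one] at hx
      exact hmJ (by rw [mul_comm c]; exact Ideal.mul_mem_mul hx hc))
    have h2 := len_add_card hQ hm 1 (sp a * maximalIdeal R) hmJ (fun c hc x hx => by
      rw [pow_one] at hx
      rw [mul_comm c]; exact Ideal.mul_mem_mul hx hc)
    rw [pow_one, ← hSe] at h1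
    rw [pow_one, sup_eq_right.2 Ideal.mul_le_left] at h2
    rw [← h2, ← h1, ht] at hℓ
    have hSt : len S ≠ ⊤ := ne_top_of_le_ne_top hJ (len_anti hJS)
    lift len S to ℕ using hSt with l
    have : l + t + (Ex d 1).card = l + (Ex d 1).card + ℓ := by exact_mod_cast hℓ
    omega
  obtain ⟨z, hzS, hz⟩ := Set.not_subset.1 hstrict
  obtain ⟨w, hwS, hSw⟩ := exists_socle_gens S t (sp a) hJS hJ
    (fun r hr s hs => (hS s).1 hs r hr) ht
  have hmonm : ∀ k, ∀ α ∈ Ex d k, mon a α ∈ sp a ^ k := by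
    intro k α hα
    have := mon_mem (a := a) α
    rwa [mem_Ex.1 hα] at this
  -- `T`
  set E : Finset (Fin t × (Fin d →₀ ℕ)) := Finset.univ ×ˢ Ex d n with hE
  set T := sp a ^ (n + 1) ⊔
    Ideal.span ((fun p : Fin t × (Fin d →₀ ℕ) => w p.1 * mon a p.2) '' (E : Set _)) with hT
  have hup : len (sp a ^ (n + 1)) ≤ len T + (t * (Ex d n).card : ℕ) := by
    have := len_upper E (fun p => w p.1 * mon a p.2) (fun _ => maximalIdeal R)
      (sp a ^ (n + 1)) (fun p hp c hc => by
        rw [← mul_assoc, pow_succ']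
        exact Ideal.mul_mem_mul ((hS _).1 (hwS p.1) c hc)
          (hmonm n _ (Finset.mem_product.1 hp).2))
    simpa [len_maximal, hE, hT] using this
  have hST : ∀ s ∈ S, ∀ α ∈ Ex d n, s * mon a α ∈ T := by
    intro s hs α hα
    rw [hSw] at hs
    obtain ⟨j, hj, y, hy, rfl⟩ := Submodule.mem_sup.1 hs
    rw [add_mul]
    refine add_mem (Ideal.mem_sup_left ?_) (Ideal.mem_sup_right ?_)
    · rw [pow_succ']; exact Ideal.mul_mem_mul hj (hmonm n _ hα)
    · obtain ⟨u, rfl⟩ := (Ideal.mem_span_range_iff_exists_fun).1 hy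
      rw [Finset.sum_mul]
      refine Ideal.sum_mem _ fun i _ => ?_
      rw [mul_assoc]
      refine Ideal.mul_mem_left _ _ (Ideal.subset_span ⟨(i, α), ?_, rfl⟩)
      simp [hE, hα]
  have hFT : F (sp a) (n + 2) ≤ T := by
    intro x hx
    obtain ⟨c, rfl⟩ := exists_form (hA n hx)
    refine Ideal.sum_mem _ fun α hα => hST _ ?_ α hα
    rw [hS]
    intro r hr
    have h1 := hA (n + 1) (hmF _ r hr _ hx)
    have h2 : MvPolynomial.eval a (form n (fun α => r * c α)) ∈ sp a ^ (n + 1) := by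
      rw [form_eval]
      convert h1 using 1
      rw [Finset.mul_sum]
      exact Finset.sum_congr rfl fun _ _ => by ring
    have h3 := hQ n _ (form_homog n _) h2 α
    rwa [form_coeff hα] at h3
  have hlow : len T + (Ex d n).card ≤ len (F (sp a) (n + 2) ⊔ sp a ^ (n + 1)) := by
    have h1 := len_lower (Ex d n) (fun α => z * mon a α) (fun _ => maximalIdeal R)
      (F (sp a) (n + 2) ⊔ sp a ^ (n + 1)) (fun c hc => by
        by_cases hzm : z ∈ maximalIdeal R
        · exact z_indep hQ hm hN0 hzm hz c hc
        · intro α hα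
          have h2 : ∑ α ∈ Ex d n, (c α * z) * mon a α ∈ F (sp a) (n + 1) := by
            have h3 : F (sp a) (n + 2) ⊔ sp a ^ (n + 1) ≤ F (sp a) (n + 1) :=
              sup_le (F_anti _ (by omega)) (pow_le_F _ _)
            have h4 := h3 hc
            convert h4 using 1
            exact Finset.sum_congr rfl fun _ _ => by ring
          have h5 := coeff_mem_max' hQ hJm h2 α hα
          exact ((Ideal.IsPrime.mem_or_mem (maximalIdeal.isMaximal R).isPrime h5)).resolve_right hzm)
    have h2 : F (sp a) (n + 2) ⊔ sp a ^ (n + 1) ⊔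
        Ideal.span ((fun α => z * mon a α) '' (Ex d n : Set _)) ≤ T := by
      refine sup_le (sup_le hFT le_sup_left) ?_
      rw [Ideal.span_le]
      rintro _ ⟨α, hα, rfl⟩
      exact hST z hzS α hα
    have h3 : len T + ∑ i ∈ Ex d n, len (maximalIdeal R) ≤ _ :=
      le_trans (add_le_add_left (len_anti h2) _) h1
    simpa [len_maximal] using h3
  have hlast := len_add_card hQ hm (n + 1) (F (sp a) (n + 2)) le_rfl (fun c hc x hx => by
    exact hmF _ c hc x (pow_le_F _ _ hx))
  have hpow := len_pow_eq hQ hd (n + 1)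
  have e1 : n + 1 + d - 1 = n + d := by omega
  rw [e1] at hpow
  rw [← hpow, ← hlast]
  calc len (sp a ^ (n + 1)) + (Ex d (n + 1)).card + (Ex d n).card 
      ≤ len T + (t * (Ex d n).card : ℕ) + (Ex d (n + 1)).card + (Ex d n).card := by gcongr
    _ = (len T + (Ex d n).card) + ((Ex d (n + 1)).card + (t * (Ex d n).card : ℕ)) := by ring
    _ ≤ len (F (sp a) (n + 2) ⊔ sp a ^ (n + 1)) + ((Ex d (n + 1)).card + (t * (Ex d n).card : ℕ)) := by gcongr
    _ = _ := by ring

end final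
end E1

namespace E1

section ext
universe u v
variable {R : Type u} [CommRing R] {d : ℕ} {ι : Type v} [Finite ι]

/-- every element is a nonzerodivisor or nilpotent -/
def NN (A : Type*) [CommRing A] : Prop := ∀ a : A, a ∈ nonZeroDivisors A ∨ IsNilpotent a

theorem nzd_of_nzd_coeff {A : Type u} [CommRing A] (hA : NN A) (φ ψ : MvPolynomial ι A)
    (hφ : ∃ α, φ.coeff α ∈ nonZeroDivisors A) (h : φ * ψ = 0) : ψ = 0 := by
  classical
  by_contra hψ
  haveI : Nontrivial A := by
    by_contra hn
    rw [not_nontrivial_iff_subsingleton] at hn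
    exact hψ (Subsingleton.elim _ _)
  letI : Fintype ι := Fintype.ofFinite ι
  letI : LinearOrder ι := LinearOrder.lift' (Fintype.equivFin ι) (Fintype.equivFin ι).injective
  let φ1 : MvPolynomial ι A := ∑ α ∈ φ.support with φ.coeff α ∈ nonZeroDivisors A,
    MvPolynomial.monomial α (φ.coeff α)
  have c1 : ∀ α, φ1.coeff α = if φ.coeff α ∈ nonZeroDivisors A then φ.coeff α else 0 := by
    intro α
    simp only [φ1, MvPolynomial.coeff_sum, MvPolynomial.coeff_monomial, Finset.sum_ite_eq',
      Finset.mem_filter, MvPolynomial.mem_support_iff]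
    by_cases hu : φ.coeff α ∈ nonZeroDivisors A
    · rw [if_pos ⟨nonZeroDivisors.ne_zero hu, hu⟩, if_pos hu]
    · rw [if_neg (fun h => hu h.2), if_neg hu]
  have hn : IsNilpotent (φ1 - φ) := by
    rw [MvPolynomial.isNilpotent_iff]
    intro α
    rw [MvPolynomial.coeff_sub, c1]
    split_ifs with hu
    · simp
    · rw [zero_sub]; exact ((hA (φ.coeff α)).resolve_left hu).neg
  have h1 : φ1 ≠ 0 := by
    obtain ⟨α, hα⟩ := hφ
    intro h0
    have := c1 α
    rw [h0, if_pos hα] at this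
    rw [MvPolynomial.coeff_zero] at this
    rw [← this] at hα
    exact zero_notMem_nonZeroDivisors hα
  have hlead : ((MonomialOrder.lex (σ := ι)).leadingCoeff φ1) ∈ nonZeroDivisors A := by
    have h2 : (MonomialOrder.lex (σ := ι)).leadingCoeff φ1 ≠ 0 := by
      rwa [Ne, MonomialOrder.leadingCoeff_eq_zero_iff]
    rw [MonomialOrder.leadingCoeff, c1] at h2 ⊢
    split_ifs at h2 ⊢ with hu
    · exact hu
    · exact absurd rfl h2
  have hreg : ∀ χ, φ1 * χ = 0 → χ = 0 := by
    intro χ hχ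
    by_contra hne
    have h3 := (MonomialOrder.lex (σ := ι)).leadingCoeff_mul_of_left_mem_nonZeroDivisors
      (f := φ1) (g := χ) hlead
    rw [hχ, MonomialOrder.leadingCoeff_zero] at h3
    have h4 := (mul_left_mem_nonZeroDivisors_eq_zero_iff hlead).1 h3.symm
    rw [MonomialOrder.leadingCoeff_eq_zero_iff] at h4
    exact hne h4
  obtain ⟨n, hn⟩ := hn
  have key : ∀ m, φ1 ^ m * ψ = (φ1 - φ) ^ m * ψ := by
    intro m
    induction m with
    | zero => simp
    | succ m ih =>
      rw [pow_succ, pow_succ', mul_assoc (φ1 - φ), ← ih, mul_assoc]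
      have : φ1 * ψ = (φ1 - φ) * ψ := by rw [sub_mul, h, sub_zero]
      rw [this]; ring
  have h5 : φ1 ^ n * ψ = 0 := by rw [key, hn, zero_mul]
  have h6 : ∀ m, φ1 ^ m * ψ = 0 → ψ = 0 := by
    intro m
    induction m with
    | zero => simp
    | succ m ih => intro hm; rw [pow_succ', mul_assoc] at hm; exact ih (hreg _ hm)
  exact hψ (h6 n h5)

theorem UN.nn {A : Type u} [CommRing A] (hA : UN A) : NN A := fun a =>
  (hA a).imp (fun h => h.mem_nonZeroDivisors) id

theorem NN.mv {A : Type u} [CommRing A] (hA : NN A) : NN (MvPolynomial ι A) := by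
  intro φ
  by_cases h : ∃ α, φ.coeff α ∈ nonZeroDivisors A
  · left
    rw [mem_nonZeroDivisors_iff_right]
    intro ψ hψ
    exact nzd_of_nzd_coeff hA φ ψ h (by rw [mul_comm]; exact hψ)
  · right
    rw [MvPolynomial.isNilpotent_iff]
    push Not at h
    intro α
    exact (hA _).resolve_left (h α)

/-- ideals of the polynomial ring -/
noncomputable abbrev ex (ι : Type v) (I : Ideal R) : Ideal (MvPolynomial ι R) := I.map MvPolynomial.C

theorem mem_ex {I : Ideal R} {x : MvPolynomial ι R} : x ∈ ex ι I ↔ ∀ α, x.coeff α ∈ I :=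
  MvPolynomial.mem_map_C_iff

theorem NN.equiv {A B : Type*} [CommRing A] [CommRing B] (e : A ≃+* B) (h : NN A) : NN B := by
  intro x
  rcases h (e.symm x) with h | h
  · left
    rw [mem_nonZeroDivisors_iff_right] at h ⊢
    intro y hy
    have := h (e.symm y) (by rw [← map_mul, hy, map_zero])
    simpa using this
  · right
    have := h.map e
    simpa using this

theorem ex_nn {I : Ideal R} (hI : NN (R ⧸ I)) : NN (MvPolynomial ι R ⧸ ex ι I) :=
  (hI.mv (ι := ι)).equiv (MvPolynomial.quotientEquivQuotientMvPolynomial (σ := ι) I).toRingEquiv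

theorem ex_pow (I : Ideal R) (n : ℕ) : ex ι I ^ n = ex ι (I ^ n) := (Ideal.map_pow _ _ _).symm

/-- constants -/
noncomputable abbrev cc {κ : Type*} (ι : Type v) (a : κ → R) : κ → MvPolynomial ι R :=
  fun i => MvPolynomial.C (a i)

theorem sp_cc {κ : Type*} (a : κ → R) : sp (cc ι a) = ex ι (sp a) := by
  rw [sp, ex, sp, Ideal.map_span, ← Set.range_comp]; rfl

theorem C_mem_ex {I : Ideal R} {x : R} : (MvPolynomial.C x : MvPolynomial ι R) ∈ ex ι I ↔ x ∈ I := by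
  classical
  rw [mem_ex]
  constructor
  · intro h; simpa using h 0
  · intro h α; rw [MvPolynomial.coeff_C]; split_ifs
    · exact h
    · exact zero_mem _

theorem qr_cc {κ : Type*} [Finite κ] {a : κ → R} (hQ : QR a) : QR (cc ι a) := by
  classical
  intro n φ hφ he α
  rw [sp_cc, mem_ex]
  intro β
  rw [sp_cc, ex_pow, mem_ex] at he
  have := he β
  let ψ : MvPolynomial κ R := ∑ γ ∈ φ.support, MvPolynomial.monomial γ ((φ.coeff γ).coeff β)
  have hc : ∀ γ, ψ.coeff γ = (φ.coeff γ).coeff β := by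
    intro γ
    simp only [ψ, MvPolynomial.coeff_sum, MvPolynomial.coeff_monomial, Finset.sum_ite_eq']
    split_ifs with h
    · rfl
    · rw [MvPolynomial.notMem_support_iff.1 h]; simp
  have hψ : ψ.IsHomogeneous n := by
    intro γ hγ
    apply hφ
    intro h0
    rw [hc, h0] at hγ
    simp at hγ
  rw [← hc]
  refine hQ n ψ hψ ?_ α
  convert this using 1
  letI := Fintype.ofFinite κ
  simp only [ψ, map_sum, MvPolynomial.eval_monomial]
  rw [MvPolynomial.eval_eq', MvPolynomial.coeff_sum]
  refine Finset.sum_congr rfl fun γ _ => ?_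
  have : (∏ i, cc ι a i ^ γ i) = MvPolynomial.C (∏ i, a i ^ γ i) := by
    simp [cc, map_prod]
  rw [this, mul_comm (MvPolynomial.coeff γ φ), MvPolynomial.coeff_C_mul, mul_comm, Finsupp.prod_fintype _ _ (by simp)]

theorem F_ex (J : Ideal R) (k : ℕ) : F (ex ι J) k = ex ι (F J k) := by
  classical
  apply le_antisymm
  · letI : Fintype ι := Fintype.ofFinite ι
    letI : LinearOrder ι := LinearOrder.lift' (Fintype.equivFin ι) (Fintype.equivFin ι).injective
    have hC : ex ι (F J k) ≤ F (ex ι J) k := by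
      rw [ex, Ideal.map_le_iff_le_comap]
      intro x hx
      obtain ⟨N, hN⟩ := mem_F.1 hx
      refine mem_F.2 ⟨N, fun n => ?_⟩
      rw [ex_pow, ← map_pow, C_mem_ex]; exact hN n
    suffices H : ∀ (c : ℕ) (x : MvPolynomial ι R), x.support.card = c → x ∈ F (ex ι J) k →
        x ∈ ex ι (F J k) from fun x hx => H _ x rfl hx
    intro c
    induction c with
    | zero =>
      intro x hx _
      rw [Finset.card_eq_zero, MvPolynomial.support_eq_empty] at hx
      rw [hx]; exact zero_mem _
    | succ c ih =>
      intro x hx hF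
      have hx0 : x ≠ 0 := by rintro rfl; simp at hx
      set δ := (MonomialOrder.lex (σ := ι)).degree x with hδ
      have hlc : x.coeff δ ∈ F J k := by
        obtain ⟨N, hN⟩ := mem_F.1 hF
        refine mem_F.2 ⟨N, fun n => ?_⟩
        have h1 := hN n
        rw [ex_pow, mem_ex] at h1
        have h2 := h1 (n • δ)
        rw [hδ, MonomialOrder.coeff_pow_nsmul_degree] at h2
        exact h2
      have hm : MvPolynomial.monomial δ (x.coeff δ) ∈ ex ι (F J k) := by
        rw [mem_ex]; intro α; rw [MvPolynomial.coeff_monomial]; split_ifs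
        · exact hlc
        · exact zero_mem _
      have hδs : δ ∈ x.support := (MonomialOrder.lex (σ := ι)).degree_mem_support hx0
      have hs : (x - MvPolynomial.monomial δ (x.coeff δ)).support = x.support.erase δ := by
        ext α
        rw [Finset.mem_erase, MvPolynomial.mem_support_iff, MvPolynomial.mem_support_iff,
          MvPolynomial.coeff_sub, MvPolynomial.coeff_monomial]
        by_cases h : δ = α
        · subst h; simp
        · rw [if_neg h, sub_zero]; exact ⟨fun hh => ⟨fun e => h e.symm, hh⟩, fun hh => hh.2⟩
      have := ih (x - MvPolynomial.monomial δ (x.coeff δ))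
        (by rw [hs, Finset.card_erase_of_mem hδs, hx]; rfl) (sub_mem hF (hC hm))
      simpa using add_mem this hm
  · rw [ex, Ideal.map_le_iff_le_comap]
    intro x hx
    obtain ⟨N, hN⟩ := mem_F.1 hx
    refine mem_F.2 ⟨N, fun n => ?_⟩
    rw [ex_pow, ← map_pow, C_mem_ex]; exact hN n

end ext
end E1

namespace E1

section evs
universe u v
variable {R : Type u} [CommRing R] {k : ℕ} (a : Fin (k + 1) → R)

/-- the generic element -/
noncomputable def gg : MvPolynomial (Fin k) R :=
  cc (Fin k) a (Fin.last k) - ∑ j, MvPolynomial.X j * cc (Fin k) a j.castSucc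

/-- the generic element without its `j`-term -/
noncomputable def bb (j : Fin k) : MvPolynomial (Fin k) R :=
  cc (Fin k) a (Fin.last k) - ∑ i ∈ univ.erase j, MvPolynomial.X i * cc (Fin k) a i.castSucc

theorem gg_eq (j : Fin k) : gg a = bb a j - MvPolynomial.X j * cc (Fin k) a j.castSucc := by
  classical
  rw [gg, bb, ← Finset.add_sum_erase _ _ (mem_univ j)]; ring

/-- the localization at `a j` -/
abbrev Lj (j : Fin k) := Localization.Away (cc (Fin k) a j.castSucc)

/-- structure map -/
noncomputable abbrev al (j : Fin k) : MvPolynomial (Fin k) R →+* Lj a j :=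
  algebraMap (MvPolynomial (Fin k) R) (Lj a j)

/-- the elimination homomorphism -/
noncomputable def ev (j : Fin k) : MvPolynomial (Fin k) R →+* Lj a j :=
  MvPolynomial.eval₂Hom ((al a j).comp MvPolynomial.C) (fun i => if i = j then
    al a j (bb a j) * IsLocalization.Away.invSelf (cc (Fin k) a j.castSucc) else
    al a j (MvPolynomial.X i))

theorem ev_C (j : Fin k) (r : R) : ev a j (MvPolynomial.C r) = al a j (MvPolynomial.C r) := by
  simp [ev]

theorem ev_X_ne (j i : Fin k) (h : i ≠ j) : ev a j (MvPolynomial.X i) = al a j (MvPolynomial.X i) := by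
  simp [ev, h]

theorem ev_X (j : Fin k) : ev a j (MvPolynomial.X j) * al a j (cc (Fin k) a j.castSucc)
    = al a j (bb a j) := by
  have := IsLocalization.Away.mul_invSelf (S := Lj a j) (cc (Fin k) a j.castSucc)
  simp only [ev, MvPolynomial.eval₂Hom_X', if_true]
  rw [mul_assoc, mul_comm (IsLocalization.Away.invSelf _)]
  rw [show al a j = algebraMap _ _ from rfl, this, mul_one]

theorem ev_bb (j : Fin k) : ev a j (bb a j) = al a j (bb a j) := by
  classical
  rw [bb, map_sub, map_sub, ev_C, map_sum, map_sum]
  congr 1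
  refine Finset.sum_congr rfl fun i hi => ?_
  rw [map_mul, map_mul, ev_X_ne a j i (Finset.ne_of_mem_erase hi), ev_C]

theorem ev_gg (j : Fin k) : ev a j (gg a) = 0 := by
  rw [gg_eq a j, map_sub, ev_bb, map_mul, ev_C, ev_X, sub_self]

theorem bb_mem (j : Fin k) : bb a j ∈ sp (cc (Fin k) a) := by
  rw [bb]
  refine sub_mem (Ideal.subset_span ⟨_, rfl⟩) (Ideal.sum_mem _ fun i _ => ?_)
  exact Ideal.mul_mem_left _ _ (Ideal.subset_span ⟨_, rfl⟩)

theorem gg_mem : gg a ∈ sp (cc (Fin k) a) := by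
  rw [gg]
  refine sub_mem (Ideal.subset_span ⟨_, rfl⟩) (Ideal.sum_mem _ fun i _ => ?_)
  exact Ideal.mul_mem_left _ _ (Ideal.subset_span ⟨_, rfl⟩)

/-- fractional filtration -/
def PP (j : Fin k) (l : ℕ) (y : Lj a j) : Prop :=
  ∃ D, ∃ h ∈ sp (cc (Fin k) a) ^ (l + D), y * al a j (cc (Fin k) a j.castSucc) ^ D = al a j h

variable {a} {j : Fin k}

theorem cj_mem (D : ℕ) : cc (Fin k) a j.castSucc ^ D ∈ sp (cc (Fin k) a) ^ D :=
  Ideal.pow_mem_pow (Ideal.subset_span (Set.mem_range_self _)) _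

theorem PP.mul {l m : ℕ} {y z : Lj a j} (hy : PP a j l y) (hz : PP a j m z) :
    PP a j (l + m) (y * z) := by
  obtain ⟨D, h, hh, e⟩ := hy
  obtain ⟨D', h', hh', e'⟩ := hz
  refine ⟨D + D', h * h', ?_, ?_⟩
  · have := Ideal.mul_mem_mul hh hh'
    rw [← pow_add] at this
    convert this using 2; ring
  · rw [map_mul, ← e, ← e']; ring

theorem PP.add {l : ℕ} {y z : Lj a j} (hy : PP a j l y) (hz : PP a j l z) :
    PP a j l (y + z) := by
  obtain ⟨D, h, hh, e⟩ := hy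
  obtain ⟨D', h', hh', e'⟩ := hz
  refine ⟨D + D', h * cc (Fin k) a j.castSucc ^ D' + h' * cc (Fin k) a j.castSucc ^ D, ?_, ?_⟩
  · have h1 := Ideal.mul_mem_mul hh (cj_mem (a := a) (j := j) D')
    have h2 := Ideal.mul_mem_mul hh' (cj_mem (a := a) (j := j) D)
    rw [← pow_add] at h1 h2
    refine add_mem ?_ ?_
    · convert h1 using 2; ring
    · convert h2 using 2; ring
  · rw [map_add, map_mul, map_mul, ← e, ← e', map_pow, map_pow]; ring

theorem PP.pow {l : ℕ} {y : Lj a j} (hy : PP a j l y) (n : ℕ) : PP a j (l * n) (y ^ n) := by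
  induction n with
  | zero => exact ⟨0, 1, by simp, by simp⟩
  | succ n ih => rw [pow_succ, Nat.mul_succ]; exact ih.mul hy

theorem PP.al {l : ℕ} {x : MvPolynomial (Fin k) R} (hx : x ∈ sp (cc (Fin k) a) ^ l) :
    PP a j l (al a j x) := ⟨0, x, hx, by simp⟩

theorem PP_ev (x : MvPolynomial (Fin k) R) : PP a j 0 (ev a j x) := by
  induction x using MvPolynomial.induction_on with
  | C r => rw [ev_C]; exact PP.al (by simp)
  | add p q hp hq => rw [map_add]; exact hp.add hq
  | mul_X p i hp =>
    rw [map_mul]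
    refine PP.mul (l := 0) (m := 0) hp ?_
    by_cases h : i = j
    · subst h
      exact ⟨1, bb a i, by simpa using bb_mem a i, by rw [pow_one, ev_X]⟩
    · rw [ev_X_ne a j i h]; exact PP.al (by simp)

theorem PP_ev_mem {l : ℕ} {x : MvPolynomial (Fin k) R} (hx : x ∈ sp (cc (Fin k) a) ^ l) :
    PP a j l (ev a j x) := by
  rw [sp_cc, ex_pow] at hx
  refine Submodule.span_induction ?_ ?_ ?_ ?_ hx
  · rintro y ⟨r, hr, rfl⟩
    rw [ev_C]; refine PP.al ?_
    rw [sp_cc, ex_pow, C_mem_ex]; exact hr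
  · rw [map_zero]; exact ⟨0, 0, zero_mem _, by simp⟩
  · intro y z _ _ hy hz; rw [map_add]; exact hy.add hz
  · intro c y _ hy
    rw [smul_eq_mul, map_mul]
    have := (PP_ev (a := a) (j := j) c).mul hy
    rwa [zero_add] at this

theorem al_mem_of_PP (hQ : QR a) {l : ℕ} {x : MvPolynomial (Fin k) R} (h : PP a j l (al a j x)) :
    x ∈ sp (cc (Fin k) a) ^ l := by
  obtain ⟨D, h, hh, e⟩ := h
  rw [← map_pow, ← map_mul] at e
  obtain ⟨⟨_, E, rfl⟩, hE⟩ := (IsLocalization.eq_iff_exists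
    (Submonoid.powers (cc (Fin k) a j.castSucc)) _).1 e
  simp only at hE
  have h1 : cc (Fin k) a j.castSucc ^ (D + E) * x ∈ sp (cc (Fin k) a) ^ (l + (D + E)) := by
    have := Ideal.mul_mem_mul (cj_mem (a := a) (j := j) E) hh
    rw [← hE, ← pow_add] at this
    rw [show cc (Fin k) a j.castSucc ^ (D + E) * x =
      cc (Fin k) a j.castSucc ^ E * (x * cc (Fin k) a j.castSucc ^ D) by ring,
      show l + (D + E) = E + (l + D) by ring]
    exact this
  exact mem_pow_of_X_mul (qr_cc hQ) _ h1

theorem exists_h (x : MvPolynomial (Fin k) R) : ∃ D h, h ∈ sp (cc (Fin k) a) ^ D ∧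
    cc (Fin k) a j.castSucc ^ D * x - h ∈ Ideal.span {gg a} ∧
    ev a j x * al a j (cc (Fin k) a j.castSucc) ^ D = al a j h := by
  induction x using MvPolynomial.induction_on with
  | C r => exact ⟨0, MvPolynomial.C r, by simp, by simp, by rw [ev_C]; simp⟩
  | add p q hp hq =>
    obtain ⟨D, h, hh, hg, e⟩ := hp
    obtain ⟨D', h', hh', hg', e'⟩ := hq
    refine ⟨D + D', h * cc (Fin k) a j.castSucc ^ D' + h' * cc (Fin k) a j.castSucc ^ D, ?_, ?_, ?_⟩
    · have h1 := Ideal.mul_mem_mul hh (cj_mem (a := a) (j := j) D')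
      have h2 := Ideal.mul_mem_mul hh' (cj_mem (a := a) (j := j) D)
      rw [← pow_add] at h1 h2
      refine add_mem h1 ?_
      convert h2 using 2; ring
    · have := add_mem (Ideal.mul_mem_left _ (cc (Fin k) a j.castSucc ^ D') hg)
        (Ideal.mul_mem_left _ (cc (Fin k) a j.castSucc ^ D) hg')
      convert this using 1; ring
    · rw [map_add, map_add, map_mul, map_mul, ← e, ← e', map_pow, map_pow]; ring
  | mul_X p i hp =>
    obtain ⟨D, h, hh, hg, e⟩ := hp
    by_cases hi : i = j
    · subst hi
      refine ⟨D + 1, h * bb a i, ?_, ?_, ?_⟩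
      · rw [pow_succ]; exact Ideal.mul_mem_mul hh (bb_mem a i)
      · have h1 : cc (Fin k) a i.castSucc ^ D * p * (-1) * gg a ∈ Ideal.span {gg a} :=
          Ideal.mul_mem_left _ _ (Ideal.mem_span_singleton_self _)
        have := add_mem h1 (Ideal.mul_mem_left _ (bb a i) hg)
        convert this using 1
        rw [gg_eq a i]; ring
      · rw [map_mul, map_mul, ← e, ← ev_X]; ring
    · refine ⟨D, h * MvPolynomial.X i, Ideal.mul_mem_right _ _ hh, ?_, ?_⟩
      · have := Ideal.mul_mem_left _ (MvPolynomial.X i) hg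
        convert this using 1; ring
      · rw [map_mul, map_mul, ← e, ev_X_ne a j i hi]; ring

theorem nzd_ex {ι : Type v} [Finite ι] {I : Ideal R} (hI : NN (R ⧸ I)) {q y : MvPolynomial ι R}
    (hq : ∃ α, IsUnit (q.coeff α)) (h : q * y ∈ ex ι I) : y ∈ ex ι I := by
  have key : ∀ z : MvPolynomial ι R, z ∈ ex ι I ↔ MvPolynomial.map (Ideal.Quotient.mk I) z = 0 := by
    intro z
    rw [mem_ex, MvPolynomial.ext_iff]
    refine forall_congr' fun α => ?_
    rw [MvPolynomial.coeff_map, MvPolynomial.coeff_zero, Ideal.Quotient.eq_zero_iff_mem]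
  rw [key] at h ⊢
  rw [map_mul] at h
  obtain ⟨α, hα⟩ := hq
  refine nzd_of_nzd_coeff hI _ _ ⟨α, ?_⟩ h
  rw [MvPolynomial.coeff_map]
  exact (hα.map _).mem_nonZeroDivisors

theorem ev_mono (α : Fin k →₀ ℕ) (r : R) : ev a j (MvPolynomial.monomial (α.erase j) r) =
    al a j (MvPolynomial.monomial (α.erase j) r) := by
  classical
  rw [MvPolynomial.monomial_eq, map_mul, map_mul, ev_C, Finsupp.prod, map_prod, map_prod]
  congr 1
  refine Finset.prod_congr rfl fun i hi => ?_
  have : i ≠ j := by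
    rintro rfl; simp at hi
  rw [map_pow, map_pow, ev_X_ne a j i this]

/-- symbol of `b` -/
noncomputable def BB (a : Fin (k + 1) → R) (j : Fin k) :
    MvPolynomial (Fin (k + 1)) (MvPolynomial (Fin k) R ⧸ sp (cc (Fin k) a)) :=
  MvPolynomial.X (Fin.last k) - ∑ i ∈ univ.erase j, MvPolynomial.C
    (Ideal.Quotient.mk _ (MvPolynomial.X i)) * MvPolynomial.X i.castSucc

theorem IsSym.sum {R : Type u} [CommRing R] {ι κ : Type*} [Finite ι] {a : ι → R} (s : Finset κ) {n : ℕ}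
    {x : κ → R} {σ : κ → MvPolynomial ι (R ⧸ sp a)} (h : ∀ i ∈ s, IsSym a n (x i) (σ i)) :
    IsSym a n (∑ i ∈ s, x i) (∑ i ∈ s, σ i) := by
  classical
  induction s using Finset.induction_on with
  | empty => simpa using isSym_zero_of_mem (a := a) (n := n) (zero_mem _)
  | insert i s hi ih =>
    rw [Finset.sum_insert hi, Finset.sum_insert hi]
    exact (h i (Finset.mem_insert_self _ _)).add (ih fun i' hi' => h i' (Finset.mem_insert_of_mem hi'))

theorem isSym_bb (j : Fin k) : IsSym (cc (Fin k) a) 1 (bb a j) (BB a j) := by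
  rw [bb, BB, sub_eq_add_neg, sub_eq_add_neg]
  refine (isSym_X (a := cc (Fin k) a) (Fin.last k)).add (IsSym.neg (IsSym.sum _ fun i _ => ?_))
  have := (isSym_C (a := cc (Fin k) a) (MvPolynomial.X i)).mul (isSym_X (a := cc (Fin k) a) i.castSucc)
  rwa [zero_add] at this

theorem exists_hs [Nontrivial R] (hI : NN (R ⧸ sp a)) {s : MvPolynomial (Fin k) R} (hs : ∃ α, IsUnit (s.coeff α)) :
    ∃ D hs σ, ev a j s * al a j (cc (Fin k) a j.castSucc) ^ D = al a j hs ∧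
      IsSym (cc (Fin k) a) D hs σ ∧ ∀ τ, σ * τ = 0 → τ = 0 := by
  classical
  obtain ⟨α0, hα0⟩ := hs
  let D := s.support.sup (fun α => α j)
  have hD : ∀ α ∈ s.support, α j ≤ D := fun α hα => Finset.le_sup (f := fun α : Fin k →₀ ℕ => α j) hα
  let mo : (Fin k →₀ ℕ) → MvPolynomial (Fin k) R := fun α =>
    MvPolynomial.monomial (α.erase j) (s.coeff α)
  let σ : MvPolynomial (Fin (k + 1)) (MvPolynomial (Fin k) R ⧸ sp (cc (Fin k) a)) :=
    ∑ α ∈ s.support, MvPolynomial.C (Ideal.Quotient.mk _ (mo α)) * BB a j ^ (α j) *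
      MvPolynomial.X j.castSucc ^ (D - α j)
  refine ⟨D, ∑ α ∈ s.support, mo α * bb a j ^ (α j) * cc (Fin k) a j.castSucc ^ (D - α j), σ, ?_, ?_, ?_⟩
  · conv_lhs => rw [s.as_sum]
    rw [map_sum, map_sum, Finset.sum_mul]
    refine Finset.sum_congr rfl fun α hα => ?_
    have e1 : MvPolynomial.monomial α (s.coeff α) = mo α * MvPolynomial.X j ^ (α j) := by
      simp only [mo]
      rw [MvPolynomial.X_pow_eq_monomial, MvPolynomial.monomial_mul, mul_one, Finsupp.erase_add_single]
    rw [e1, map_mul, map_mul, map_mul, ev_mono, map_pow, map_pow, map_pow, ← ev_X a j, mul_pow,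
      ← Nat.sub_add_cancel (hD α hα), pow_add, Nat.add_sub_cancel]
    ring
  · refine IsSym.sum _ fun α hα => ?_
    have h1 := ((isSym_C (a := cc (Fin k) a) (mo α)).mul ((isSym_bb (a := a) j).pow (α j))).mul
      ((isSym_X (a := cc (Fin k) a) j.castSucc).pow (D - α j))
    have h2 : 0 + 1 * α j + 1 * (D - α j) = D := by have := hD α hα; omega
    rwa [h2] at h1
  · set 𝔞 : Ideal (MvPolynomial (Fin (k + 1)) (MvPolynomial (Fin k) R ⧸ sp (cc (Fin k) a))) :=
      Ideal.span (MvPolynomial.X '' {i | i ≠ Fin.last k ∧ i ≠ j.castSucc}) with h𝔞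
    have hB : ∀ m, BB a j ^ m - MvPolynomial.X (Fin.last k) ^ m ∈ 𝔞 := by
      intro m
      have h0 : BB a j - MvPolynomial.X (Fin.last k) ∈ 𝔞 := by
        rw [BB, sub_sub_cancel_left, neg_mem_iff]
        refine Ideal.sum_mem _ fun i hi => Ideal.mul_mem_left _ _ (Ideal.subset_span ⟨_, ?_, rfl⟩)
        refine ⟨(Fin.castSucc_lt_last i).ne, fun h => ?_⟩
        exact (Finset.ne_of_mem_erase hi) (Fin.castSucc_injective _ h)
      exact Ideal.mem_of_dvd _ (sub_dvd_pow_sub_pow _ _ m) h0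
    let K := α0 j
    let β0 : Fin (k + 1) →₀ ℕ := Finsupp.single (Fin.last k) K + Finsupp.single j.castSucc (D - K)
    have h0 : ∀ z ∈ 𝔞, MvPolynomial.coeff β0 z = 0 := by
      intro z hz
      by_contra hne
      obtain ⟨i, hi, hi'⟩ := (MvPolynomial.mem_ideal_span_X_image.1 hz) β0
        (MvPolynomial.mem_support_iff.2 hne)
      apply hi'
      simp only [β0, Finsupp.add_apply]
      rw [Finsupp.single_eq_of_ne hi.1, Finsupp.single_eq_of_ne hi.2, add_zero]
    have hK : α0 ∈ s.support := by
      rw [MvPolynomial.mem_support_iff]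
      intro h
      rw [h] at hα0
      exact not_isUnit_zero hα0
    let q : MvPolynomial (Fin k) R := ∑ α ∈ s.support with α j = K, mo α
    have hc : MvPolynomial.coeff β0 σ = Ideal.Quotient.mk _ q := by
      have h1 : ∀ α ∈ s.support, MvPolynomial.coeff β0 (MvPolynomial.C (Ideal.Quotient.mk _ (mo α)) *
          BB a j ^ (α j) * MvPolynomial.X j.castSucc ^ (D - α j)) =
          if α j = K then Ideal.Quotient.mk _ (mo α) else 0 := by
        intro α hα
        have e1 : MvPolynomial.coeff β0 (MvPolynomial.C (Ideal.Quotient.mk _ (mo α)) *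
          BB a j ^ (α j) * MvPolynomial.X j.castSucc ^ (D - α j)) =
          MvPolynomial.coeff β0 (MvPolynomial.C (Ideal.Quotient.mk (sp (cc (Fin k) a)) (mo α)) *
          MvPolynomial.X (Fin.last k) ^ (α j) * MvPolynomial.X j.castSucc ^ (D - α j)) := by
          rw [← sub_eq_zero, ← MvPolynomial.coeff_sub]
          apply h0
          have := Ideal.mul_mem_left 𝔞 (MvPolynomial.C (Ideal.Quotient.mk _ (mo α)) *
            MvPolynomial.X j.castSucc ^ (D - α j)) (hB (α j))
          convert this using 1; ring
        rw [e1, mul_assoc, MvPolynomial.coeff_C_mul, MvPolynomial.X_pow_eq_monomial,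
          MvPolynomial.X_pow_eq_monomial, MvPolynomial.monomial_mul, MvPolynomial.coeff_monomial]
        by_cases h : α j = K
        · rw [if_pos h, if_pos (by rw [h]), mul_one, mul_one]
        · rw [if_neg h, if_neg, mul_zero]
          intro he
          apply h
          have := DFunLike.congr_fun he (Fin.last k)
          simpa [β0, Finsupp.single_apply, (Fin.castSucc_lt_last j).ne] using this
      simp only [σ, q]
      rw [MvPolynomial.coeff_sum, Finset.sum_congr rfl h1, map_sum, Finset.sum_filter]
    have hq : ∃ α, IsUnit (q.coeff α) := by
      refine ⟨α0.erase j, ?_⟩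
      have : q.coeff (α0.erase j) = s.coeff α0 := by
        simp only [q, mo]
        rw [MvPolynomial.coeff_sum, Finset.sum_eq_single α0]
        · simp
        · intro α hα hne
          rw [MvPolynomial.coeff_monomial, if_neg]
          intro he
          apply hne
          rw [← Finsupp.erase_add_single j α, he, (Finset.mem_filter.1 hα).2,
            Finsupp.erase_add_single]
        · intro h; exact absurd (Finset.mem_filter.2 ⟨hK, (rfl : α0 j = K)⟩) h
      rwa [this]
    have hNN : NN (MvPolynomial (Fin k) R ⧸ sp (cc (Fin k) a)) := by
      rw [sp_cc]; exact ex_nn hI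
    intro τ hτ
    refine nzd_of_nzd_coeff hNN σ τ ⟨β0, ?_⟩ hτ
    rw [hc, mem_nonZeroDivisors_iff_right]
    intro y hy
    obtain ⟨y, rfl⟩ := Ideal.Quotient.mk_surjective y
    rw [← map_mul, Ideal.Quotient.eq_zero_iff_mem, sp_cc, mul_comm] at hy
    rw [Ideal.Quotient.eq_zero_iff_mem, sp_cc]
    exact nzd_ex hI hq hy

end evs
end E1

namespace E1

section cut
universe u v
variable {R : Type u} [CommRing R] [Nontrivial R] {k : ℕ} {a : Fin (k + 1) → R} {j : Fin k}

theorem PP_cancel (hQ : QR a) (hI : NN (R ⧸ sp a)) {s x : MvPolynomial (Fin k) R}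
    (hs : ∃ α, IsUnit (s.coeff α)) {n : ℕ} (h : PP a j n (ev a j s * ev a j x)) :
    PP a j n (ev a j x) := by
  obtain ⟨D, h', hh', hg, e⟩ := exists_h (a := a) (j := j) x
  obtain ⟨E, hs', σ, e', hsym, hσ⟩ := exists_hs (a := a) (j := j) hI hs
  have h1 : PP a j (n + (D + E)) (al a j (hs' * h')) := by
    rw [map_mul, ← e, ← e']
    have := h.mul (PP.al (j := j) (cj_mem (a := a) (j := j) (D + E)))
    convert this using 1
    rw [map_pow]; ring
  have h2 := al_mem_of_PP hQ h1
  rw [← add_assoc] at h2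
  exact ⟨D, h', mem_pow_of_mul_mem (qr_cc hQ) hsym hσ h2, e⟩

theorem PP_of_mem (hQ : QR a) (hI : NN (R ⧸ sp a)) {s x : MvPolynomial (Fin k) R}
    (hs : ∃ α, IsUnit (s.coeff α)) {n : ℕ} (h : s * x ∈ sp (cc (Fin k) a) ^ n ⊔ Ideal.span {gg a}) :
    PP a j n (ev a j x) := by
  obtain ⟨z, hz, w, hw, e⟩ := Submodule.mem_sup.1 h
  obtain ⟨w, rfl⟩ := Ideal.mem_span_singleton'.1 hw
  refine PP_cancel hQ hI hs ?_
  rw [← map_mul, ← e, map_add, map_mul, ev_gg, mul_zero, add_zero]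
  exact PP_ev_mem hz

theorem closure_h (hQ : QR a) (hI : NN (R ⧸ sp a)) {x : MvPolynomial (Fin k) R} {n N : ℕ}
    (h : ∀ m, ∃ s : MvPolynomial (Fin k) R, (∃ α, IsUnit (s.coeff α)) ∧
      s * x ^ m ∈ sp (cc (Fin k) a) ^ (n * m - N) ⊔ Ideal.span {gg a}) (j : Fin k) :
    ∃ D h, h ∈ F (sp (cc (Fin k) a)) (n + D) ∧
      cc (Fin k) a j.castSucc ^ D * x - h ∈ Ideal.span {gg a} := by
  obtain ⟨D, h', hh', hg, e⟩ := exists_h (a := a) (j := j) x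
  refine ⟨D, h', mem_F.2 ⟨N, fun m => ?_⟩, hg⟩
  obtain ⟨s, hs, hm⟩ := h m
  have h1 := PP_of_mem (j := j) hQ hI hs hm
  have h2 := h1.mul (PP.al (j := j) (cj_mem (a := a) (j := j) (D * m)))
  rw [map_pow, map_pow, pow_mul, ← mul_pow, e, ← map_pow] at h2
  refine Ideal.pow_le_pow_right ?_ (al_mem_of_PP hQ h2)
  rw [add_mul]; omega

/-- generic specialization -/
structure Spec (a : Fin (k + 1) → R) {B : Type u} [CommRing B] (π : MvPolynomial (Fin k) R →+* B) : Prop where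
  sur : ∀ b, ∃ x s, (∃ α, IsUnit (MvPolynomial.coeff α s)) ∧ IsUnit (π s) ∧ b * π s = π x
  un : ∀ s, (∃ α, IsUnit (MvPolynomial.coeff α s)) → IsUnit (π s)
  mem : ∀ (I : Ideal (MvPolynomial (Fin k) R)) x, π x ∈ I.map π ↔
    ∃ s, (∃ α, IsUnit (MvPolynomial.coeff α s)) ∧ s * x ∈ I ⊔ Ideal.span {gg a}

variable {B : Type u} [CommRing B] {π : MvPolynomial (Fin k) R →+* B}

/-- specialized sequence -/
noncomputable def ab (a : Fin (k + 1) → R) (π : MvPolynomial (Fin k) R →+* B) : Fin k → B :=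
  fun j => π (cc (Fin k) a j.castSucc)

theorem Spec.gg (hπ : Spec a π) : π (gg a) = 0 := by
  have : π (E1.gg a) ∈ (⊥ : Ideal (MvPolynomial (Fin k) R)).map π := by
    rw [hπ.mem]
    exact ⟨1, ⟨0, by simp⟩, by rw [one_mul]; exact Ideal.mem_sup_right (Ideal.mem_span_singleton_self _)⟩
  simpa [Ideal.map_bot] using this

theorem Spec.sp (hπ : Spec a π) : sp (ab a π) = (sp (cc (Fin k) a)).map π := by
  apply le_antisymm
  · rw [E1.sp, Ideal.span_le]
    rintro _ ⟨j, rfl⟩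
    exact Ideal.mem_map_of_mem _ (Ideal.subset_span ⟨_, rfl⟩)
  · rw [E1.sp, Ideal.map_span, Ideal.span_le]
    rintro _ ⟨_, ⟨i, rfl⟩, rfl⟩
    refine Fin.lastCases ?_ (fun j => ?_) i
    · have : π (cc (Fin k) a (Fin.last k)) = ∑ j, π (MvPolynomial.X j) * ab a π j := by
        have h := hπ.gg
        rw [E1.gg, map_sub, sub_eq_zero] at h
        rw [h, map_sum]
        exact Finset.sum_congr rfl fun j _ => by rw [map_mul]; rfl
      rw [this]
      exact Ideal.sum_mem _ fun j _ => Ideal.mul_mem_left _ _ (Ideal.subset_span ⟨_, rfl⟩)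
    · exact Ideal.subset_span ⟨j, rfl⟩

theorem Spec.sp_pow (hπ : Spec a π) (n : ℕ) :
    E1.sp (ab a π) ^ n = (E1.sp (cc (Fin k) a) ^ n).map π := by
  rw [hπ.sp, Ideal.map_pow]

theorem Spec.lift (hπ : Spec a π) (b : B) : ∃ x u, IsUnit u ∧ b * u = π x := by
  obtain ⟨x, s, _, h2, h3⟩ := hπ.sur b
  exact ⟨x, _, h2, h3⟩

theorem mem_of_unit_mul {I : Ideal B} {b u : B} (hu : IsUnit u) : b * u ∈ I ↔ b ∈ I :=
  I.mul_unit_mem_iff_mem hu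

theorem Spec.closure (hπ : Spec a π) (hQ : QR a) (hI : NN (R ⧸ E1.sp a)) {x : MvPolynomial (Fin k) R}
    {n : ℕ} (hx : π x ∈ F (E1.sp (ab a π)) n) (j : Fin k) :
    ∃ D h, h ∈ F (E1.sp (cc (Fin k) a)) (n + D) ∧ ab a π j ^ D * π x = π h := by
  obtain ⟨N, hN⟩ := mem_F.1 hx
  have : ∀ m, ∃ s : MvPolynomial (Fin k) R, (∃ α, IsUnit (s.coeff α)) ∧
      s * x ^ m ∈ E1.sp (cc (Fin k) a) ^ (n * m - N) ⊔ Ideal.span {E1.gg a} := by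
    intro m
    have := hN m
    rw [hπ.sp_pow, ← map_pow, hπ.mem] at this
    exact this
  obtain ⟨D, h, h1, h2⟩ := closure_h hQ hI this j
  refine ⟨D, h, h1, ?_⟩
  obtain ⟨w, hw⟩ := Ideal.mem_span_singleton'.1 h2
  have := congrArg π hw
  rw [map_mul, hπ.gg, mul_zero, map_sub, map_mul, map_pow] at this
  exact (sub_eq_zero.1 this.symm)

theorem Spec.transfer (hπ : Spec a π) (hQ : QR a) (hI : NN (R ⧸ E1.sp a)) (hk : 0 < k)
    (h : ∀ n, F (E1.sp (ab a π)) (n + 2) ≤ E1.sp (ab a π) ^ n) (n : ℕ) :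
    F (E1.sp a) (n + 2) ≤ E1.sp a ^ n := by
  intro x hx
  let j : Fin k := ⟨0, hk⟩
  have h1 : π (MvPolynomial.C x) ∈ F (E1.sp (ab a π)) (n + 2) := by
    obtain ⟨N, hN⟩ := mem_F.1 hx
    refine mem_F.2 ⟨N, fun m => ?_⟩
    rw [hπ.sp_pow, ← map_pow]
    apply Ideal.mem_map_of_mem
    rw [sp_cc, ex_pow, ← map_pow, C_mem_ex]; exact hN m
  have h2 := h n h1
  rw [hπ.sp_pow, hπ.mem] at h2
  obtain ⟨s, hs, h3⟩ := h2
  have h4 := PP_of_mem (j := j) hQ hI hs h3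
  rw [ev_C] at h4
  have h5 := al_mem_of_PP hQ h4
  rwa [sp_cc, ex_pow, C_mem_ex] at h5

end cut
end E1

namespace E1

section cut2
universe u v
variable {R : Type u} [CommRing R] [Nontrivial R] {k : ℕ} {a : Fin (k + 1) → R} {j : Fin k}
variable {B : Type u} [CommRing B] {π : MvPolynomial (Fin k) R →+* B}

/-- polynomial of the generic element -/
noncomputable def GG (R : Type u) [CommRing R] (k : ℕ) :
    MvPolynomial (Fin (k + 1)) (MvPolynomial (Fin k) R) :=
  MvPolynomial.X (Fin.last k) - ∑ i, MvPolynomial.C (MvPolynomial.X i) * MvPolynomial.X i.castSucc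

theorem GG_homog : (GG R k).IsHomogeneous 1 := by
  rw [GG]
  refine (MvPolynomial.isHomogeneous_X _ _).sub (MvPolynomial.IsHomogeneous.sum _ _ _ fun i _ => ?_)
  have := (MvPolynomial.isHomogeneous_C (Fin (k + 1)) (MvPolynomial.X i : MvPolynomial (Fin k) R)).mul
    (MvPolynomial.isHomogeneous_X _ i.castSucc)
  rwa [zero_add] at this

theorem eval_GG : MvPolynomial.eval (cc (Fin k) a) (GG R k) = gg a := by
  rw [GG, gg, map_sub, map_sum, MvPolynomial.eval_X]
  congr 1
  exact Finset.sum_congr rfl fun i _ => by rw [map_mul, MvPolynomial.eval_C, MvPolynomial.eval_X]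

theorem gg_nzd (hI : NN (R ⧸ sp a)) : ∃ σ, IsSym (cc (Fin k) a) 1 (gg a) σ ∧
    ∀ τ, σ * τ = 0 → τ = 0 := by
  classical
  have h := isSym_eval (a := cc (Fin k) a) (GG_homog (R := R) (k := k))
  rw [eval_GG] at h
  refine ⟨_, h, fun τ hτ => ?_⟩
  have hNN : NN (MvPolynomial (Fin k) R ⧸ sp (cc (Fin k) a)) := by
    rw [sp_cc]; exact ex_nn hI
  refine nzd_of_nzd_coeff hNN _ _ ⟨Finsupp.single (Fin.last k) 1, ?_⟩ hτ
  have : MvPolynomial.coeff (Finsupp.single (Fin.last k) 1) (GG R k) = 1 := by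
    rw [GG, MvPolynomial.coeff_sub, MvPolynomial.coeff_X, if_pos rfl, MvPolynomial.coeff_sum,
      Finset.sum_eq_zero, sub_zero]
    intro i _
    rw [MvPolynomial.coeff_C_mul, MvPolynomial.coeff_X, if_neg, mul_zero]
    intro h
    have := DFunLike.congr_fun h (Fin.last k)
    simp [Finsupp.single_apply, (Fin.castSucc_lt_last i).ne] at this
  rw [MvPolynomial.coeff_map, this, map_one]
  exact one_mem _

theorem gg_cancel (hQ : QR a) (hI : NN (R ⧸ sp a)) {w : MvPolynomial (Fin k) R} {n : ℕ}
    (h : gg a * w ∈ sp (cc (Fin k) a) ^ (n + 1)) : w ∈ sp (cc (Fin k) a) ^ n := by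
  obtain ⟨σ, h1, h2⟩ := gg_nzd (a := a) hI
  exact mem_pow_of_mul_mem (qr_cc hQ) h1 h2 h

theorem gg_cancel_F (hQ : QR a) (hI : NN (R ⧸ sp a)) {w : MvPolynomial (Fin k) R} {n : ℕ}
    (h : gg a * w ∈ F (sp (cc (Fin k) a)) (n + 1)) : w ∈ F (sp (cc (Fin k) a)) n := by
  obtain ⟨σ, h1, h2⟩ := gg_nzd (a := a) hI
  exact mem_F_of_mul_mem (qr_cc hQ) h1 h2 h

theorem Spec.lift_poly (hπ : Spec a π) (φ : MvPolynomial (Fin k) B) : ∃ (u : B)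
    (φ0 : MvPolynomial (Fin k) (MvPolynomial (Fin k) R)), IsUnit u ∧
    (∀ α, φ.coeff α * u = π (φ0.coeff α)) ∧ ∀ α, φ.coeff α = 0 → φ0.coeff α = 0 := by
  classical
  choose x s hs hu hx using hπ.sur
  let c : (Fin k →₀ ℕ) → MvPolynomial (Fin k) R := fun α =>
    x (φ.coeff α) * ∏ β ∈ φ.support.erase α, s (φ.coeff β)
  let φ0 : MvPolynomial (Fin k) (MvPolynomial (Fin k) R) := ∑ α ∈ φ.support, MvPolynomial.monomial α (c α)
  have hc : ∀ α, φ0.coeff α = if α ∈ φ.support then c α else 0 := by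
    intro α
    simp only [φ0, MvPolynomial.coeff_sum, MvPolynomial.coeff_monomial, Finset.sum_ite_eq']
  have h0 : ∀ α, φ.coeff α = 0 → φ0.coeff α = 0 := by
    intro α h
    rw [hc, if_neg (MvPolynomial.notMem_support_iff.2 h)]
  refine ⟨∏ β ∈ φ.support, π (s (φ.coeff β)), φ0, ?_, ?_, h0⟩
  · rw [IsUnit.prod_iff]; exact fun β _ => hu _
  · intro α
    by_cases h : φ.coeff α = 0
    · rw [h0 α h, h, zero_mul, map_zero]
    · rw [hc, if_pos (MvPolynomial.mem_support_iff.2 h), map_mul, ← hx, map_prod, mul_assoc,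
        Finset.mul_prod_erase φ.support (fun β => π (s (φ.coeff β))) (MvPolynomial.mem_support_iff.2 h)]

theorem Spec.qr (hπ : Spec a π) (hQ : QR a) (hI : NN (R ⧸ E1.sp a)) : QR (ab a π) := by
  classical
  intro n φ hφ he α
  obtain ⟨u, φ0, hu, hc, h0⟩ := hπ.lift_poly φ
  have hφ0 : φ0.IsHomogeneous n := fun β hβ => hφ (fun h => hβ (h0 β h))
  have hmap : MvPolynomial.map π φ0 = MvPolynomial.C u * φ := by
    ext β; rw [MvPolynomial.coeff_map, ← hc, MvPolynomial.coeff_C_mul, mul_comm]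
  have hx : π (MvPolynomial.eval (cc (Fin k) a) (MvPolynomial.rename Fin.castSucc φ0)) =
      u * MvPolynomial.eval (ab a π) φ := by
    rw [MvPolynomial.eval_rename, ← MvPolynomial.eval_C (f := ab a π) u, ← map_mul, ← hmap,
      MvPolynomial.eval_map, MvPolynomial.eval, MvPolynomial.coe_eval₂Hom,
      MvPolynomial.eval₂_comp_left]
    rfl
  have hren : (MvPolynomial.rename (Fin.castSucc (n := k)) φ0).IsHomogeneous n :=
    hφ0.rename_isHomogeneous
  have h1 : π (MvPolynomial.eval (cc (Fin k) a) (MvPolynomial.rename Fin.castSucc φ0)) ∈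
      (E1.sp (cc (Fin k) a) ^ (n + 1)).map π := by
    rw [hx, ← hπ.sp_pow]; exact Ideal.mul_mem_left _ _ he
  rw [hπ.mem] at h1
  obtain ⟨s, hs, hm⟩ := h1
  obtain ⟨z, hz, w', hw', e⟩ := Submodule.mem_sup.1 hm
  obtain ⟨w, rfl⟩ := Ideal.mem_span_singleton'.1 hw'
  suffices H : ∀ α, s * φ0.coeff α ∈ E1.sp (cc (Fin k) a) by
    have h2 : φ0.coeff α ∈ E1.sp (cc (Fin k) a) := by
      have := H α
      rw [sp_cc] at this ⊢
      exact nzd_ex hI hs this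
    rw [← mem_of_unit_mul hu, hc, hπ.sp]
    exact Ideal.mem_map_of_mem _ h2
  cases n with
  | zero =>
    have h2 : φ0 = MvPolynomial.C (φ0.coeff 0) := 
      MvPolynomial.totalDegree_eq_zero_iff_eq_C.1
        ((MvPolynomial.totalDegree_zero_iff_isHomogeneous _).2 hφ0)
    intro α
    have h3 : s * φ0.coeff 0 ∈ E1.sp (cc (Fin k) a) := by
      rw [h2, MvPolynomial.rename_C, MvPolynomial.eval_C] at e
      rw [← e]
      exact add_mem (by simpa using hz) (Ideal.mul_mem_left _ _ (gg_mem a))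
    rw [h2, MvPolynomial.coeff_C]
    split_ifs
    · exact h3
    · rw [mul_zero]; exact zero_mem _
  | succ m =>
    have h2 : E1.gg a * w ∈ E1.sp (cc (Fin k) a) ^ (m + 1) := by
      have : E1.gg a * w = s * MvPolynomial.eval (cc (Fin k) a) (MvPolynomial.rename Fin.castSucc φ0) - z := by
        rw [← e]; ring
      rw [this]
      exact sub_mem (Ideal.mul_mem_left _ _ (eval_mem_pow hren)) (Ideal.pow_le_pow_right (Nat.le_succ _) hz)
    obtain ⟨Ψ, hΨ, hw⟩ := (Ideal.mem_span_pow_iff_exists_isHomogeneous _ _).1 (gg_cancel hQ hI h2)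
    have hθ : (MvPolynomial.C s * MvPolynomial.rename (Fin.castSucc (n := k)) φ0 -
        GG R k * Ψ).IsHomogeneous (m + 1) := by
      refine MvPolynomial.IsHomogeneous.sub ?_ ?_
      · have := (MvPolynomial.isHomogeneous_C (Fin (k + 1)) s).mul hren
        rwa [zero_add] at this
      · have := (GG_homog (R := R) (k := k)).mul hΨ
        rwa [add_comm 1 m] at this
    have h3 := qr_cc (ι := Fin k) hQ (m + 1) _ hθ (by
      rw [map_sub, map_mul, map_mul, MvPolynomial.eval_C, eval_GG, hw, ← e]
      convert hz using 1; ring)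
    let χ : MvPolynomial (Fin (k + 1)) (MvPolynomial (Fin k) R) →ₐ[MvPolynomial (Fin k) R]
        MvPolynomial (Fin k) (MvPolynomial (Fin k) R) :=
      MvPolynomial.aeval (Fin.lastCases (∑ i, MvPolynomial.C (MvPolynomial.X i) * MvPolynomial.X i)
        (fun i => MvPolynomial.X i))
    have hχG : χ (GG R k) = 0 := by
      simp only [χ, GG, map_sub, map_sum, map_mul, MvPolynomial.aeval_X, Fin.lastCases_last,
        Fin.lastCases_castSucc, MvPolynomial.aeval_C, MvPolynomial.algebraMap_eq, sub_self]
    have hχr : χ (MvPolynomial.rename (Fin.castSucc (n := k)) φ0) = φ0 := by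
      simp only [χ]
      rw [MvPolynomial.aeval_rename]
      have : (Fin.lastCases (∑ i, MvPolynomial.C (MvPolynomial.X i) * MvPolynomial.X i)
        (fun i => MvPolynomial.X i) : Fin (k + 1) → MvPolynomial (Fin k) (MvPolynomial (Fin k) R)) ∘
          Fin.castSucc = MvPolynomial.X := by
        funext i; simp
      rw [this, MvPolynomial.aeval_X_left_apply]
    have h4 : MvPolynomial.C s * MvPolynomial.rename (Fin.castSucc (n := k)) φ0 - GG R k * Ψ ∈
        ex (Fin (k + 1)) (E1.sp (cc (Fin k) a)) := mem_ex.2 h3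
    have h5 := Ideal.mem_map_of_mem χ.toRingHom h4
    rw [ex, Ideal.map_map] at h5
    have h6 : χ.toRingHom.comp MvPolynomial.C =
      MvPolynomial.C := by
      refine RingHom.ext fun x => ?_
      simp [χ]
    rw [h6] at h5
    have h7 : χ.toRingHom (MvPolynomial.C s *
      MvPolynomial.rename (Fin.castSucc (n := k)) φ0 - GG R k * Ψ) = MvPolynomial.C s * φ0 := by
      have : χ (MvPolynomial.C s * MvPolynomial.rename (Fin.castSucc (n := k)) φ0 - GG R k * Ψ)
          = MvPolynomial.C s * φ0 := by
        rw [map_sub, map_mul, map_mul, hχG, hχr, zero_mul, sub_zero]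
        simp [χ]
      exact this
    rw [h7] at h5
    intro α
    have := (mem_ex (ι := Fin k)).1 h5 α
    rwa [MvPolynomial.coeff_C_mul] at this

theorem Spec.bdd (hπ : Spec a π) (hQ : QR a) (hI : NN (R ⧸ E1.sp a)) (hk : 0 < k)
    (hB : Bdd (E1.sp a)) : Bdd (E1.sp (ab a π)) := by
  obtain ⟨c, hc⟩ := hB
  refine ⟨c, fun n b hb => ?_⟩
  obtain ⟨x, u, hu, e⟩ := hπ.lift b
  rw [← mem_of_unit_mul hu, e] at hb ⊢
  obtain ⟨D, h, h1, h2⟩ := hπ.closure hQ hI hb ⟨0, hk⟩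
  refine mem_pow_of_X_mul (hπ.qr hQ hI) ⟨0, hk⟩ (k := D) ?_
  rw [h2, hπ.sp_pow]
  apply Ideal.mem_map_of_mem
  rw [sp_cc, F_ex] at h1
  rw [sp_cc, ex_pow]
  refine Ideal.map_mono ?_ h1
  have := hc (n + D)
  rwa [show n + D + c = n + c + D by ring] at this

/-- `F̄ ≤ F̃` -/
theorem Spec.Fbar_le (hπ : Spec a π) (n : ℕ) :
    (ex (Fin k) (F (E1.sp a) n)).map π ≤ F (E1.sp (ab a π)) n := by
  rw [Ideal.map_le_iff_le_comap, ← F_ex, ← sp_cc]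
  intro x hx
  obtain ⟨N, hN⟩ := mem_F.1 hx
  refine mem_F.2 ⟨N, fun m => ?_⟩
  rw [hπ.sp_pow, ← map_pow]
  exact Ideal.mem_map_of_mem _ (hN m)

end cut2
end E1

namespace E1

section cut3
universe u v
variable {R : Type u} [CommRing R] [Nontrivial R] {k : ℕ} {a : Fin (k + 1) → R} {j : Fin k}
variable {B : Type u} [CommRing B] {π : MvPolynomial (Fin k) R →+* B}

theorem Spec.ab_mul_Fbar (hπ : Spec a π) {n m : ℕ} {x y : B} (hx : x ∈ E1.sp (ab a π) ^ m)
    (hy : y ∈ (ex (Fin k) (F (E1.sp a) n)).map π) :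
    x * y ∈ (ex (Fin k) (F (E1.sp a) (n + m))).map π := by
  have h := Ideal.mul_mem_mul hx hy
  rw [hπ.sp_pow, ← Ideal.map_mul, sp_cc, ex_pow, ex, ex, ← Ideal.map_mul] at h
  refine Ideal.map_mono (Ideal.map_mono ?_) h
  rw [mul_comm]
  refine (Ideal.mul_mono_right (pow_le_F _ _)).trans (mul_F_le _ _ _)

theorem Spec.Fbar_eq [IsNoetherianRing B] (hπ : Spec a π) (hQ : QR a) (hI : NN (R ⧸ E1.sp a)) (hk : 0 < k)
    (hB : Bdd (E1.sp a)) : ∃ n1, ∀ n ≥ n1,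
      F (E1.sp (ab a π)) n = (ex (Fin k) (F (E1.sp a) n)).map π := by
  classical
  obtain ⟨n0, hn0⟩ := (hπ.bdd hQ hI hk hB).stable
  have h1 : ∀ b ∈ F (E1.sp (ab a π)) n0, ∀ j, ∃ D, ∀ E ≥ D, ab a π j ^ E * b ∈
      (ex (Fin k) (F (E1.sp a) (n0 + E))).map π := by
    intro b hb j
    obtain ⟨x, u, hu, e⟩ := hπ.lift b
    rw [← mem_of_unit_mul hu, e] at hb
    obtain ⟨D, h, h1, h2⟩ := hπ.closure hQ hI hb j
    refine ⟨D, fun E hE => ?_⟩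
    have h3 : ab a π j ^ D * π x ∈ (ex (Fin k) (F (E1.sp a) (n0 + D))).map π := by
      rw [h2]; apply Ideal.mem_map_of_mem; rwa [sp_cc, F_ex] at h1
    have h4 := hπ.ab_mul_Fbar (a_pow_mem (a := ab a π) j (E - D)) h3
    rw [← mul_assoc, ← pow_add, add_assoc, Nat.sub_add_cancel hE, Nat.add_sub_cancel' hE, ← e,
      ← mul_assoc, mem_of_unit_mul hu] at h4
    exact h4
  obtain ⟨T, hT⟩ := (isNoetherianRing_iff_ideal_fg B).1 inferInstance (F (E1.sp (ab a π)) n0)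
  have hTm : ∀ b ∈ T, b ∈ F (E1.sp (ab a π)) n0 := fun b hb => hT ▸ Ideal.subset_span hb
  choose! D hD using h1
  let DD := ∑ b ∈ T, ∑ j, D b j
  have hDD : ∀ b ∈ T, ∀ j, D b j ≤ DD := fun b hb j =>
    (Finset.single_le_sum (f := fun j => D b j) (fun _ _ => Nat.zero_le _) (mem_univ j)).trans
      (Finset.single_le_sum (f := fun b => ∑ j, D b j) (fun _ _ => Nat.zero_le _) hb)
  refine ⟨n0 + (k * DD + 1), fun n hn => le_antisymm ?_ (hπ.Fbar_le n)⟩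
  obtain ⟨m, rfl⟩ : ∃ m, n = n0 + m := ⟨n - n0, by omega⟩
  rw [hn0, ← hT, pow_eq_span, Ideal.span_mul_span', Ideal.span_le]
  rintro _ ⟨_, ⟨α, hα, rfl⟩, b, hb, rfl⟩
  have hα' := mem_Ex.1 hα
  obtain ⟨j, hj⟩ : ∃ j, DD ≤ α j := by
    by_contra hcon
    push Not at hcon
    have : α.degree ≤ k * DD := by
      rw [Finsupp.degree_eq_sum]
      have := Finset.sum_le_card_nsmul univ (fun i => α i) DD (fun i _ => (hcon i).le)
      simpa using this
    omega
  have e1 : mon (ab a π) α = mon (ab a π) (α - Finsupp.single j DD) * ab a π j ^ DD := by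
    have h5 : ab a π j ^ DD = ∏ i, ab a π i ^ (Finsupp.single j DD i) := by
      rw [Finset.prod_eq_single j]
      · simp
      · intro i _ hi; rw [Finsupp.single_eq_of_ne hi, pow_zero]
      · simp
    rw [mon, mon, h5, ← Finset.prod_mul_distrib]
    refine Finset.prod_congr rfl fun i _ => ?_
    rw [← pow_add]; congr 1
    rw [Finsupp.tsub_apply, Nat.sub_add_cancel]
    by_cases hi : i = j
    · subst hi; simpa using hj
    · rw [Finsupp.single_eq_of_ne hi]; exact Nat.zero_le _
  have h6 := hπ.ab_mul_Fbar (mon_mem (a := ab a π) (α - Finsupp.single j DD))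
    (hD b (hTm b hb) j DD (hDD b hb j))
  have h7 : (α - Finsupp.single j DD).degree + DD = α.degree := by
    have : (α - Finsupp.single j DD) + Finsupp.single j DD = α := by
      apply tsub_add_cancel_of_le
      rw [Finsupp.single_le_iff]; exact hj
    conv_rhs => rw [← this]
    rw [map_add, Finsupp.degree_single]
  rw [← mul_assoc, ← e1] at h6
  have h8 : n0 + DD + (α - Finsupp.single j DD).degree = n0 + m := by
    rw [← hα']; omega
  rw [h8] at h6
  exact h6

end cut3

section lens
universe u v
variable {R : Type u} [CommRing R] [IsLocalRing R]

theorem unit_coeff_iff {ι : Type v} {s : MvPolynomial ι R} : s ∉ ex ι (maximalIdeal R) ↔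
    ∃ α, IsUnit (s.coeff α) := by
  rw [MvPolynomial.mem_map_C_iff]
  push Not
  refine exists_congr fun α => ?_
  rw [mem_maximalIdeal, mem_nonunits_iff, not_not]

instance ex_prime {ι : Type v} : (ex ι (maximalIdeal R)).IsPrime := by
  rw [← Ideal.Quotient.isDomain_iff_prime]
  exact (MvPolynomial.quotientEquivQuotientMvPolynomial (σ := ι)
    (maximalIdeal R)).symm.toMulEquiv.isDomain _

/-- the localized polynomial ring -/
abbrev R1 (k : ℕ) (R : Type u) [CommRing R] [IsLocalRing R] :=
  Localization.AtPrime (ex (Fin k) (maximalIdeal R))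

/-- specialization -/
abbrev BR {k : ℕ} (a : Fin (k + 1) → R) :=
  R1 k R ⧸ Ideal.span {algebraMap (MvPolynomial (Fin k) R) (R1 k R) (gg a)}

/-- specialization map -/
noncomputable def pi {k : ℕ} (a : Fin (k + 1) → R) : MvPolynomial (Fin k) R →+* BR a :=
  (Ideal.Quotient.mk _).comp (algebraMap _ _)

variable {k : ℕ} {a : Fin (k + 1) → R}

theorem isUnit_al {s : MvPolynomial (Fin k) R} (hs : ∃ α, IsUnit (s.coeff α)) :
    IsUnit (algebraMap (MvPolynomial (Fin k) R) (R1 k R) s) :=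
  IsLocalization.map_units (M := (ex (Fin k) (maximalIdeal R)).primeCompl) (R1 k R)
    ⟨s, unit_coeff_iff.2 hs⟩

theorem pi_map (I : Ideal (MvPolynomial (Fin k) R)) : I.map (pi a) =
    (I.map (algebraMap _ (R1 k R))).map (Ideal.Quotient.mk (Ideal.span
      {algebraMap (MvPolynomial (Fin k) R) (R1 k R) (gg a)})) :=
  (Ideal.map_map _ _).symm

theorem pi_unit {s : MvPolynomial (Fin k) R} (hs : ∃ α, IsUnit (s.coeff α)) : IsUnit (pi a s) := by
  rw [pi, RingHom.comp_apply]
  exact RingHom.isUnit_map _ (isUnit_al hs)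

theorem spec_pi : Spec (B := BR a) a (pi a) where
  sur := by
    intro b
    obtain ⟨b, rfl⟩ := Ideal.Quotient.mk_surjective b
    obtain ⟨⟨x, s⟩, hx⟩ := IsLocalization.surj (ex (Fin k) (maximalIdeal R)).primeCompl b
    refine ⟨x, s, unit_coeff_iff.1 s.2, ?_, ?_⟩
    · exact pi_unit (unit_coeff_iff.1 s.2)
    · simp only [pi, RingHom.comp_apply]
      rw [← map_mul, hx]
  un := fun s hs => pi_unit hs
  mem := by
    intro I x
    rw [pi_map, pi, RingHom.comp_apply, ← Ideal.mem_comap, Ideal.comap_map_of_surjective _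
      Ideal.Quotient.mk_surjective, ← RingHom.ker_eq_comap_bot, Ideal.mk_ker,
      ← Set.image_singleton, ← Ideal.map_span, ← Ideal.map_sup,
      IsLocalization.algebraMap_mem_map_algebraMap_iff (ex (Fin k) (maximalIdeal R)).primeCompl]
    refine exists_congr fun s => ?_
    rw [← unit_coeff_iff]; rfl

theorem exists_socle {I : Ideal R} {N : ℕ} (hN : maximalIdeal R ^ N ≤ I) (hI : I ≠ ⊤) :
    ∃ f, I.colon ({f} : Set R) = maximalIdeal R ∧ f ∉ I := by
  classical
  have hex : ∃ n, maximalIdeal R ^ n ≤ I := ⟨N, hN⟩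
  have h0 : Nat.find hex ≠ 0 := by
    intro h
    have := Nat.find_spec hex
    rw [h, pow_zero, Ideal.one_eq_top, top_le_iff] at this
    exact hI this
  obtain ⟨n, hn⟩ := Nat.exists_eq_succ_of_ne_zero h0
  have h1 : ¬ maximalIdeal R ^ n ≤ I := Nat.find_min hex (by omega)
  obtain ⟨f, hf, hfI⟩ := SetLike.not_le_iff_exists.1 h1
  refine ⟨f, le_antisymm ?_ ?_, hfI⟩
  · apply le_maximalIdeal
    intro h
    have : (1 : R) ∈ I.colon ({f} : Set R) := by rw [h]; trivial
    rw [mem_colon1, one_mul] at this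
    exact hfI this
  · intro x hx
    rw [mem_colon1]
    have := Nat.find_spec hex
    rw [hn, Nat.succ_eq_add_one, pow_succ'] at this
    exact this (Ideal.mul_mem_mul hx hf)

theorem len_map_eq [IsNoetherianRing R] {R' : Type u} [CommRing R'] [IsLocalRing R'] (φ : R →+* R')
    (hm : (maximalIdeal R).map φ = maximalIdeal R')
    (hφ : ∀ (I : Ideal R) N, maximalIdeal R ^ N ≤ I → ∀ f, φ f ∈ I.map φ → f ∈ I)
    {I : Ideal R} {N : ℕ} (hN : maximalIdeal R ^ N ≤ I) : len (I.map φ) = len I := by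
  suffices H : ∀ (n : ℕ) (I : Ideal R), maximalIdeal R ^ N ≤ I → len I ≤ n → len (I.map φ) = len I by
    obtain ⟨n, hn⟩ := ENat.ne_top_iff_exists.1 (len_ne_top hN)
    exact H n I hN hn.symm.le
  intro n
  induction n with
  | zero =>
    intro I hN h
    have : I = ⊤ := len_eq_zero.1 (by simpa using h)
    subst this
    rw [Ideal.map_top, len_eq_zero.2 rfl, len_eq_zero.2 rfl]
  | succ n ih =>
    intro I hN h
    by_cases hI : I = ⊤
    · subst hI
      rw [Ideal.map_top, len_eq_zero.2 rfl, len_eq_zero.2 rfl]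
    obtain ⟨f, hf, hfI⟩ := exists_socle hN hI
    have h1 := len_colon_add I f
    rw [hf, len_maximal] at h1
    have h2 := len_colon_add (I.map φ) (φ f)
    have h3 : (I.map φ).colon ({φ f} : Set R') = maximalIdeal R' := by
      apply le_antisymm
      · apply le_maximalIdeal
        intro h
        have : (1 : R') ∈ (I.map φ).colon ({φ f} : Set R') := by rw [h]; trivial
        rw [mem_colon1, one_mul] at this
        exact hfI (hφ I N hN f this)
      · rw [← hm, Ideal.map_le_iff_le_comap]
        intro x hx
        rw [Ideal.mem_comap, mem_colon1, ← map_mul]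
        apply Ideal.mem_map_of_mem
        rw [← hf] at hx
        exact mem_colon1.1 hx
    rw [h3, len_maximal] at h2
    have h4 : I.map φ ⊔ Ideal.span {φ f} = (I ⊔ Ideal.span {f}).map φ := by
      rw [Ideal.map_sup, Ideal.map_span, Set.image_singleton]
    rw [h4, ih (I ⊔ Ideal.span {f}) (hN.trans le_sup_left) ?_, ← h1] at h2
    · exact h2
    · rw [h1, add_comm] at h
      push_cast at h
      exact (ENat.add_le_add_iff_right (by simp)).1 h

theorem len_quot_ring {S : Type u} [CommRing S] (g : S) (K : Ideal S) :
    len (K.map (Ideal.Quotient.mk (Ideal.span {g}))) = len (K ⊔ Ideal.span {g}) := by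
  rw [len, ← Module.length_eq_of_surjective (S := S) (R := S ⧸ Ideal.span {g})
    Ideal.Quotient.mk_surjective, len, sup_comm]
  exact (DoubleQuot.quotQuotEquivQuotSupₐ S (Ideal.span {g}) K).toLinearEquiv.length_eq

theorem mem_R1 {I : Ideal R} {N : ℕ} (hN : maximalIdeal R ^ N ≤ I) {z : MvPolynomial (Fin k) R} :
    algebraMap _ (R1 k R) z ∈ (ex (Fin k) I).map (algebraMap _ (R1 k R)) ↔ z ∈ ex (Fin k) I := by
  constructor
  · intro h
    rw [IsLocalization.algebraMap_mem_map_algebraMap_iff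
      (ex (Fin k) (maximalIdeal R)).primeCompl] at h
    obtain ⟨s, hs, h⟩ := h
    exact nzd_ex (un_quot hN).nn (unit_coeff_iff.1 hs) h
  · exact fun h => Ideal.mem_map_of_mem _ h

theorem max_R1 : maximalIdeal (R1 k R) = (ex (Fin k) (maximalIdeal R)).map
    (algebraMap (MvPolynomial (Fin k) R) (R1 k R)) :=
  (Localization.AtPrime.map_eq_maximalIdeal).symm

/-- the structure map -/
noncomputable def toR1 (k : ℕ) (R : Type u) [CommRing R] [IsLocalRing R] : R →+* R1 k R :=
  (algebraMap (MvPolynomial (Fin k) R) (R1 k R)).comp MvPolynomial.C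

theorem map_toR1 (I : Ideal R) : I.map (toR1 k R) =
    (ex (Fin k) I).map (algebraMap (MvPolynomial (Fin k) R) (R1 k R)) :=
  (Ideal.map_map _ _).symm

theorem len_R1 [IsNoetherianRing R] {I : Ideal R} {N : ℕ} (hN : maximalIdeal R ^ N ≤ I) :
    len ((ex (Fin k) I).map (algebraMap (MvPolynomial (Fin k) R) (R1 k R))) = len I := by
  rw [← map_toR1]
  refine len_map_eq (toR1 k R) ?_ ?_ hN
  · rw [max_R1, map_toR1]
  · intro I N hN f hf
    rw [map_toR1, toR1, RingHom.comp_apply, mem_R1 hN] at hf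
    exact C_mem_ex.1 hf

theorem colon_R1 (hQ : QR a) {N0 : ℕ} (hN0 : maximalIdeal R ^ N0 ≤ sp a) (n : ℕ) :
    ((ex (Fin k) (F (sp a) (n + 1))).map (algebraMap (MvPolynomial (Fin k) R) (R1 k R))).colon
      ({algebraMap (MvPolynomial (Fin k) R) (R1 k R) (gg a)} : Set (R1 k R)) =
    (ex (Fin k) (F (sp a) n)).map (algebraMap (MvPolynomial (Fin k) R) (R1 k R)) := by
  have hI : NN (R ⧸ sp a) := (un_quot hN0).nn
  have hFN : ∀ n, maximalIdeal R ^ (N0 * n) ≤ F (sp a) n := fun n => by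
    rw [pow_mul]; exact (Ideal.pow_right_mono hN0 n).trans (pow_le_F _ _)
  ext y
  obtain ⟨⟨x, s⟩, hx⟩ := IsLocalization.surj (ex (Fin k) (maximalIdeal R)).primeCompl y
  have hsu := isUnit_al (unit_coeff_iff.1 s.2)
  rw [mem_colon1]
  have e1 := Ideal.unit_mul_mem_iff_mem ((ex (Fin k) (F (sp a) n)).map
    (algebraMap (MvPolynomial (Fin k) R) (R1 k R))) hsu (x := y)
  rw [mul_comm, hx, mem_R1 (hFN n)] at e1
  have e2 := Ideal.unit_mul_mem_iff_mem ((ex (Fin k) (F (sp a) (n + 1))).map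
    (algebraMap (MvPolynomial (Fin k) R) (R1 k R))) hsu
    (x := y * algebraMap (MvPolynomial (Fin k) R) (R1 k R) (gg a))
  rw [← mul_assoc, mul_comm _ y, hx, ← map_mul, mem_R1 (hFN (n + 1))] at e2
  rw [← e1, ← e2, ← F_ex, ← sp_cc, ← F_ex, ← sp_cc]
  constructor
  · intro h
    rw [mul_comm] at h
    exact gg_cancel_F hQ hI h
  · intro h
    rw [add_comm n 1, mul_comm]
    refine mul_mem_F (pow_le_F _ 1 ?_) h
    rw [pow_one]
    exact gg_mem a

theorem len_BR [IsNoetherianRing R] (hQ : QR a) {N0 : ℕ} (hN0 : maximalIdeal R ^ N0 ≤ sp a) (n : ℕ) :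
    len ((ex (Fin k) (F (sp a) (n + 1))).map (pi a)) + len (F (sp a) n) = len (F (sp a) (n + 1)) := by
  have hFN : ∀ n, maximalIdeal R ^ (N0 * n) ≤ F (sp a) n := fun n => by
    rw [pow_mul]; exact (Ideal.pow_right_mono hN0 n).trans (pow_le_F _ _)
  rw [pi_map, len_quot_ring]
  have h := len_colon_add ((ex (Fin k) (F (sp a) (n + 1))).map
    (algebraMap (MvPolynomial (Fin k) R) (R1 k R))) (algebraMap (MvPolynomial (Fin k) R) (R1 k R) (gg a))
  rw [colon_R1 hQ hN0, len_R1 (hFN n), len_R1 (hFN (n + 1))] at h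
  rw [h, add_comm (len (F (sp a) n))]

theorem gg_max (ha : sp a ≤ maximalIdeal R) :
    algebraMap (MvPolynomial (Fin k) R) (R1 k R) (gg a) ∈ maximalIdeal (R1 k R) := by
  rw [max_R1]; apply Ideal.mem_map_of_mem
  have := gg_mem a
  rw [sp_cc] at this
  exact Ideal.map_mono ha this

theorem BR_nontrivial (ha : sp a ≤ maximalIdeal R) : Nontrivial (BR a) := by
  rw [Ideal.Quotient.nontrivial_iff]
  intro h
  have := (Ideal.span_singleton_le_iff_mem _).2 (gg_max ha)
  rw [h] at this
  exact (maximalIdeal.isMaximal (R1 k R)).ne_top (top_le_iff.1 this)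

theorem BR_local (ha : sp a ≤ maximalIdeal R) : IsLocalRing (BR a) :=
  haveI := BR_nontrivial ha
  IsLocalRing.of_surjective' (Ideal.Quotient.mk _) Ideal.Quotient.mk_surjective

theorem BR_max [IsLocalRing (BR a)] : maximalIdeal (BR a) = (ex (Fin k) (maximalIdeal R)).map (pi a) := by
  rw [pi_map, ← max_R1]
  exact ((IsLocalRing.map_maximalIdeal_of_surjective _ Ideal.Quotient.mk_surjective)).symm

theorem BR_noeth [IsNoetherianRing R] : IsNoetherianRing (BR a) := by
  haveI : IsNoetherianRing (R1 k R) := IsLocalization.isNoetherianRing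
    (ex (Fin k) (maximalIdeal R)).primeCompl _ inferInstance
  infer_instance

theorem cut_aux [IsNoetherianRing R] {B : Type u} [CommRing B] [hBl : IsLocalRing B]
    [hBn : IsNoetherianRing B] {π : MvPolynomial (Fin k) R →+* B} (hπ : Spec a π)
    (hmB : maximalIdeal B = (ex (Fin k) (maximalIdeal R)).map π)
    (hlen : ∀ n, len ((ex (Fin k) (F (sp a) (n + 1))).map π) + len (F (sp a) n) =
      len (F (sp a) (n + 1)))
    (hQ : QR a) (hB : Bdd (sp a)) {N0 : ℕ}
    (hN0 : maximalIdeal R ^ N0 ≤ sp a) (ha : sp a ≤ maximalIdeal R) (hk : 0 < k) :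
    ∃ (B : Type u) (_ : CommRing B) (_ : IsLocalRing B) (_ : IsNoetherianRing B) (b : Fin k → B),
      QR b ∧ Bdd (sp b) ∧ (∃ N, maximalIdeal B ^ N ≤ sp b) ∧ sp b ≤ maximalIdeal B ∧
      (∃ n1, ∀ n ≥ n1, len (F (sp b) (n + 1)) + len (F (sp a) n) = len (F (sp a) (n + 1))) ∧
      ((∀ n, F (sp b) (n + 2) ≤ sp b ^ n) → ∀ n, F (sp a) (n + 2) ≤ sp a ^ n) := by
  have hI : NN (R ⧸ sp a) := (un_quot hN0).nn
  refine ⟨B, inferInstance, hBl, hBn, ab a π, hπ.qr hQ hI,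
    hπ.bdd hQ hI hk hB, ⟨N0, ?_⟩, ?_, ?_, hπ.transfer hQ hI hk⟩
  · rw [hmB, ← Ideal.map_pow, ex_pow, hπ.sp, sp_cc]
    exact Ideal.map_mono (Ideal.map_mono hN0)
  · rw [hmB, hπ.sp, sp_cc]
    exact Ideal.map_mono (Ideal.map_mono ha)
  · obtain ⟨n1, hn1⟩ := hπ.Fbar_eq hQ hI hk hB
    refine ⟨n1, fun n hn => ?_⟩
    rw [hn1 (n + 1) (by omega)]
    exact hlen n

theorem cut_exists [IsNoetherianRing R] (hQ : QR a) (hB : Bdd (sp a)) {N0 : ℕ}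
    (hN0 : maximalIdeal R ^ N0 ≤ sp a) (ha : sp a ≤ maximalIdeal R) (hk : 0 < k) :
    ∃ (B : Type u) (_ : CommRing B) (_ : IsLocalRing B) (_ : IsNoetherianRing B) (b : Fin k → B),
      QR b ∧ Bdd (sp b) ∧ (∃ N, maximalIdeal B ^ N ≤ sp b) ∧ sp b ≤ maximalIdeal B ∧
      (∃ n1, ∀ n ≥ n1, len (F (sp b) (n + 1)) + len (F (sp a) n) = len (F (sp a) (n + 1))) ∧
      ((∀ n, F (sp b) (n + 2) ≤ sp b ^ n) → ∀ n, F (sp a) (n + 2) ≤ sp a ^ n)  := by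
  have h1 : IsLocalRing (BR a) := BR_local ha
  have h2 : IsNoetherianRing (BR a) := BR_noeth
  have h3 : Spec (B := BR a) a (pi a) := spec_pi
  have h4 : maximalIdeal (BR a) = (ex (Fin k) (maximalIdeal R)).map (pi a) := BR_max
  have h5 := (len_BR hQ hN0)
  generalize pi a = p at h3 h4 h5
  exact cut_aux h3 h4 h5 hQ hB hN0 ha hk

end lens
end E1

namespace E1

section asym
open Filter Topology

theorem choose_lim (c j : ℕ) : Tendsto (fun n : ℕ => (((n + c).choose j : ℕ) : ℝ) / (n : ℝ) ^ j) atTop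
    (𝓝 (1 / (j.factorial : ℝ))) := by
  have h1 : Tendsto (fun n : ℕ => ((n : ℕ) : ℝ) * ((n : ℝ) - c)⁻¹) atTop (𝓝 1) := by
    rw [← tendsto_add_atTop_iff_nat c]
    have h2 : Tendsto (fun n : ℕ => (1 : ℝ) + c * (n : ℝ)⁻¹) atTop (𝓝 (1 + c * 0)) :=
      tendsto_const_nhds.add (tendsto_const_nhds.mul tendsto_inv_atTop_nhds_zero_nat)
    rw [mul_zero, add_zero] at h2
    refine h2.congr' ?_
    filter_upwards [eventually_gt_atTop 0] with n hn
    have : (n : ℝ) ≠ 0 := by positivity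
    push_cast
    rw [add_sub_cancel_right]
    field_simp
  have h := ProbabilityTheory.tendsto_choose_mul_pow_atTop j h1
  rw [← tendsto_add_atTop_iff_nat c, one_pow] at h
  refine h.congr fun n => ?_
  push_cast
  rw [add_sub_cancel_right, inv_pow, div_eq_mul_inv]

theorem choose_lim_lt (c : ℕ) {j D : ℕ} (h : j < D) :
    Tendsto (fun n : ℕ => (((n + c).choose j : ℕ) : ℝ) / (n : ℝ) ^ D) atTop (𝓝 0) := by
  obtain ⟨m, rfl⟩ : ∃ m, D = j + (m + 1) := ⟨D - j - 1, by omega⟩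
  have h1 := (choose_lim c j).mul (tendsto_inv_atTop_nhds_zero_nat (𝕜 := ℝ) |>.pow (m + 1))
  rw [zero_pow (by omega), mul_zero] at h1
  refine h1.congr fun n => ?_
  rw [pow_add _ j, inv_pow, div_eq_mul_inv, div_eq_mul_inv, mul_inv, mul_assoc]

/-- limit of Hilbert-type sums -/
theorem sum_lim (d c : ℕ) (s : Finset ℕ) (e : ℕ → ℤ) (D : ℕ) (hD : ∀ i ∈ s, i ≤ d ∧ d - i < D) :
    Tendsto (fun n : ℕ => ((∑ i ∈ s, (-1 : ℤ) ^ i * e i * (((n + c + d - i).choose (d - i) : ℕ) : ℤ) : ℤ) : ℝ)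
      / (n : ℝ) ^ D) atTop (𝓝 0) := by
  have h : Tendsto (fun n : ℕ => ∑ i ∈ s, ((-1 : ℝ) ^ i * e i *
      ((((n + c + d - i).choose (d - i) : ℕ) : ℝ) / (n : ℝ) ^ D))) atTop (𝓝 (∑ i ∈ s, (-1 : ℝ) ^ i * e i * 0)) := by
    refine tendsto_finsetSum _ fun i hi => tendsto_const_nhds.mul ?_
    have hh := choose_lim_lt (c + (d - i)) (hD i hi).2
    have := (hD i hi).1
    refine hh.congr fun n => ?_
    rw [show n + (c + (d - i)) = n + c + d - i by omega]
  simp only [mul_zero, sum_const_zero] at h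
  refine h.congr fun n => ?_
  push_cast
  rw [Finset.sum_div]
  refine Finset.sum_congr rfl fun i _ => ?_
  rw [mul_div_assoc]

/-- the Hilbert polynomial -/
def HP (d : ℕ) (e : ℕ → ℤ) (n : ℕ) : ℤ :=
  ∑ i ∈ Finset.range (d + 1), (-1 : ℤ) ^ i * e i * (((n + d - i).choose (d - i) : ℕ) : ℤ)

theorem HP_lim {d : ℕ} (c : ℕ) (e : ℕ → ℤ) :
    Tendsto (fun n : ℕ => ((HP d e (n + c) : ℤ) : ℝ) / (n : ℝ) ^ d) atTop (𝓝 (e 0 * (1 / d.factorial))) := by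
  have h1 := sum_lim d c ((Finset.range d).image (· + 1)) e d (by
    intro i hi; simp only [mem_image, Finset.mem_range] at hi; obtain ⟨j, hj, rfl⟩ := hi; omega)
  have h2 := ((choose_lim (c + d) d).const_mul (e 0 : ℝ)).add h1
  rw [add_zero] at h2
  refine h2.congr fun n => ?_
  rw [HP, Finset.sum_range_succ']
  rw [Finset.sum_image (by intro a _ b _ h; simpa using h)]
  push_cast
  rw [add_div, add_comm]
  congr 1
  simp only [pow_zero, one_mul, Nat.sub_zero]
  rw [← add_assoc, mul_div_assoc]

theorem HP_step (k : ℕ) (e : ℕ → ℤ) (n : ℕ) : HP (k + 1) e (n + 1) = HP (k + 1) e n + HP k e (n + 1) := by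
  rw [HP, HP, HP, Finset.sum_range_succ, Finset.sum_range_succ _ (k + 1),
    add_right_comm (∑ x ∈ _, _), ← Finset.sum_add_distrib]
  congr 1
  · refine Finset.sum_congr rfl fun i hi => ?_
    rw [Finset.mem_range] at hi
    obtain ⟨j, rfl⟩ : ∃ j, k = i + j := ⟨k - i, by omega⟩
    rw [show n + 1 + (i + j + 1) - i = (n + 1 + j) + 1 by omega, show i + j + 1 - i = j + 1 by omega,
      show n + (i + j + 1) - i = n + 1 + j by omega, show n + 1 + (i + j) - i = n + 1 + j by omega,
      show i + j - i = j by omega, Nat.choose_succ_succ]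
    push_cast; ring
  · simp

theorem HP_three (e : ℕ → ℤ) (h3 : e 3 = 0) (K : ℕ) (hK : 0 < K) :
    HP 3 e (3 * K - 1) + 3 * HP 3 e (K - 1) = 3 * HP 3 e (2 * K - 1) + K ^ 3 * e 0 := by
  obtain ⟨k, rfl⟩ : ∃ k, K = k + 1 := ⟨K - 1, by omega⟩
  have h2 : ∀ n : ℕ, (((n + 2).choose 2 : ℕ) : ℤ) * 2 = (n + 2) * (n + 1) := by
    intro n
    have := Nat.add_one_mul_choose_eq (n + 1) 1
    rw [Nat.choose_one_right] at this
    zify at this; push_cast at this ⊢; linarith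
  have h33 : ∀ n : ℕ, (((n + 3).choose 3 : ℕ) : ℤ) * 6 = (n + 3) * (n + 2) * (n + 1) := by
    intro n
    have := Nat.add_one_mul_choose_eq (n + 2) 2
    have h := h2 n
    zify at this; push_cast at this ⊢
    have h' : ((n + 2 + 1).choose (2 + 1) : ℤ) * 3 = (n + 3) * ((n + 2).choose 2 : ℕ) := by
      push_cast; linarith
    have : ((n + 2 + 1).choose (2 + 1) : ℤ) * 6 = (n + 3) * (((n + 2).choose 2 : ℕ) * 2 : ℤ) := by
      push_cast; linarith
    rw [h] at this
    push_cast at this ⊢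
    linarith
  have hP : ∀ n : ℕ, 6 * HP 3 e n = e 0 * ((n + 3) * (n + 2) * (n + 1)) - 3 * e 1 * ((n + 2) * (n + 1))
      + 6 * e 2 * (n + 1) := by
    intro n
    simp only [HP, Finset.sum_range_succ, Finset.sum_range_zero]
    have a1 := h33 n
    have a2 := h2 n
    rw [show n + 3 - 0 = n + 3 by omega, show n + 3 - 1 = n + 2 by omega, show n + 3 - 2 = n + 1 by omega,
      show 3 - 0 = 3 by omega, show 3 - 1 = 2 by omega, show 3 - 2 = 1 by omega, Nat.choose_one_right, h3,
      ← a1, ← a2]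
    push_cast; ring
  have b1 := hP (3 * (k + 1) - 1)
  have b2 := hP (2 * (k + 1) - 1)
  have b3 := hP (k + 1 - 1)
  have c1 : ((3 * (k + 1) - 1 : ℕ) : ℤ) = 3 * k + 2 := by omega
  have c2 : ((2 * (k + 1) - 1 : ℕ) : ℤ) = 2 * k + 1 := by omega
  have c3 : ((k + 1 - 1 : ℕ) : ℤ) = k := by omega
  rw [c1] at b1; rw [c2] at b2; rw [c3] at b3
  have : 6 * (HP 3 e (3 * (k + 1) - 1) + 3 * HP 3 e (k + 1 - 1)) =
      6 * (3 * HP 3 e (2 * (k + 1) - 1) + ((k + 1 : ℕ) : ℤ) ^ 3 * e 0) := by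
    rw [Nat.cast_add, Nat.cast_one]
    linear_combination b1 + 3 * b3 - 3 * b2
  exact mul_left_cancel₀ (by norm_num) this

theorem final_lim {d : ℕ} (hd : 2 ≤ d) (e : ℕ → ℤ) (t : ℕ) (n0 : ℕ)
    (h : ∀ n ≥ n0, (((n + d).choose d : ℕ) : ℤ) * e 0 + ((n + d).choose (d - 1) : ℕ) +
      ((n + d - 1).choose (d - 1) : ℕ) ≤ HP d e (n + 1) + t * ((n + d - 1).choose (d - 1) : ℕ)) :
    e 1 < e 0 - 1 + t := by
  obtain ⟨m, rfl⟩ : ∃ m, d = m + 2 := ⟨d - 2, by omega⟩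
  have hl := sum_lim (m + 2) 1 ((Finset.range (m + 1)).image (· + 2)) e (m + 1) (by
    intro i hi; simp only [mem_image, Finset.mem_range] at hi; obtain ⟨j, hj, rfl⟩ := hi; omega)
  have h1 := choose_lim (m + 2) (m + 1)
  have h2 := choose_lim (m + 1) (m + 1)
  have hr := ((h1.const_mul ((e 0 - e 1 : ℤ) : ℝ)).add hl).add (h2.const_mul (t : ℝ))
  have hL := h1.add h2
  have hle := le_of_tendsto_of_tendsto hL hr (by
    filter_upwards [eventually_ge_atTop n0, eventually_gt_atTop 0] with n hn hn'
    have hh := h n hn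
    have key : HP (m + 2) e (n + 1) = (((n + (m + 2)).choose (m + 2) : ℕ) : ℤ) * e 0 +
        (e 0 - e 1) * ((n + (m + 2)).choose (m + 1) : ℕ) +
        ∑ i ∈ (Finset.range (m + 1)).image (· + 2), (-1 : ℤ) ^ i * e i *
          (((n + 1 + (m + 2) - i).choose (m + 2 - i) : ℕ) : ℤ) := by
      rw [Finset.sum_image (by intro a _ b _ h; simpa using h), HP, Finset.sum_range_succ',
        Finset.sum_range_succ']
      simp only [pow_zero, one_mul, Nat.sub_zero, zero_add, pow_one]
      rw [show n + 1 + (m + 2) = (n + (m + 2)) + 1 by omega, Nat.choose_succ_succ,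
        show n + (m + 2) + 1 - 1 = n + (m + 2) by omega, show m + 2 - 1 = m + 1 by omega]
      rw [show (m + 1).succ = m + 2 from rfl]
      push_cast
      ring
    rw [key] at hh
    have hpos : (0 : ℝ) < (n : ℝ) ^ (m + 1) := by positivity
    rw [show n + (m + 2) - 1 = n + (m + 1) by omega, show m + 2 - 1 = m + 1 by omega] at hh
    rw [← mul_div_assoc, ← mul_div_assoc, ← add_div, ← add_div, ← add_div]
    apply div_le_div_of_nonneg_right _ hpos.le
    have hh' : (((n + (m + 2)).choose (m + 1) : ℕ) : ℤ) + ((n + (m + 1)).choose (m + 1) : ℕ) ≤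
      (e 0 - e 1) * ((n + (m + 2)).choose (m + 1) : ℕ) +
        ∑ i ∈ (Finset.range (m + 1)).image (· + 2), (-1 : ℤ) ^ i * e i *
          (((n + 1 + (m + 2) - i).choose (m + 2 - i) : ℕ) : ℤ) + t * ((n + (m + 1)).choose (m + 1) : ℕ) := by
      linarith
    exact_mod_cast hh')
  have hf : (0 : ℝ) < 1 / ((m + 1).factorial : ℝ) := by positivity
  rw [add_zero, ← add_mul, ← two_mul] at hle
  have := le_of_mul_le_mul_right hle hf
  have : (2 : ℤ) ≤ e 0 - e 1 + t := by exact_mod_cast this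
  linarith

end asym

section thmA
open Filter Topology
universe u

/-- Hilbert data for `F` -/
def HD {R : Type u} [CommRing R] {d : ℕ} (a : Fin d → R) (e : ℕ → ℤ) : Prop :=
  ∃ N, ∀ n ≥ N, ∃ l : ℕ, len (F (sp a) (n + 1)) = l ∧ (l : ℤ) = HP d e n

theorem HD.e_zero {R : Type u} [CommRing R] [IsLocalRing R] [IsNoetherianRing R] {d : ℕ}
    {a : Fin d → R} {e : ℕ → ℤ} (h : HD a e) (hd : 0 < d) (hQ : QR a) (hB : Bdd (sp a)) {l : ℕ}
    (hl : len (sp a) = l) : e 0 = l := by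
  obtain ⟨N, hN⟩ := h
  obtain ⟨c, hc⟩ := hB
  have hf : (0 : ℝ) < 1 / (d.factorial : ℝ) := by positivity
  have h1 : (e 0 : ℝ) * (1 / d.factorial) ≤ l * (1 / d.factorial) := by
    refine le_of_tendsto_of_tendsto (HP_lim 0 e) ((choose_lim d d).const_mul (l : ℝ)) ?_
    filter_upwards [eventually_ge_atTop N] with n hn
    obtain ⟨l', h1, h2⟩ := hN n hn
    have h3 := len_anti (pow_le_F (sp a) (n + 1))
    rw [h1, len_pow_eq hQ hd, hl, show n + 1 + d - 1 = n + d by omega] at h3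
    rw [← mul_div_assoc]
    apply div_le_div_of_nonneg_right _ (by positivity)
    rw [add_zero, ← h2]
    have h4 : l' ≤ (n + d).choose d * l := by exact_mod_cast h3
    rw [mul_comm] at h4
    exact_mod_cast h4
  have h2 : (l : ℝ) * (1 / d.factorial) ≤ e 0 * (1 / d.factorial) := by
    refine le_of_tendsto_of_tendsto ((choose_lim d d).const_mul (l : ℝ)) (HP_lim c e) ?_
    filter_upwards [eventually_ge_atTop N] with n hn
    obtain ⟨l', h1, h2⟩ := hN (n + c) (by omega)
    have h3 := len_anti (hc (n + 1))
    rw [show n + 1 + c = n + c + 1 by omega, h1, len_pow_eq hQ hd, hl,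
      show n + 1 + d - 1 = n + d by omega] at h3
    rw [← mul_div_assoc]
    apply div_le_div_of_nonneg_right _ (by positivity)
    rw [← h2]
    have h4 : (n + d).choose d * l ≤ l' := by exact_mod_cast h3
    rw [mul_comm] at h4
    exact_mod_cast h4
  have h3 := le_of_mul_le_mul_right h1 hf
  have h4 := le_of_mul_le_mul_right h2 hf
  exact_mod_cast le_antisymm h3 h4

theorem F_ne_top {R : Type u} [CommRing R] [IsLocalRing R] [IsNoetherianRing R] {J : Ideal R} {N0 : ℕ}
    (hN0 : maximalIdeal R ^ N0 ≤ J) (n : ℕ) : len (F J n) ≠ ⊤ := by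
  have : maximalIdeal R ^ (N0 * n) ≤ F J n := by
    rw [pow_mul]; exact (Ideal.pow_right_mono hN0 n).trans (pow_le_F _ _)
  exact len_ne_top this

theorem thmA (j : ℕ) : ∀ {R : Type u} [CommRing R] [IsLocalRing R] [IsNoetherianRing R]
    {a : Fin (j + 3) → R} {e : ℕ → ℤ} {N0 : ℕ}, QR a → Bdd (sp a) → maximalIdeal R ^ N0 ≤ sp a →
    sp a ≤ maximalIdeal R → HD a e → e 3 = 0 → ∀ n, F (sp a) (n + 2) ≤ sp a ^ n := by
  induction j with
  | zero =>
    intro R _ _ _ a e N0 hQ hB hN0 ha hD he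
    obtain ⟨l, hl⟩ := ENat.ne_top_iff_exists.1 (len_ne_top hN0)
    have he0 := hD.e_zero (by omega) hQ hB hl.symm
    obtain ⟨N, hN⟩ := hD
    refine core3 hQ hB (F_ne_top hN0) (len_ne_top hN0) (N + 1) fun K hK => ?_
    obtain ⟨l1, h1, h1'⟩ := hN (3 * K - 1) (by omega)
    obtain ⟨l2, h2, h2'⟩ := hN (2 * K - 1) (by omega)
    obtain ⟨l3, h3, h3'⟩ := hN (K - 1) (by omega)
    rw [Nat.sub_add_cancel (by omega)] at h1 h2 h3
    have := HP_three e he K (by omega)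
    rw [zero_add] at h1' h2' h3'
    rw [← h1', ← h2', ← h3', he0] at this
    rw [h1, h2, h3, ← hl]
    exact_mod_cast this
  | succ j ih =>
    intro R _ _ _ a e N0 hQ hB hN0 ha hD he
    obtain ⟨B, i1, i2, i3, b, hQb, hBb, ⟨N', hN'⟩, hb, ⟨n1, hn1⟩, htr⟩ :=
      cut_exists (k := j + 3) hQ hB hN0 ha (by omega)
    apply htr
    refine ih hQb hBb hN' hb (e := e) ?_ he
    obtain ⟨N, hN⟩ := hD
    refine ⟨N + n1 + 1, fun n hn => ?_⟩
    obtain ⟨n, rfl⟩ : ∃ m, n = m + 1 := ⟨n - 1, by omega⟩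
    obtain ⟨l, h1, h1'⟩ := hN n (by omega)
    obtain ⟨l', h2, h2'⟩ := hN (n + 1) (by omega)
    have h3 := hn1 (n + 1) (by omega)
    rw [h1, h2] at h3
    obtain ⟨m, hm⟩ := ENat.ne_top_iff_exists.1 (F_ne_top hN' (n + 1 + 1))
    refine ⟨m, hm.symm, ?_⟩
    rw [← hm] at h3
    have h4 : m + l = l' := by exact_mod_cast h3
    have h5 := HP_step (j + 3) e n
    have h6 : HP (j + 1 + 3) e = HP (j + 3 + 1) e := by rw [show j + 1 + 3 = j + 3 + 1 by omega]
    rw [h6] at h1' h2'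
    zify at h4
    linarith

theorem main_red {R : Type u} [CommRing R] [IsLocalRing R] [IsNoetherianRing R] {d : ℕ} (hd : 3 ≤ d)
    {a : Fin d → R} {e : ℕ → ℤ} {N0 : ℕ} (hQ : QR a) (hB : Bdd (sp a)) (hN0 : maximalIdeal R ^ N0 ≤ sp a)
    (hm : F (sp a) 1 = maximalIdeal R) (hD : HD a e) (he : e 3 = 0) (S : Ideal R)
    (hS : ∀ x, x ∈ S ↔ ∀ r ∈ maximalIdeal R, r * x ∈ sp a) (t ℓ : ℕ)
    (ht : len (sp a) = len S + t)
    (hℓ : len (sp a * maximalIdeal R) = len (F (sp a) 2) + ℓ) (hne : t ≠ ℓ) : e 1 < e 0 - 1 + t := by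
  have ha : sp a ≤ maximalIdeal R := by
    rw [← hm]; have := pow_le_F (sp a) 1; rwa [pow_one] at this
  have hA : ∀ n, F (sp a) (n + 2) ≤ sp a ^ n := by
    obtain ⟨j, rfl⟩ : ∃ j, d = j + 3 := ⟨d - 3, by omega⟩
    exact thmA j hQ hB hN0 ha hD he
  obtain ⟨l, hl⟩ := ENat.ne_top_iff_exists.1 (len_ne_top hN0)
  have he0 := hD.e_zero (by omega) hQ hB hl.symm
  obtain ⟨N, hN⟩ := hD
  refine final_lim (d := d) (by omega) e t N fun n hn => ?_
  obtain ⟨l', h1, h1'⟩ := hN (n + 1) (by omega)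
  have h2 := final_count hQ (by omega) hm hN0 hA S hS t ℓ ht hℓ hne n
  rw [card_Ex _ _ (by omega), card_Ex _ _ (by omega), h1, ← hl,
    show n + 1 + d - 1 = n + d by omega] at h2
  rw [← h1', he0]
  exact_mod_cast h2

end thmA
end E1

namespace E1

section quasi
universe u
variable {R : Type u} [CommRing R] {d : ℕ} {a : Fin d → R}

/-- partial ideals of a sequence -/
def Ji (a : Fin d → R) (i : ℕ) : Ideal R := Ideal.span (a '' {j | j.val < i})

/-- the polynomial only uses the first variables -/
def SV (i : ℕ) (φ : MvPolynomial (Fin d) R) : Prop := ∀ α, φ.coeff α ≠ 0 → ∀ j : Fin d, i ≤ j.val → α j = 0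

/-- quasi-regularity of the first elements -/
def QI (a : Fin d → R) (i : ℕ) : Prop := ∀ n (φ : MvPolynomial (Fin d) R), φ.IsHomogeneous n → SV i φ →
  MvPolynomial.eval a φ ∈ Ji a i ^ (n + 1) → ∀ α, φ.coeff α ∈ Ji a i

theorem SV.add {i : ℕ} {φ ψ : MvPolynomial (Fin d) R} (h1 : SV i φ) (h2 : SV i ψ) : SV i (φ + ψ) := by
  intro α hα j hj
  by_cases h : φ.coeff α = 0
  · refine h2 α ?_ j hj
    intro h'; apply hα; rw [MvPolynomial.coeff_add, h, h', add_zero]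
  · exact h1 α h j hj

theorem SV.C_mul {i : ℕ} {φ : MvPolynomial (Fin d) R} (h1 : SV i φ) (c : R) : SV i (MvPolynomial.C c * φ) := by
  intro α hα j hj
  refine h1 α ?_ j hj
  intro h; apply hα; rw [MvPolynomial.coeff_C_mul, h, mul_zero]

theorem SV.X_mul {i : ℕ} {φ : MvPolynomial (Fin d) R} (h1 : SV i φ) {l : Fin d} (hl : l.val < i) :
    SV i (MvPolynomial.X l * φ) := by
  classical
  intro α hα j hj
  rw [MvPolynomial.coeff_X_mul'] at hα
  split_ifs at hα with h
  · have := h1 _ hα j hj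
    rw [Finsupp.tsub_apply, Finsupp.single_eq_of_ne (by rintro rfl; omega)] at this
    simpa using this
  · exact absurd rfl hα

theorem exists_rep (i : ℕ) : ∀ (n : ℕ) (x : R), x ∈ Ji a i ^ n → ∃ φ : MvPolynomial (Fin d) R,
    φ.IsHomogeneous n ∧ SV i φ ∧ MvPolynomial.eval a φ = x := by
  intro n
  induction n with
  | zero =>
    intro x _
    refine ⟨MvPolynomial.C x, MvPolynomial.isHomogeneous_C _ _, ?_, by simp⟩
    intro α hα j hj
    rw [MvPolynomial.coeff_C] at hα
    split_ifs at hα with h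
    · rw [← h]; rfl
    · exact absurd rfl hα
  | succ n ih =>
    intro x hx
    rw [pow_succ'] at hx
    induction hx using Submodule.mul_induction_on' with
    | mem_mul_mem m hm r hr =>
      obtain ⟨φ, h1, h2, h3⟩ := ih r hr
      induction hm using Submodule.span_induction with
      | mem x hx =>
        obtain ⟨l, hl, rfl⟩ := hx
        refine ⟨MvPolynomial.X l * φ, ?_, h2.X_mul hl, by simp [h3]⟩
        rw [add_comm]; exact (MvPolynomial.isHomogeneous_X _ _).mul h1
      | zero => exact ⟨0, MvPolynomial.isHomogeneous_zero _ _ _, fun α h => absurd rfl h, by simp⟩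
      | add x y _ _ hx hy =>
        obtain ⟨φ, h1, h2, h3⟩ := hx
        obtain ⟨ψ, k1, k2, k3⟩ := hy
        exact ⟨φ + ψ, h1.add k1, h2.add k2, by rw [map_add, h3, k3, add_mul]⟩
      | smul c x _ hx =>
        obtain ⟨φ, h1, h2, h3⟩ := hx
        refine ⟨MvPolynomial.C c * φ, ?_, h2.C_mul c, by simp [h3, mul_assoc]⟩
        have := (MvPolynomial.isHomogeneous_C (Fin d) c).mul h1
        rwa [zero_add] at this
    | add x _ y _ hx hy =>
      obtain ⟨φ, h1, h2, h3⟩ := hx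
      obtain ⟨ψ, k1, k2, k3⟩ := hy
      exact ⟨φ + ψ, h1.add k1, h2.add k2, by rw [map_add, h3, k3]⟩

theorem exists_rep' (i n : ℕ) (x : R) (hx : x ∈ Ji a i ^ (n + 1)) : ∃ φ : MvPolynomial (Fin d) R,
    φ.IsHomogeneous n ∧ SV i φ ∧ MvPolynomial.eval a φ = x ∧ ∀ α, φ.coeff α ∈ Ji a i := by
  rw [pow_succ'] at hx
  induction hx using Submodule.mul_induction_on' with
  | mem_mul_mem m hm r hr =>
    obtain ⟨φ, h1, h2, h3⟩ := exists_rep i n r hr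
    refine ⟨MvPolynomial.C m * φ, ?_, h2.C_mul m, by simp [h3], ?_⟩
    · have := (MvPolynomial.isHomogeneous_C (Fin d) m).mul h1
      rwa [zero_add] at this
    · intro α; rw [MvPolynomial.coeff_C_mul]; exact Ideal.mul_mem_right _ _ hm
  | add x _ y _ hx hy =>
    obtain ⟨φ, h1, h2, h3, h4⟩ := hx
    obtain ⟨ψ, k1, k2, k3, k4⟩ := hy
    refine ⟨φ + ψ, h1.add k1, h2.add k2, by rw [map_add, h3, k3], fun α => ?_⟩
    rw [MvPolynomial.coeff_add]; exact add_mem (h4 α) (k4 α)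

theorem eval_mem_Ji {i : ℕ} {I : Ideal R} : ∀ (n : ℕ) (φ : MvPolynomial (Fin d) R), φ.IsHomogeneous n → SV i φ →
    (∀ α, φ.coeff α ∈ I) → MvPolynomial.eval a φ ∈ I * Ji a i ^ n := by
  classical
  intro n φ h1 h2 h3
  rw [MvPolynomial.eval_eq']
  refine Ideal.sum_mem _ fun α hα => Ideal.mul_mem_mul (h3 α) ?_
  have hα' := MvPolynomial.mem_support_iff.1 hα
  have hd : α.degree = n := by
    by_contra h; exact hα' (h1.coeff_eq_zero h)
  rw [← hd, Finsupp.degree_eq_sum, ← Finset.prod_pow_eq_pow_sum]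
  refine Ideal.prod_mem_prod fun j _ => ?_
  by_cases hj : j.val < i
  · exact Ideal.pow_mem_pow (show a j ∈ Ji a i from Ideal.subset_span ⟨j, hj, rfl⟩) _
  · rw [h2 α hα' j (by omega)]; simp

theorem QI.nzd {i : ℕ} (hQ : QI a i) {b : R} (hb : ∀ r, r * b ∈ Ji a i → r ∈ Ji a i) :
    ∀ (n : ℕ) (y : R), y * b ∈ Ji a i ^ n → y ∈ Ji a i ^ n := by
  intro n
  induction n with
  | zero => intro y _; rw [pow_zero, Ideal.one_eq_top]; trivial
  | succ n ih =>
    intro y hy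
    obtain ⟨φ, h1, h2, h3⟩ := exists_rep i n y (ih y (Ideal.pow_le_pow_right (Nat.le_succ n) hy))
    have h4 := hQ n (MvPolynomial.C b * φ) (by
      have := (MvPolynomial.isHomogeneous_C (Fin d) b).mul h1
      rwa [zero_add] at this) (h2.C_mul b) (by
      rw [map_mul, MvPolynomial.eval_C, h3, mul_comm]; exact hy)
    rw [← h3, pow_succ']
    refine eval_mem_Ji n φ h1 h2 fun α => hb _ ?_
    have := h4 α
    rwa [MvPolynomial.coeff_C_mul, mul_comm] at this

theorem QI_zero : QI a 0 := by
  intro n φ h1 h2 h3 α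
  have hJ : Ji a 0 = ⊥ := by simp [Ji]
  have e : φ = MvPolynomial.C (φ.coeff 0) := by
    ext β
    rw [MvPolynomial.coeff_C]
    split_ifs with h
    · rw [h]
    · by_contra hc
      apply h
      ext j
      exact (h2 β hc j (Nat.zero_le _)).symm
  rw [hJ] at h3 ⊢
  rw [e, MvPolynomial.eval_C] at h3
  have h4 : φ.coeff 0 = 0 := by
    have := Ideal.pow_le_self (Nat.succ_ne_zero n) h3
    simpa using this
  rw [e, h4]; simp

theorem QI.succ {i : Fin d} (hQ : QI a i) (hb : ∀ r, r * a i ∈ Ji a i → r ∈ Ji a i) : QI a (i + 1) := by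
  classical
  have hJJ : Ji a i ≤ Ji a (i + 1) := Ideal.span_mono (Set.image_mono fun j hj => Nat.lt_succ_of_lt hj)
  have hai : a i ∈ Ji a (i + 1) := Ideal.subset_span ⟨i, Nat.lt_succ_self _, rfl⟩
  have red : ∀ n, (∀ φ : MvPolynomial (Fin d) R, φ.IsHomogeneous n → SV (i + 1) φ →
      MvPolynomial.eval a φ = 0 → ∀ α, φ.coeff α ∈ Ji a (i + 1)) →
      ∀ φ : MvPolynomial (Fin d) R, φ.IsHomogeneous n → SV (i + 1) φ →
      MvPolynomial.eval a φ ∈ Ji a (i + 1) ^ (n + 1) → ∀ α, φ.coeff α ∈ Ji a (i + 1) := by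
    intro n h φ h1 h2 h3 α
    obtain ⟨ψ, k1, k2, k3, k4⟩ := exists_rep' _ _ _ h3
    have h5 := h (φ + MvPolynomial.C (-1) * ψ) (h1.add (by
      have := (MvPolynomial.isHomogeneous_C (Fin d) (-1 : R)).mul k1
      rwa [zero_add] at this)) (h2.add (k2.C_mul _)) (by simp [k3]) α
    rw [MvPolynomial.coeff_add, MvPolynomial.coeff_C_mul] at h5
    have := add_mem h5 (k4 α)
    simpa using this
  intro n
  induction n with
  | zero =>
    refine red 0 fun φ h1 h2 h3 α => ?_
    have e : φ = MvPolynomial.C (φ.coeff 0) := MvPolynomial.totalDegree_eq_zero_iff_eq_C.1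
      (Nat.le_zero.1 h1.totalDegree_le)
    rw [e, MvPolynomial.eval_C] at h3
    rw [e, h3]; simp
  | succ n ih =>
    refine red (n + 1) fun φ h1 h2 h3 α => ?_
    set H := φ.divMonomial (Finsupp.single i 1) with hH
    set G := φ.modMonomial (Finsupp.single i 1) with hG
    have hdec : MvPolynomial.X i * H + G = φ := MvPolynomial.divMonomial_add_modMonomial_single φ i
    have cH : ∀ β, H.coeff β = φ.coeff (Finsupp.single i 1 + β) := fun β => MvPolynomial.coeff_divMonomial _ _ _
    have cG : ∀ β, G.coeff β ≠ 0 → β i = 0 ∧ φ.coeff β ≠ 0 := by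
      intro β hβ
      by_cases hle : Finsupp.single i 1 ≤ β
      · exact absurd (MvPolynomial.coeff_modMonomial_of_le _ hle) hβ
      · rw [MvPolynomial.coeff_modMonomial_of_not_le _ hle] at hβ
        refine ⟨?_, hβ⟩
        rw [Finsupp.single_le_iff] at hle
        omega
    have hHh : H.IsHomogeneous n := by
      intro β hβ
      rw [cH] at hβ
      have : (Finsupp.single i 1 + β).degree = n + 1 := by
        by_contra h; exact hβ (h1.coeff_eq_zero h)
      rw [map_add, Finsupp.degree_single] at this
      change (Finsupp.weight fun _ => 1) β = n
      rw [← Finsupp.degree_eq_weight_one]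
      omega
    have hGh : G.IsHomogeneous (n + 1) := fun β hβ => h1 (cG β hβ).2
    have hHs : SV (i + 1) H := by
      intro β hβ j hj
      rw [cH] at hβ
      have := h2 _ hβ j hj
      rw [Finsupp.add_apply] at this
      omega
    have hGs : SV i G := by
      intro β hβ j hj
      rcases eq_or_lt_of_le hj with h | h
      · have : j = i := Fin.ext h.symm
        rw [this]; exact (cG β hβ).1
      · exact h2 _ (cG β hβ).2 j h
    have e1 : a i * MvPolynomial.eval a H + MvPolynomial.eval a G = 0 := by
      rw [← h3, ← hdec]; simp
    have hGm : MvPolynomial.eval a G ∈ Ji a i ^ (n + 1) := by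
      have := eval_mem_Ji (a := a) (I := ⊤) (n + 1) G hGh hGs (fun _ => Submodule.mem_top)
      rwa [Ideal.top_mul] at this
    have hHm : MvPolynomial.eval a H ∈ Ji a i ^ (n + 1) := by
      apply hQ.nzd hb
      rw [mul_comm, eq_neg_of_add_eq_zero_left e1]
      exact neg_mem hGm
    have cHJ := ih H hHh hHs (Ideal.pow_right_mono hJJ _ hHm)
    obtain ⟨h, k1, k2, k3⟩ := exists_rep i (n + 1) _ hHm
    have cGJ := hQ (n + 1) (G + MvPolynomial.C (a i) * h) (hGh.add (by
      have := (MvPolynomial.isHomogeneous_C (Fin d) (a i)).mul k1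
      rwa [zero_add] at this)) (hGs.add (k2.C_mul _)) (by
      rw [map_add, map_mul, MvPolynomial.eval_C, k3, add_comm (MvPolynomial.eval a G), e1]; exact zero_mem _)
    rw [← hdec, MvPolynomial.coeff_add]
    refine add_mem ?_ ?_
    · rw [MvPolynomial.coeff_X_mul']
      split_ifs
      · exact cHJ _
      · exact zero_mem _
    · have h5 := hJJ (cGJ α)
      rw [MvPolynomial.coeff_add, MvPolynomial.coeff_C_mul] at h5
      exact (Ideal.add_mem_iff_left _ (Ideal.mul_mem_right _ _ hai)).1 h5

theorem qr_of_regular (h : ∀ i : Fin d, ∀ r, r * a i ∈ Ji a i → r ∈ Ji a i) : QR a := by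
  have h1 : ∀ i, i ≤ d → QI a i := by
    intro i
    induction i with
    | zero => exact fun _ => QI_zero
    | succ i ih => exact fun hi => (ih (by omega)).succ (i := ⟨i, hi⟩) (h ⟨i, hi⟩)
  have h2 := h1 d le_rfl
  have hJ : Ji a d = sp a := by
    rw [Ji, sp, ← Set.image_univ]; congr 2; ext j; simp
  intro n φ h3 h4
  rw [← hJ] at h4 ⊢
  exact h2 n φ h3 (fun α _ j hj => absurd j.2 (by omega)) h4

end quasi
end E1

namespace E1

section lemZ
universe u v

theorem F_map {A : Type u} {B : Type v} [CommRing A] [CommRing B] (f : A →+* B) {I : Ideal A} {I' : Ideal B}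
    (h : I.map f ≤ I') {k : ℕ} {x : A} (hx : x ∈ F I k) : f x ∈ F I' k := by
  obtain ⟨N, hN⟩ := mem_F.1 hx
  refine mem_F.2 ⟨N, fun n => ?_⟩
  rw [← map_pow]
  have := Ideal.mem_map_of_mem f (hN n)
  rw [Ideal.map_pow] at this
  exact Ideal.pow_right_mono h _ this

theorem lemZ_dom {D : Type u} [CommRing D] [IsDomain D] [IsLocalRing D] [IsNoetherianRing D] {u : D} (hu : u ≠ 0)
    (hp : ∀ P : Ideal D, P.IsPrime → P ≠ ⊥ → u ∈ P) (hF : ∀ q, u ∈ F (maximalIdeal D) q) : False := by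
  have hum : u ∈ maximalIdeal D := by
    obtain ⟨N, hN⟩ := mem_F.1 (hF 1)
    have := hN (N + 1)
    rw [one_mul, Nat.add_sub_cancel_left, pow_one] at this
    exact (maximalIdeal.isMaximal D).isPrime.mem_of_pow_mem _ this
  have hmin : maximalIdeal D ∈ (Ideal.span {u}).minimalPrimes := by
    by_contra h
    have h1 : ¬ ((maximalIdeal D : Set D) ⊆ ⋃ P ∈ (Ideal.span {u}).minimalPrimes, (id P : Ideal D)) := by
      rw [Ideal.subset_union_prime_finite (Ideal.finite_minimalPrimes_of_isNoetherianRing D _) (f := id) 0 0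
        (fun P hP _ _ => hP.isPrime)]
      rintro ⟨P, hP, hle⟩
      have : maximalIdeal D = P := (maximalIdeal.isMaximal D).eq_of_le hP.isPrime.ne_top hle
      exact h (this ▸ hP)
    rw [Set.not_subset] at h1
    obtain ⟨y, hy, hyn⟩ := h1
    simp only [Set.mem_iUnion, not_exists] at hyn
    obtain ⟨P, hP, hPm⟩ := Ideal.exists_minimalPrimes_le (I := Ideal.span {y}) (J := maximalIdeal D)
      ((Ideal.span_singleton_le_iff_mem _).2 hy)
    have hPp := hP.isPrime
    have hyP : y ∈ P := hP.1.2 (Ideal.mem_span_singleton_self y)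
    have hy0 : P ≠ ⊥ := by
      rintro rfl
      have hy0 : y = 0 := by simpa using hyP
      obtain ⟨P0, hP0, _⟩ := Ideal.exists_minimalPrimes_le (I := Ideal.span {u}) (J := maximalIdeal D)
        ((Ideal.span_singleton_le_iff_mem _).2 hum)
      refine hyn P0 hP0 ?_
      rw [hy0]; exact zero_mem P0
    obtain ⟨P2, hP2, hle⟩ := Ideal.exists_minimalPrimes_le (I := Ideal.span {u}) (J := P)
      ((Ideal.span_singleton_le_iff_mem _).2 (hp P hPp hy0))
    have hP2p := hP2.isPrime
    have hlt : P2 < P := lt_of_le_of_ne hle (by rintro rfl; exact hyn _ hP2 hyP)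
    have hlt0 : (⊥ : Ideal D) < P2 := by
      rw [bot_lt_iff_ne_bot]
      rintro rfl
      have : u ∈ (⊥ : Ideal D) := hP2.1.2 (Ideal.mem_span_singleton_self u)
      exact hu (by simpa using this)
    have h3 := Ideal.height_le_one_of_isPrincipal_of_mem_minimalPrimes _ _ hP
    have hb : (⊥ : Ideal D).IsPrime := Ideal.isPrime_bot
    have h4 := Ideal.height_strict_mono_of_isPrime_of_isPrime hlt
    have h5 := Ideal.height_strict_mono_of_isPrime_of_isPrime hlt0
    have h6 : P2.height < 1 := lt_of_lt_of_le h4 h3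
    rw [Order.lt_one_iff] at h6
    rw [h6] at h5
    exact not_lt_zero h5
  have hrad : (Ideal.span {u}).radical = maximalIdeal D := by
    rw [Ideal.radical_eq_sInf]
    apply le_antisymm
    · exact sInf_le ⟨hmin.1.2, hmin.isPrime⟩
    · refine le_sInf ?_
      rintro P ⟨h1, h2⟩
      exact hmin.2 ⟨h2, h1⟩ (IsLocalRing.le_maximalIdeal h2.ne_top)
  obtain ⟨h0, hh0⟩ := Ideal.exists_radical_pow_le_of_fg (Ideal.span {u}) (IsNoetherian.noetherian _)
  rw [hrad] at hh0
  obtain ⟨h, hh1, hh⟩ : ∃ h, 1 ≤ h ∧ maximalIdeal D ^ h ≤ Ideal.span {u} :=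
    ⟨h0 + 1, by omega, (Ideal.pow_le_pow_right (Nat.le_succ _)).trans hh0⟩
  obtain ⟨N, hN⟩ := mem_F.1 (hF (h * 2))
  have h1 := hN (N + 1)
  have h2 : u ^ (N + 1) ∈ maximalIdeal D ^ (h * (N + 2)) := by
    refine Ideal.pow_le_pow_right ?_ h1
    apply Nat.le_sub_of_add_le
    nlinarith
  rw [pow_mul] at h2
  have h3 := Ideal.pow_right_mono hh _ h2
  rw [Ideal.span_singleton_pow, Ideal.mem_span_singleton] at h3
  obtain ⟨c, hc⟩ := h3
  have h4 : u ^ (N + 1) * (1 - u * c) = 0 := by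
    rw [mul_sub, mul_one]; nth_rewrite 1 [hc]; ring
  rcases mul_eq_zero.1 h4 with h5 | h5
  · exact hu (pow_eq_zero_iff (Nat.succ_ne_zero N) |>.1 h5)
  · have : u * c = 1 := (sub_eq_zero.1 h5).symm
    exact (mem_nonunits_iff.1 hum) (IsUnit.of_mul_eq_one c this)

theorem lemZ {A : Type u} [CommRing A] [IsLocalRing A] [IsNoetherianRing A] {u : A}
    (hF : ∀ q, u ∈ F (maximalIdeal A) q) : IsNilpotent u := by
  by_contra hu
  have hne : {Q : Ideal A | Q.IsPrime ∧ u ∉ Q}.Nonempty := by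
    by_contra h
    apply hu
    rw [← mem_nilradical, nilradical_eq_sInf, Ideal.mem_sInf]
    intro Q hQ
    by_contra h2
    exact h ⟨Q, hQ, h2⟩
  obtain ⟨Q, ⟨hQp, hQu⟩, hmax⟩ := set_has_maximal_iff_noetherian.2 (inferInstance : IsNoetherian A A) _ hne
  have : Nontrivial (A ⧸ Q) := Ideal.Quotient.nontrivial_iff.2 hQp.ne_top
  have hloc : IsLocalRing (A ⧸ Q) := IsLocalRing.of_surjective' (Ideal.Quotient.mk Q) Ideal.Quotient.mk_surjective
  have hdom : IsDomain (A ⧸ Q) := Ideal.Quotient.isDomain Q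
  refine lemZ_dom (D := A ⧸ Q) (u := Ideal.Quotient.mk Q u) ?_ ?_ ?_
  · intro h; exact hQu (Ideal.Quotient.eq_zero_iff_mem.1 h)
  · intro P hP hP0
    by_contra hPu
    have h1 : (P.comap (Ideal.Quotient.mk Q)).IsPrime := Ideal.comap_isPrime _ P
    refine hmax (P.comap (Ideal.Quotient.mk Q)) ⟨h1, fun h => hPu h⟩ ?_
    refine lt_of_le_of_ne ?_ ?_
    · intro z hz
      rw [Ideal.mem_comap, Ideal.Quotient.eq_zero_iff_mem.2 hz]; exact zero_mem P
    · intro h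
      apply hP0
      rw [eq_bot_iff]
      intro z hz
      obtain ⟨z, rfl⟩ := Ideal.Quotient.mk_surjective z
      have : z ∈ Q := by rw [h]; exact hz
      exact Ideal.Quotient.eq_zero_iff_mem.2 this
  · intro q
    refine F_map _ ?_ (hF q)
    rw [IsLocalRing.map_maximalIdeal_of_surjective _ Ideal.Quotient.mk_surjective]

end lemZ

section VF
universe u
variable {R : Type u} [CommRing R]

theorem F_pow (J : Ideal R) (p k : ℕ) : F (J ^ p) k ≤ F J (p * k) := by
  intro x hx
  obtain ⟨N, hN⟩ := mem_F.1 hx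
  refine mem_F.2 ⟨p * N, fun n => ?_⟩
  have := hN n
  rw [← pow_mul] at this
  refine Ideal.pow_le_pow_right ?_ this
  rw [Nat.mul_sub, mul_assoc]

theorem F_of_pow_mem_mul {I : Ideal R} {x : R} {n0 : ℕ} (h : x ^ (n0 + 1) ∈ I * (I ⊔ Ideal.span {x}) ^ n0) :
    x ∈ F I 1 := by
  set K := I ⊔ Ideal.span {x} with hK
  have h1 : ∀ m, K ^ (m + 1) ≤ I * K ^ m ⊔ Ideal.span {x ^ (m + 1)} := by
    intro m
    induction m with
    | zero => simp [hK]
    | succ m ih =>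
      rw [pow_succ' K (m + 1)]
      nth_rewrite 1 [hK]
      rw [Ideal.sup_mul]
      refine sup_le le_sup_left ?_
      refine (Ideal.mul_mono_right ih).trans ?_
      rw [Ideal.mul_sup, Ideal.span_singleton_mul_span_singleton, ← pow_succ' x]
      refine sup_le_sup_right ?_ _
      rw [mul_left_comm]
      refine Ideal.mul_mono_right ?_
      rw [pow_succ' K m]
      exact Ideal.mul_mono_left le_sup_right
  have h2 : ∀ n ≥ n0, K ^ (n + 1) = I * K ^ n := by
    intro n hn
    apply le_antisymm
    · obtain ⟨k, rfl⟩ := Nat.exists_eq_add_of_le hn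
      have h3 : K ^ (n0 + 1) ≤ I * K ^ n0 := (h1 n0).trans
        (sup_le le_rfl ((Ideal.span_singleton_le_iff_mem _).2 h))
      have : n0 + k + 1 = (n0 + 1) + k := by omega
      rw [this, pow_add, pow_add K n0 k, ← mul_assoc]
      exact Ideal.mul_mono_left h3
    · rw [pow_succ']; exact Ideal.mul_mono_left le_sup_left
  rw [← F_eq_of_reduction le_sup_left h2]
  apply pow_le_F
  rw [pow_one]
  exact Ideal.mem_sup_right (Ideal.mem_span_singleton_self x)

theorem absZ {C : Type u} [CommRing C] [IsNoetherianRing C] {cc : Ideal C} (htop : cc ≠ ⊤) {b : C}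
    (hbF : ∀ q, b ∈ F cc q) : ∃ s : C, s ≠ 0 ∧ ∃ k : ℕ, s * b ^ k = 0 := by
  obtain ⟨mm, hmm, hle⟩ := Ideal.exists_le_maximal cc htop
  have hmp : mm.IsPrime := hmm.isPrime
  have hnil : IsNilpotent (algebraMap C (Localization.AtPrime mm) b) := by
    have : IsNoetherianRing (Localization.AtPrime mm) :=
      IsLocalization.isNoetherianRing mm.primeCompl _ inferInstance
    refine lemZ fun q => F_map (algebraMap C (Localization.AtPrime mm)) ?_ (hbF q)
    rw [← Localization.AtPrime.map_eq_maximalIdeal]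
    exact Ideal.map_mono hle
  obtain ⟨k, hk⟩ := hnil
  rw [← map_pow, IsLocalization.map_eq_zero_iff mm.primeCompl] at hk
  obtain ⟨⟨s, hs⟩, hs0⟩ := hk
  refine ⟨s, ?_, k, hs0⟩
  rintro rfl
  exact hs (zero_mem mm)

theorem F_of_asymp [IsNoetherianRing R] {J : Ideal R} {b : R} (hb : b ∈ J) (hbn : b ∈ nonZeroDivisors R)
    {x : R} {p : ℕ} (h : ∀ q, x ^ q ∈ F J (p * q - 1)) : x ∈ F J p := by
  classical
  rcases Nat.eq_zero_or_pos p with rfl | hp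
  · rw [F_zero]; trivial
  set L := Localization.Away x
  set y : L := IsLocalization.Away.invSelf x with hy
  have hxy : algebraMap R L x * y = 1 := IsLocalization.Away.mul_invSelf x
  obtain ⟨G, hG⟩ : (J ^ p).FG := IsNoetherian.noetherian _
  set S : Set L := (fun g => algebraMap R L g * y) '' (G : Set R) with hS
  set C := Algebra.adjoin R S with hC
  have hSC : ∀ g ∈ J ^ p, algebraMap R L g * y ∈ C := by
    intro g hg
    rw [← hG] at hg
    induction hg using Submodule.span_induction with
    | mem g hg => exact Algebra.subset_adjoin ⟨g, hg, rfl⟩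
    | zero => rw [map_zero, zero_mul]; exact zero_mem C
    | add g g' _ _ h1 h2 => rw [map_add, add_mul]; exact add_mem h1 h2
    | smul c g _ h1 =>
      rw [smul_eq_mul, map_mul, mul_assoc]
      exact mul_mem (C.algebraMap_mem c) h1
  set cc : Ideal C := Ideal.span {z | ∃ g ∈ J ^ p, (z : L) = algebraMap R L g * y} with hcc
  have hNoe : IsNoetherianRing C := by
    have : C.FG := ⟨G.image (fun g => algebraMap R L g * y), by rw [hC, hS, Finset.coe_image]⟩
    have : Algebra.FiniteType R C := (Subalgebra.fg_iff_finiteType C).1 this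
    exact Algebra.FiniteType.isNoetherianRing R C
  -- the key relation
  have hJx : ∀ q, (J ^ (p * q)).map (algebraMap R C) ≤ Ideal.span {algebraMap R C x} ^ q * cc ^ q := by
    intro q
    rw [pow_mul, Ideal.map_pow, ← mul_pow]
    refine Ideal.pow_right_mono ?_ q
    rw [Ideal.map_le_iff_le_comap]
    intro g hg
    rw [Ideal.mem_comap]
    have : algebraMap R C g = algebraMap R C x * ⟨_, hSC g hg⟩ := by
      apply Subtype.ext
      change algebraMap R L g = algebraMap R L x * (algebraMap R L g * y)
      rw [mul_left_comm, hxy, mul_one]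
    rw [this]
    exact Ideal.mul_mem_mul (Ideal.mem_span_singleton_self _) (Ideal.subset_span ⟨g, hg, rfl⟩)
  have hxC : ∀ n (z w : C), algebraMap R C x ^ n * z = algebraMap R C x ^ n * w → z = w := by
    intro n z w hzw
    have h1 := congrArg (Subtype.val) hzw
    apply Subtype.ext
    change (algebraMap R L x) ^ n * (z : L) = (algebraMap R L x) ^ n * (w : L) at h1
    have h2 := congrArg (y ^ n * ·) h1
    simp only [← mul_assoc, ← mul_pow, mul_comm y, hxy, one_pow, one_mul] at h2
    exact h2
  have hbF : ∀ q, algebraMap R C b ∈ F cc q := by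
    intro q
    have h1 : b * x ^ q ∈ F J (p * q) := by
      rcases Nat.eq_zero_or_pos q with rfl | hq
      · simp [F_zero]
      · have hb1 : b ∈ F J 1 := pow_le_F J 1 (by rwa [pow_one])
        have := mul_mem_F hb1 (h q)
        have hpq : 1 ≤ p * q := Nat.mul_pos hp hq
        rwa [Nat.add_sub_cancel' hpq] at this
    obtain ⟨N, hN⟩ := mem_F.1 h1
    refine mem_F.2 ⟨q * N, fun m => ?_⟩
    rw [← Nat.mul_sub]
    rcases le_total m N with hm | hm
    · rw [Nat.sub_eq_zero_of_le hm]; simp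
    obtain ⟨n, rfl⟩ := Nat.exists_eq_add_of_le hm
    rw [Nat.add_sub_cancel_left]
    have h2 : b ^ (N + n) * x ^ (q * n) ∈ J ^ (p * (q * n)) := by
      have := Ideal.mul_mem_mul (Ideal.pow_mem_pow hb N) (hN n)
      rw [← pow_add] at this
      have e : b ^ (N + n) * x ^ (q * n) = b ^ N * (b * x ^ q) ^ n := by
        rw [mul_pow, pow_add, pow_mul]; ring
      rw [e]
      refine Ideal.pow_le_pow_right ?_ this
      rw [← mul_assoc]; omega
    have h3 := hJx _ (Ideal.mem_map_of_mem (algebraMap R C) h2)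
    rw [Ideal.span_singleton_pow, Ideal.mem_span_singleton_mul] at h3
    obtain ⟨z, hz, hzz⟩ := h3
    rw [map_mul, map_pow, map_pow, mul_comm ((algebraMap R C) b ^ (N + n))] at hzz
    rw [← hxC _ _ _ hzz]; exact hz
  by_cases htop : cc = ⊤
  · -- integral
    set K := J ^ p ⊔ Ideal.span {x} with hK
    have hxK : x ∈ K := Ideal.mem_sup_right (Ideal.mem_span_singleton_self x)
    have hCr : ∀ z ∈ C, ∃ N, ∃ k ∈ K ^ N, algebraMap R L x ^ N * z = algebraMap R L k := by
      intro z hz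
      induction hz using Algebra.adjoin_induction with
      | mem z hz =>
        obtain ⟨g, hg, rfl⟩ := hz
        refine ⟨1, g, ?_, ?_⟩
        · rw [pow_one]; exact Ideal.mem_sup_left (by rw [← hG]; exact Ideal.subset_span hg)
        · simp only [pow_one]
          rw [mul_left_comm, hxy, mul_one]
      | algebraMap r => exact ⟨0, r, by simp, by simp⟩
      | add z w _ _ hz hw =>
        obtain ⟨N, k, hk, e1⟩ := hz
        obtain ⟨M, l, hl, e2⟩ := hw
        refine ⟨N + M, k * x ^ M + x ^ N * l, add_mem ?_ ?_, ?_⟩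
        · rw [pow_add]; exact Ideal.mul_mem_mul hk (Ideal.pow_mem_pow hxK M)
        · rw [pow_add]; exact Ideal.mul_mem_mul (Ideal.pow_mem_pow hxK N) hl
        · rw [map_add, map_mul, map_mul, ← e1, ← e2, map_pow, map_pow]; ring
      | mul z w _ _ hz hw =>
        obtain ⟨N, k, hk, e1⟩ := hz
        obtain ⟨M, l, hl, e2⟩ := hw
        refine ⟨N + M, k * l, ?_, ?_⟩
        · rw [pow_add]; exact Ideal.mul_mem_mul hk hl
        · rw [map_mul, ← e1, ← e2]; ring
    have hcr : ∀ z ∈ cc, ∃ N, ∃ k ∈ J ^ p * K ^ N, algebraMap R L x ^ (N + 1) * (z : L) = algebraMap R L k := by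
      intro z hz
      induction hz using Submodule.span_induction with
      | mem z hz =>
        obtain ⟨g, hg, e⟩ := hz
        refine ⟨0, g, by simpa using hg, ?_⟩
        rw [e, zero_add, pow_one, mul_left_comm, hxy, mul_one]
      | zero => exact ⟨0, 0, zero_mem _, by simp⟩
      | add z w _ _ hz hw =>
        obtain ⟨N, k, hk, e1⟩ := hz
        obtain ⟨M, l, hl, e2⟩ := hw
        refine ⟨N + M, k * x ^ M + l * x ^ N, add_mem ?_ ?_, ?_⟩
        · rw [pow_add, ← mul_assoc]; exact Ideal.mul_mem_mul hk (Ideal.pow_mem_pow hxK M)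
        · rw [add_comm, pow_add, ← mul_assoc]; exact Ideal.mul_mem_mul hl (Ideal.pow_mem_pow hxK N)
        · rw [map_add, map_mul, map_mul, ← e1, ← e2, map_pow, map_pow]
          change _ * ((z : L) + (w : L)) = _
          ring
      | smul c z _ hz =>
        obtain ⟨N, k, hk, e1⟩ := hz
        obtain ⟨M, l, hl, e2⟩ := hCr c c.2
        refine ⟨N + M, k * l, ?_, ?_⟩
        · rw [pow_add, ← mul_assoc]; exact Ideal.mul_mem_mul hk hl
        · rw [map_mul, ← e1, ← e2]
          change _ * ((c : L) * (z : L)) = _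
          ring
    obtain ⟨N, k, hk, e⟩ := hcr 1 (by rw [htop]; trivial)
    have e' : algebraMap R L (x ^ (N + 1)) = algebraMap R L k := by
      rw [← e, map_pow]; change _ = _ * (1 : L); rw [mul_one]
    obtain ⟨⟨_, M, rfl⟩, hM⟩ := (IsLocalization.eq_iff_exists (Submonoid.powers x) L).1 e'
    dsimp only at hM
    have h1 : x ^ (M + N + 1) ∈ J ^ p * K ^ (M + N) := by
      rw [add_assoc, pow_add x M, hM, pow_add K, mul_left_comm]
      exact Ideal.mul_mem_mul (Ideal.pow_mem_pow hxK M) hk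
    have := F_pow J p 1 (F_of_pow_mem_mul h1)
    rwa [mul_one] at this
  · exfalso
    obtain ⟨s, hs, k, hs0⟩ := absZ htop hbF
    have hs1 : (s : L) * algebraMap R L b ^ k = 0 := congrArg Subtype.val hs0
    have hbL : algebraMap R L b ∈ nonZeroDivisors L :=
      IsLocalization.map_nonZeroDivisors_le (Submonoid.powers x) L ⟨b, hbn, rfl⟩
    have hs2 : (s : L) = 0 := (mem_nonZeroDivisors_iff.1 (pow_mem hbL k)).2 _ hs1
    exact hs (Subtype.ext hs2)

end VF
end E1

namespace E1
section VP
universe u v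

lemma noeth_of_complete {R A : Type u} [CommRing R] [CommRing A] [IsNoetherianRing R]
    (φ : R →+* A) (M : Ideal A) [IsAdicComplete M A] {n : ℕ} (x : Fin n → A)
    (hM : M = Ideal.span (Set.range x)) (hs : ∀ y, ∃ r, y - φ r ∈ M) : IsNoetherianRing A := by
  let _ : WithIdeal A := ⟨M⟩
  have had : IsAdic M := rfl
  obtain ⟨h1, h2⟩ := had.isAdicComplete_iff.1 inferInstance
  let _ : UniformSpace R := ⊥
  have _ : DiscreteTopology R := ⟨rfl⟩
  have _ : IsUniformAddGroup R := inferInstance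
  have _ : IsLinearTopology A A := inferInstance
  have hx : MvPowerSeries.HasEval x := ⟨fun i => by
      have : x i ∈ M := by rw [hM]; exact Ideal.subset_span ⟨i, rfl⟩
      rw [IsTopologicallyNilpotent, had.hasBasis_nhds_zero.tendsto_right_iff]
      intro k _
      filter_upwards [Filter.eventually_ge_atTop k] with j hj
      exact Ideal.pow_le_pow_right hj (Ideal.pow_mem_pow this j), by simp [Filter.cofinite_eq_bot]⟩
  let f := MvPowerSeries.eval₂Hom (φ := φ) (a := x) continuous_of_discreteTopology hx
  have hfX : ∀ i, f (MvPowerSeries.X i) = x i := fun i => by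
    simp only [f, MvPowerSeries.coe_eval₂Hom]; exact MvPowerSeries.eval₂_X ..
  have hfC : ∀ r, f (MvPowerSeries.C r) = φ r := fun i => by
    simp only [f, MvPowerSeries.coe_eval₂Hom]; exact MvPowerSeries.eval₂_C ..
  have hmap : (Ideal.span (Set.range (MvPowerSeries.X : Fin n → MvPowerSeries (Fin n) R))).map f = M := by
    rw [Ideal.map_span, ← Set.range_comp, hM]; congr 2; ext i; exact hfX i
  have : IsHausdorff ((Ideal.span (Set.range (MvPowerSeries.X : Fin n → MvPowerSeries (Fin n) R))).map f) A := by
    rw [hmap]; infer_instance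
  have hsurj : Function.Surjective f := by
    apply surjective_of_mk_map_comp_surjective f (I := Ideal.span (Set.range MvPowerSeries.X))
    intro y
    obtain ⟨y, rfl⟩ := Ideal.Quotient.mk_surjective y
    obtain ⟨r, hr⟩ := hs y
    refine ⟨MvPowerSeries.C r, ?_⟩
    rw [RingHom.comp_apply, hfC, eq_comm, Ideal.Quotient.eq, hmap]; exact hr
  exact isNoetherianRing_of_surjective _ _ f hsurj

lemma noeth_completion {R : Type u} [CommRing R] [IsLocalRing R] [IsNoetherianRing R] :
    IsNoetherianRing (AdicCompletion (maximalIdeal R) R) := by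
  obtain ⟨n, s, hs⟩ := Submodule.fg_iff_exists_fin_generating_family.1 (IsNoetherian.noetherian (maximalIdeal R))
  refine noeth_of_complete (algebraMap R (AdicCompletion (maximalIdeal R) R)) (maximalIdeal (AdicCompletion (maximalIdeal R) R)) 
    (fun i => algebraMap R _ (s i)) ?_ ?_
  · rw [AdicCompletion.maximalIdeal_eq_map, ← hs]
    change Ideal.map _ (Ideal.span _) = _
    rw [Ideal.map_span, ← Set.range_comp]; rfl
  · intro y
    obtain ⟨r, hr⟩ := (AdicCompletion.residueField_map_bijective (R := R)).2 (residue _ y)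
    obtain ⟨r, rfl⟩ := residue_surjective r
    refine ⟨r, ?_⟩
    rw [← residue_eq_zero_iff, map_sub, ← hr, ResidueField.map_residue, sub_self]

end VP
end E1

namespace E1
section VP2
universe u v

lemma mono_stab (f : ℕ → ℕ) (hf : Monotone f) (B : ℕ) (hB : ∀ n, f n ≤ B) :
    ∃ k, ∀ n, k ≤ n → f n = f k := by
  classical
  have hP : ∃ v, ∃ k, B - f k = v := ⟨_, 0, rfl⟩
  obtain ⟨k, hk⟩ := Nat.find_spec hP
  refine ⟨k, fun n hn => ?_⟩
  have := Nat.find_min' hP ⟨n, rfl⟩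
  have h1 := hf hn
  have h2 := hB n
  have h3 := hB k
  omega

lemma chev_abs {R A : Type u} [CommRing R] [IsLocalRing R] [IsNoetherianRing R]
    [CommRing A] [IsLocalRing A] [IsNoetherianRing A] [IsReduced A] [IsAdicComplete (maximalIdeal A) A]
    (φ : R →+* A) (h1 : (maximalIdeal R).map φ ≤ maximalIdeal A)
    (h2 : ∀ n r, φ r ∈ maximalIdeal A ^ n → r ∈ maximalIdeal R ^ n)
    (J : Ideal R) (hJ : J ≤ maximalIdeal R) (n0 : ℕ) : ∃ β, F J β ≤ maximalIdeal R ^ n0 := by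
  classical
  set m := maximalIdeal R with hm
  set M := maximalIdeal A with hM
  by_contra hcon
  push Not at hcon
  have hpow : ∀ n r, r ∈ m ^ n → φ r ∈ M ^ n := fun n r hr => by
    have := Ideal.mem_map_of_mem φ hr
    rw [Ideal.map_pow] at this
    exact Ideal.pow_right_mono h1 n this
  have hst : ∀ n, ∃ k, ∀ b, k ≤ b → F J b ⊔ m ^ n = F J k ⊔ m ^ n := by
    intro n
    have hft : ∀ b, len (F J b ⊔ m ^ n) ≠ ⊤ := fun b => len_ne_top (n := n) le_sup_right
    have hmon : ∀ a b, a ≤ b → F J b ⊔ m ^ n ≤ F J a ⊔ m ^ n := fun a b h => sup_le_sup_right (F_anti J h) _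
    have hle : ∀ b, len (F J b ⊔ m ^ n) ≤ len (m ^ n) := fun b => len_anti le_sup_right
    obtain ⟨k, hk⟩ := mono_stab (fun b => (len (F J b ⊔ m ^ n)).toNat)
      (fun a b h => ENat.toNat_le_toNat (len_anti (hmon a b h)) (hft b)) (len (m ^ n)).toNat
      (fun b => ENat.toNat_le_toNat (hle b) (len_ne_top (n := n) le_rfl))
    refine ⟨k, fun b hb => eq_of_len_le (hmon k b hb) ?_ ?_⟩
    · exact hft _
    · have := hk b hb
      rw [← ENat.coe_toNat (hft b), ← ENat.coe_toNat (hft k), this]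
  choose k hk using hst
  have key : ∀ n y, y ∈ F J (k n) ⊔ m ^ n → ∃ y' ∈ F J (k (n+1)) ⊔ m ^ (n+1), y' - y ∈ m ^ n := by
    intro n y hy
    rw [← hk n (max (k n) (k (n+1))) (le_max_left _ _)] at hy
    obtain ⟨u, hu, v, hv, rfl⟩ := Submodule.mem_sup.1 hy
    refine ⟨u, Ideal.mem_sup_left (F_anti J (le_max_right _ _) hu), ?_⟩
    rw [sub_add_cancel_left]; exact neg_mem hv
  obtain ⟨y0, hy0, hy0n⟩ := Set.not_subset.1 (hcon (k n0))
  choose! g hg1 hg2 using key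
  let y : ℕ → R := fun n => Nat.rec y0 (fun i z => g (n0 + i) z) n
  have hyD : ∀ i, y i ∈ F J (k (n0+i)) ⊔ m ^ (n0+i) := by
    intro i
    induction i with
    | zero => exact Ideal.mem_sup_left hy0
    | succ i ih => exact hg1 (n0+i) (y i) ih
  have hyd : ∀ i, y (i+1) - y i ∈ m ^ (n0+i) := fun i => hg2 (n0+i) (y i) (hyD i)
  have hyd2 : ∀ i j, y (i+j) - y i ∈ m ^ (n0+i) := by
    intro i j
    induction j with
    | zero => simp
    | succ j ih =>
      have := add_mem (Ideal.pow_le_pow_right (by omega) (hyd (i+j)) : _ ∈ m ^ (n0 + i)) ih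
      rwa [sub_add_sub_cancel] at this
  obtain ⟨L, hL⟩ := IsPrecomplete.prec (I := M) (M := A) inferInstance (f := fun i => φ (y i)) (by
    intro a b hab
    obtain ⟨j, rfl⟩ := Nat.exists_eq_add_of_le hab
    rw [SModEq.comm, SModEq.sub_mem, smul_eq_mul, Ideal.mul_top, ← map_sub]
    exact Ideal.pow_le_pow_right (by omega) (hpow _ _ (hyd2 a j)))
  have hL' : ∀ n, φ (y n) - L ∈ M ^ n := fun n => by
    have := hL n
    rwa [SModEq.sub_mem, smul_eq_mul, Ideal.mul_top] at this
  have hLF : ∀ q, L ∈ F M q := by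
    intro q
    have e : L = φ (y q) - (φ (y q) - L) := by ring
    have h3 : φ (y q) ∈ F M q := by
      have := hyD q
      rw [← hk (n0+q) (max (k (n0+q)) q) (le_max_left _ _)] at this
      obtain ⟨u, hu, v, hv, e⟩ := Submodule.mem_sup.1 this
      rw [← e, map_add]
      refine add_mem (F_map φ ((Ideal.map_mono hJ).trans h1) (F_anti J (le_max_right _ _) hu)) ?_
      exact pow_le_F M q (Ideal.pow_le_pow_right (by omega) (hpow _ _ hv))
    rw [e]
    exact sub_mem h3 (pow_le_F M q (hL' q))
  have hL0 : L = 0 := (lemZ hLF).eq_zero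
  have h4 := h2 n0 _ (by simpa [hL0] using hL' n0)
  have h5 := sub_mem h4 (Ideal.pow_le_pow_right (by omega) (hyd2 0 n0) : _ ∈ m ^ n0)
  rw [zero_add, sub_sub_cancel] at h5
  exact hy0n h5

lemma chev {R : Type u} [CommRing R] [IsLocalRing R] [IsNoetherianRing R]
    (hred : IsReduced (AdicCompletion (maximalIdeal R) R))
    {J : Ideal R} (hJ : J ≤ maximalIdeal R) {N0 : ℕ} (hN0 : maximalIdeal R ^ N0 ≤ J) (n : ℕ) :
    ∃ β, F J β ≤ J ^ n := by
  have := noeth_completion (R := R)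
  obtain ⟨β, hβ⟩ := chev_abs (algebraMap R (AdicCompletion (maximalIdeal R) R))
    (AdicCompletion.maximalIdeal_eq_map (R := R)).ge (by
      intro n r hr
      rw [AdicCompletion.maximalIdeal_eq_map, ← Ideal.map_pow, ← Submodule.restrictScalars_mem R,
        ← Ideal.smul_top_eq_map,
        AdicCompletion.pow_smul_top_eq_ker_eval (IsNoetherian.noetherian _), LinearMap.mem_ker,
        AdicCompletion.algebraMap_apply] at hr
      have := (AdicCompletion.eval_of (maximalIdeal R) R n r).symm.trans hr
      rw [Submodule.mkQ_apply, Submodule.Quotient.mk_eq_zero, smul_eq_mul, Ideal.mul_top] at this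
      exact this) J hJ (N0 * n)
  refine ⟨β, hβ.trans ?_⟩
  rw [pow_mul]
  exact Ideal.pow_right_mono hN0 n

end VP2
end E1

namespace E1
section VR
universe u v

lemma exists_fun {k V : Type u} [Field k] [AddCommGroup V] [Module k V] (b0 : V) (hb : b0 ≠ 0) :
    ∃ ψ : V →+ k, (∀ (c : k) b, ψ (c • b) = c * ψ b) ∧ ψ b0 ≠ 0 := by
  obtain ⟨f, hf⟩ : ∃ f : Module.Dual k V, f b0 ≠ 0 := by
    by_contra h
    push Not at h
    exact hb ((Module.forall_dual_apply_eq_zero_iff k b0).1 h)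
  exact ⟨f.toAddMonoidHom, fun c b => f.map_smul c b, hf⟩

lemma mv_addHom_ext {σ k M : Type*} [CommSemiring k] [AddCommMonoid M] (f g : MvPolynomial σ k →+ M)
    (h : ∀ δ b, f (MvPolynomial.monomial δ b) = g (MvPolynomial.monomial δ b)) : f = g := by
  refine DFunLike.ext _ _ fun x => ?_
  induction x using MvPolynomial.induction_on' with
  | monomial δ b => exact h δ b
  | add p q hp hq => rw [map_add, map_add, hp, hq]

lemma exists_psi {k : Type u} [Field k] (p : ℕ) [ExpChar k p] (n : ℕ) (b0 : k) (hb : b0 ≠ 0) :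
    ∃ ψ : k →+ k, (∀ c b, ψ (c ^ p ^ n * b) = c * ψ b) ∧ ψ b0 ≠ 0 := by
  let M : Module k k := Module.compHom k (iterateFrobenius k p n)
  obtain ⟨f, hf1, hf⟩ := @exists_fun k k _ _ M b0 hb
  refine ⟨f, fun c b => ?_, hf⟩
  have := hf1 c b
  change f ((iterateFrobenius k p n c) * b) = c * f b at this
  rw [iterateFrobenius_def] at this
  exact this

lemma exists_phi {k : Type u} [Field k] {d : ℕ} (p : ℕ) [ExpChar k p] (n : ℕ)
    (h : MvPolynomial (Fin d) k) (hh : h ≠ 0) :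
    ∃ φ : MvPolynomial (Fin d) k →+ MvPolynomial (Fin d) k,
      (∀ g h, φ (g ^ p ^ n * h) = g * φ h) ∧ φ h ≠ 0 := by
  classical
  set q := p ^ n with hq
  have hq0 : 0 < q := pow_pos (expChar_pos k p) n
  obtain ⟨γ0, h0⟩ := MvPolynomial.ne_zero_iff.1 hh
  obtain ⟨ψ, hψ, hψ0⟩ := exists_psi p n _ h0
  let β : Fin d →₀ ℕ := γ0.mapRange (· % q) (Nat.zero_mod q)
  let dv : (Fin d →₀ ℕ) → (Fin d →₀ ℕ) := fun δ => δ.mapRange (· / q) (Nat.zero_div q)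
  have hdm : ∀ δ, q • dv δ + δ.mapRange (· % q) (Nat.zero_mod q) = δ := fun δ => by
    ext i; simp [dv, Nat.div_add_mod]
  have hdv : ∀ γ, dv (q • γ + β) = γ := fun γ => by
    ext i
    simp only [dv, β, Finsupp.mapRange_apply, Finsupp.add_apply, Finsupp.smul_apply, smul_eq_mul]
    rw [Nat.mul_add_div hq0, Nat.div_eq_of_lt (Nat.mod_lt _ hq0), add_zero]
  let T : (Fin d →₀ ℕ) → (k →+ MvPolynomial (Fin d) k) := fun δ =>
    if q • dv δ + β = δ then ((MvPolynomial.monomial (dv δ)).toAddMonoidHom.comp ψ) else 0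
  let φ : MvPolynomial (Fin d) k →+ MvPolynomial (Fin d) k :=
    { toFun := fun h => ∑ δ ∈ h.support, T δ (h.coeff δ)
      map_zero' := by simp
      map_add' := fun x y => by
        have e : ∀ z : MvPolynomial (Fin d) k, z.support ⊆ x.support ∪ y.support →
            ∑ δ ∈ z.support, T δ (z.coeff δ) = ∑ δ ∈ x.support ∪ y.support, T δ (z.coeff δ) := fun z hz =>
          Finset.sum_subset hz (fun δ _ hd => by rw [MvPolynomial.notMem_support_iff.1 hd, map_zero])
        rw [e _ MvPolynomial.support_add, e x Finset.subset_union_left, e y Finset.subset_union_right,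
          ← Finset.sum_add_distrib]
        simp }
  have hφm : ∀ δ b, φ (MvPolynomial.monomial δ b) = T δ b := fun δ b => by
    change ∑ δ' ∈ _, _ = _
    by_cases hb : b = 0
    · simp [hb]
    · rw [MvPolynomial.support_monomial, if_neg hb]; simp
  have hT : ∀ γ δ c b, T (q • γ + δ) (c ^ q * b) = MvPolynomial.monomial γ c * T δ b := by
    intro γ δ c b
    have e1 : dv (q • γ + δ) = γ + dv δ := by
      ext i
      simp only [dv, Finsupp.mapRange_apply, Finsupp.add_apply, Finsupp.smul_apply, smul_eq_mul]
      rw [Nat.mul_add_div hq0]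
    simp only [T]
    rw [e1]
    by_cases hd : q • dv δ + β = δ
    · rw [if_pos hd, if_pos (by rw [smul_add, add_assoc, hd])]
      change MvPolynomial.monomial _ (ψ _) = _ * MvPolynomial.monomial _ (ψ _)
      rw [MvPolynomial.monomial_mul, hψ]
    · rw [if_neg hd, if_neg (fun h => hd (by rw [smul_add, add_assoc] at h; exact add_left_cancel h))]
      simp
  refine ⟨φ, fun g h => ?_, fun h1 => ?_⟩
  · have h1 : ∀ δ b, φ (g ^ q * MvPolynomial.monomial δ b) = g * φ (MvPolynomial.monomial δ b) := by
      intro δ b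
      have : (φ.comp (AddMonoidHom.mulRight (MvPolynomial.monomial δ b))).comp
          (iterateFrobenius (MvPolynomial (Fin d) k) p n).toAddMonoidHom =
          AddMonoidHom.mulRight (φ (MvPolynomial.monomial δ b)) := by
        apply mv_addHom_ext
        intro γ c
        change φ (iterateFrobenius (MvPolynomial (Fin d) k) p n (MvPolynomial.monomial γ c) * MvPolynomial.monomial δ b) = 
          MvPolynomial.monomial γ c * φ (MvPolynomial.monomial δ b)
        rw [iterateFrobenius_def, ← hq, MvPolynomial.monomial_pow, MvPolynomial.monomial_mul, hφm, hφm, hT]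
      have h2 := DFunLike.congr_fun this g
      change φ (iterateFrobenius (MvPolynomial (Fin d) k) p n g * _) = g * _ at h2
      rwa [iterateFrobenius_def, ← hq] at h2
    have : φ.comp (AddMonoidHom.mulLeft (g ^ q)) = (AddMonoidHom.mulLeft g).comp φ :=
      mv_addHom_ext _ _ (fun δ b => h1 δ b)
    exact DFunLike.congr_fun this h
  · have h2 : ∀ δ b, (T δ b).coeff (dv γ0) = if δ = γ0 then ψ b else 0 := by
      intro δ b
      simp only [T]
      by_cases hd : q • dv δ + β = δ
      · rw [if_pos hd]
        change (MvPolynomial.monomial (dv δ) (ψ b)).coeff _ = _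
        rw [MvPolynomial.coeff_monomial]
        refine if_congr ⟨fun e => ?_, fun e => by rw [e]⟩ rfl rfl
        rw [← hd, e]; exact hdm γ0
      · rw [if_neg hd, if_neg (fun e => hd (by rw [e]; exact hdm γ0))]
        simp
    have h3 : (φ h).coeff (dv γ0) = ψ (h.coeff γ0) := by
      change MvPolynomial.coeff _ (∑ δ ∈ _, _) = _
      rw [MvPolynomial.coeff_sum]
      simp only [h2]
      rw [Finset.sum_ite_eq', if_pos (MvPolynomial.mem_support_iff.2 h0)]
    rw [h1, MvPolynomial.coeff_zero] at h3
    exact hψ0 h3.symm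

lemma exists_f0 {P K L : Type u} [CommRing P] [IsDomain P] [IsIntegrallyClosed P] [Field K] [Algebra P K]
    [IsFractionRing P K] [Field L] [Algebra K L] [FiniteDimensional K L] [Algebra P L] [IsScalarTower P K L]
    (p : ℕ) [ExpChar K p] (y : L) (hy : y ≠ 0) :
    ∃ (n : ℕ) (f0 : L →+ K), (∀ (c : K) z, f0 (c • z) = c ^ (p ^ n) * f0 z) ∧
      (∀ z, IsIntegral P z → ∃ g, algebraMap P K g = f0 z) ∧ f0 y ≠ 0 := by
  let S := separableClosure K L
  have : ExpChar S p := expChar_of_injective_algebraMap (algebraMap K S).injective p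
  have : ExpChar L p := expChar_of_injective_algebraMap (algebraMap K L).injective p
  have : FiniteDimensional S L := FiniteDimensional.right K S L
  have hex := (IsPurelyInseparable.hasExponent_iff' S L p).1 inferInstance
  obtain ⟨n, hn⟩ := hex
  choose τ hτ using hn
  have : IsScalarTower P S L := IsScalarTower.to₁₃₄ P K S L
  have hinj : Function.Injective (algebraMap S L) := (algebraMap S L).injective
  have hτy : τ y ≠ 0 := by
    intro h
    have := hτ y
    rw [h, map_zero] at this
    exact hy (pow_eq_zero_iff (pow_pos (expChar_pos K p) n).ne' |>.1 this.symm)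
  have hsep : Algebra.IsSeparable K S := inferInstance
  have hfd : FiniteDimensional K S := inferInstance
  obtain ⟨s0, hs0⟩ : ∃ s : S, Algebra.trace K S (s * τ y) ≠ 0 := by
    by_contra h
    push Not at h
    apply hτy
    exact (traceForm_nondegenerate K S).2 (τ y) (fun s => h s)
  have halg : IsAlgebraic P s0 := by
    have h1 : IsAlgebraic K s0 := Algebra.IsAlgebraic.isAlgebraic s0
    exact (IsFractionRing.isAlgebraic_iff P K S).2 h1
  obtain ⟨r, hr, hrs⟩ := halg.exists_integral_multiple
  let f0 : L →+ K :=
    { toFun := fun z => Algebra.trace K S (r • s0 * τ z)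
      map_zero' := by
        have : τ 0 = 0 := hinj (by rw [hτ, zero_pow (pow_pos (expChar_pos K p) n).ne', map_zero])
        rw [this]; simp
      map_add' := fun x z => by
        have : τ (x + z) = τ x + τ z := hinj (by rw [hτ, map_add, hτ, hτ, add_pow_expChar_pow])
        rw [this, mul_add, map_add] }
  refine ⟨n, f0, ?_, ?_, ?_⟩
  · intro c z
    have : τ (c • z) = c ^ p ^ n • τ z := hinj (by
      rw [hτ, Algebra.smul_def, Algebra.smul_def, map_mul, hτ, mul_pow, ← IsScalarTower.algebraMap_apply, map_pow])
    change Algebra.trace K S (r • s0 * τ (c • z)) = _ * Algebra.trace K S (r • s0 * τ z)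
    rw [this, mul_smul_comm, map_smul, smul_eq_mul]
  · intro z hz
    have h1 : IsIntegral P (τ z) := by
      have : IsIntegral P (algebraMap S L (τ z)) := by rw [hτ]; exact hz.pow _
      exact (isIntegral_algebraMap_iff hinj).1 this
    have h2 : IsIntegral P (Algebra.trace K S (r • s0 * τ z)) := Algebra.isIntegral_trace (hrs.mul h1)
    exact IsIntegrallyClosed.isIntegral_iff.1 h2
  · change Algebra.trace K S (r • s0 * τ y) ≠ 0
    rw [smul_mul_assoc, ← IsScalarTower.algebraMap_smul K r, map_smul, smul_eq_mul]
    refine mul_ne_zero ?_ hs0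
    rwa [Ne, IsFractionRing.to_map_eq_zero_iff]

end VR
end E1

namespace E1
section VR2
universe u v

lemma fd_of_rank {P K B L : Type u} [CommRing P] [IsDomain P] [Field K] [Algebra P K] [IsFractionRing P K]
    [CommRing B] [IsDomain B] [Algebra P B] [Field L] [Algebra B L] [IsFractionRing B L] [Algebra K L]
    [Algebra P L] [IsScalarTower P K L] [IsScalarTower P B L] (e : ℕ)
    (hrank : ∀ z : Fin (e+1) → B, ∃ g : Fin (e+1) → P, g ≠ 0 ∧ ∑ i, g i • z i = 0) :
    FiniteDimensional K L := by
  classical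
  have : Module.rank K L ≤ e := by
    apply rank_le
    intro s hs
    by_contra hcon
    push Not at hcon
    obtain ⟨t, hts, htc⟩ := Finset.exists_subset_card_eq (show e + 1 ≤ s.card from hcon)
    let eq := t.equivFinOfCardEq htc
    let l : Fin (e+1) → L := fun i => (eq.symm i : L)
    have hl : LinearIndependent K l := by
      have := hs.comp (fun i : Fin (e+1) => (⟨(eq.symm i : L), hts (eq.symm i).2⟩ : s)) (by
        intro i j h
        simp only [Subtype.mk.injEq] at h
        exact eq.symm.injective (Subtype.ext h))
      exact this
    obtain ⟨⟨c, hc⟩, hb⟩ := IsLocalization.exist_integer_multiples_of_finset (nonZeroDivisors B) t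
    choose b hb using fun i : Fin (e+1) => hb (eq.symm i) (eq.symm i).2
    obtain ⟨g, hg, hs⟩ := hrank b
    apply hg
    have h1 : ∑ i, (algebraMap P K (g i)) • l i = 0 := by
      have h2 := congrArg (algebraMap B L) hs
      rw [map_sum, map_zero] at h2
      have h3 : ∀ i, algebraMap B L (g i • b i) = algebraMap B L c * (algebraMap P K (g i) • l i) := by
        intro i
        rw [algebraMap_smul, Algebra.smul_def, map_mul, hb i, ← IsScalarTower.algebraMap_apply, Algebra.smul_def,
          Algebra.smul_def]
        change _ * (algebraMap B L c * l i) = _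
        ring
      simp only [h3] at h2
      rw [← Finset.mul_sum] at h2
      refine (mul_eq_zero.1 h2).resolve_left ?_
      intro h5
      exact nonZeroDivisors.ne_zero hc (IsFractionRing.to_map_eq_zero_iff.1 h5)
    have h4 := Fintype.linearIndependent_iff.1 hl _ h1
    funext i
    exact (IsFractionRing.to_map_eq_zero_iff (K := K)).1 (h4 i)
  exact Module.rank_lt_aleph0_iff.1 (this.trans_lt Cardinal.natCast_lt_aleph0)

lemma exists_functional_dom {k : Type u} [Field k] {d : ℕ} {B : Type u} [CommRing B] [IsDomain B]
    [Algebra (MvPolynomial (Fin d) k) B]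
    (hinj : Function.Injective (algebraMap (MvPolynomial (Fin d) k) B))
    (hIntg : ∀ z : B, IsIntegral (MvPolynomial (Fin d) k) z) (e : ℕ)
    (hrank : ∀ z : Fin (e+1) → B, ∃ g : Fin (e+1) → MvPolynomial (Fin d) k, g ≠ 0 ∧ ∑ i, g i • z i = 0)
    (x : B) (hx : x ≠ 0) :
    ∃ f : B →+ MvPolynomial (Fin d) k, (∀ g z, f (g • z) = g * f z) ∧ f x ≠ 0 := by
  let K := FractionRing (MvPolynomial (Fin d) k)
  let L := FractionRing B
  have hBL : Function.Injective (algebraMap B L) := IsFractionRing.injective B L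
  have : FaithfulSMul (MvPolynomial (Fin d) k) L := by
    rw [faithfulSMul_iff_algebraMap_injective, IsScalarTower.algebraMap_eq (MvPolynomial (Fin d) k) B L]
    exact hBL.comp hinj
  letI : Algebra K L := FractionRing.liftAlgebra _ _
  have : FiniteDimensional K L := fd_of_rank (P := MvPolynomial (Fin d) k) (B := B) e hrank
  have hPK : Function.Injective (algebraMap (MvPolynomial (Fin d) k) K) := IsFractionRing.injective _ K
  let p := ringExpChar k
  have : ExpChar K p := by
    have : ExpChar (MvPolynomial (Fin d) k) p := inferInstance
    exact expChar_of_injective_ringHom hPK p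
  obtain ⟨n, f0, h1, h2, h3⟩ := exists_f0 (P := MvPolynomial (Fin d) k) (K := K) p (algebraMap B L x)
    (by rwa [Ne, IsFractionRing.to_map_eq_zero_iff])
  choose G hG using fun z : B => h2 (algebraMap B L z) ((hIntg z).algebraMap)
  have hGx : G x ≠ 0 := fun h => h3 (by rw [← hG, h, map_zero])
  obtain ⟨φ, hφ, hφx⟩ := exists_phi p n (G x) hGx
  let Ga : B →+ MvPolynomial (Fin d) k :=
    { toFun := G
      map_zero' := hPK (by rw [hG, map_zero, map_zero, map_zero])
      map_add' := fun a b => hPK (by rw [hG, map_add, map_add, map_add, hG, hG]) }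
  refine ⟨φ.comp Ga, fun g z => ?_, hφx⟩
  change φ (G (g • z)) = g * φ (G z)
  rw [← hφ]
  congr 1
  apply hPK
  rw [hG, map_mul, map_pow, hG, ← h1, Algebra.smul_def g z, map_mul, ← IsScalarTower.algebraMap_apply,
    IsScalarTower.algebraMap_apply (MvPolynomial (Fin d) k) K L, ← Algebra.smul_def]

lemma exists_functional {k : Type u} [Field k] {d : ℕ} {A : Type u} [CommRing A] [IsReduced A]
    (ρ : MvPolynomial (Fin d) k →+* A) (htf : ∀ g z, ρ g * z = 0 → g = 0 ∨ z = 0)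
    (hIntg : ∀ z, ρ.IsIntegralElem z) (e : ℕ)
    (hrank : ∀ z : Fin (e+1) → A, ∃ g : Fin (e+1) → MvPolynomial (Fin d) k, g ≠ 0 ∧ ∑ i, ρ (g i) * z i = 0)
    (x : A) (hx : x ≠ 0) :
    ∃ f : A →+ MvPolynomial (Fin d) k, (∀ g z, f (ρ g * z) = g * f z) ∧ f x ≠ 0 := by
  let S : Submonoid A :=
    { carrier := {y | ∃ g n, g ≠ 0 ∧ y = ρ g * x ^ n}
      one_mem' := ⟨1, 0, one_ne_zero, by simp⟩
      mul_mem' := by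
        rintro _ _ ⟨g, n, hg, rfl⟩ ⟨h, m, hh, rfl⟩
        exact ⟨g * h, n + m, mul_ne_zero hg hh, by rw [map_mul, pow_add]; ring⟩ }
  have hS0 : Disjoint ((⊥ : Ideal A) : Set A) (S : Set A) := by
    rw [Set.disjoint_left]
    rintro y hy ⟨g, n, hg, rfl⟩
    have := (htf g _ hy).resolve_left hg
    exact hx (IsNilpotent.eq_zero ⟨n, this⟩)
  obtain ⟨q, hq, -, hqS⟩ := Ideal.exists_le_prime_disjoint ⊥ S hS0
  let B := A ⧸ q
  let π := Ideal.Quotient.mk q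
  letI : Algebra (MvPolynomial (Fin d) k) B := (π.comp ρ).toAlgebra
  have halg : ∀ g, algebraMap (MvPolynomial (Fin d) k) B g = π (ρ g) := fun g => rfl
  have hsm : ∀ g z, g • π z = π (ρ g * z) := fun g z => by rw [Algebra.smul_def, halg, map_mul]
  have hxq : π x ≠ 0 := fun h => Set.disjoint_left.1 hqS (Ideal.Quotient.eq_zero_iff_mem.1 h) ⟨1, 1, one_ne_zero, by simp⟩
  obtain ⟨f, hf1, hf2⟩ := exists_functional_dom (k := k) (d := d) (B := B) (by
      rw [injective_iff_map_eq_zero]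
      intro g hg
      by_contra hg0
      exact Set.disjoint_left.1 hqS (Ideal.Quotient.eq_zero_iff_mem.1 hg) ⟨g, 0, hg0, by simp⟩)
    (by
      intro z
      obtain ⟨z, rfl⟩ := Ideal.Quotient.mk_surjective z
      obtain ⟨P, hP1, hP2⟩ := hIntg z
      refine ⟨P, hP1, ?_⟩
      have := congrArg π hP2
      rwa [Polynomial.hom_eval₂, map_zero] at this) e
    (by
      intro z
      choose w hw using fun i => Ideal.Quotient.mk_surjective (z i)
      obtain ⟨g, hg, hs⟩ := hrank w
      refine ⟨g, hg, ?_⟩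
      have := congrArg π hs
      rw [map_sum, map_zero] at this
      rw [← this]
      exact Finset.sum_congr rfl fun i _ => by rw [← hw]; exact hsm _ _)
    (π x) hxq
  exact ⟨f.comp π.toAddMonoidHom, fun g z => by
    change f (π (ρ g * z)) = g * f (π z); rw [← hsm, hf1], hf2⟩

theorem claimN {k : Type u} [Field k] {d : ℕ} {A : Type u} [CommRing A] [IsReduced A]
    (ρ : MvPolynomial (Fin d) k →+* A) (htf : ∀ g z, ρ g * z = 0 → g = 0 ∨ z = 0)
    (hIntg : ∀ z, ρ.IsIntegralElem z) (e : ℕ)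
    (hrank : ∀ z : Fin (e+1) → A, ∃ g : Fin (e+1) → MvPolynomial (Fin d) k, g ≠ 0 ∧ ∑ i, ρ (g i) * z i = 0) :
    ∃ s : Finset A, ∀ z, ∃ g : A → MvPolynomial (Fin d) k, z = ∑ b ∈ s, ρ (g b) * b := by
  classical
  let Fn := {f : A →+ MvPolynomial (Fin d) k // ∀ g z, f (ρ g * z) = g * f z}
  have hf0 : Fn := ⟨0, by simp⟩
  have key : ∀ r : ℕ, (∃ (f : ℕ → Fn) (x : ℕ → A), ∀ i < r, (f i).1 (x i) ≠ 0 ∧ ∀ j < i, (f j).1 (x i) = 0) ∨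
      ∃ (r' : ℕ) (f : ℕ → Fn), ∀ z, (∀ i < r', (f i).1 z = 0) → z = 0 := by
    intro r
    induction r with
    | zero => exact Or.inl ⟨fun _ => hf0, fun _ => 0, by simp⟩
    | succ r ih =>
      rcases ih with ⟨f, x, h⟩ | h
      · by_cases hz : ∀ z, (∀ i < r, (f i).1 z = 0) → z = 0
        · exact Or.inr ⟨r, f, hz⟩
        · left
          push Not at hz
          obtain ⟨z, hz1, hz2⟩ := hz
          obtain ⟨f', hf', hfz⟩ := exists_functional ρ htf hIntg e hrank z hz2
          refine ⟨Function.update f r ⟨f', hf'⟩, Function.update x r z, fun i hi => ?_⟩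
          rcases Nat.lt_succ_iff_lt_or_eq.1 hi with hi | rfl
          · rw [Function.update_of_ne hi.ne, Function.update_of_ne hi.ne]
            refine ⟨(h i hi).1, fun j hj => ?_⟩
            rw [Function.update_of_ne (hj.trans hi).ne]
            exact (h i hi).2 j hj
          · rw [Function.update_self, Function.update_self]
            refine ⟨hfz, fun j hj => ?_⟩
            rw [Function.update_of_ne hj.ne]
            exact hz1 j hj
      · exact Or.inr h
  rcases key (e + 1) with ⟨f, x, h⟩ | ⟨r, f, hf⟩
  · exfalso
    obtain ⟨g, hg, hs⟩ := hrank (fun i => x i)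
    apply hg
    funext i
    obtain ⟨i, hi⟩ := i
    induction i using Nat.strong_induction_on with
    | _ i ih =>
      have h1 := congrArg (f i).1 hs
      rw [map_sum, map_zero, Finset.sum_eq_single (⟨i, hi⟩ : Fin (e+1))] at h1
      · rw [(f i).2] at h1
        exact (mul_eq_zero.1 h1).resolve_right (h i hi).1
      · rintro ⟨j, hj⟩ - hne
        rw [(f i).2]
        rcases lt_or_gt_of_ne (fun h => hne (Fin.ext h) : j ≠ i) with hlt | hlt
        · rw [ih j hlt hj]; simp
        · rw [(h j hj).2 i hlt, mul_zero]
      · simp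
  · letI : Algebra (MvPolynomial (Fin d) k) A := ρ.toAlgebra
    have hsm : ∀ g (z : A), g • z = ρ g * z := fun g z => Algebra.smul_def g z
    let Φ : A →ₗ[MvPolynomial (Fin d) k] (Fin r → MvPolynomial (Fin d) k) :=
      { toFun := fun z i => (f i).1 z
        map_add' := fun a b => by funext i; simp
        map_smul' := fun g z => by funext i; rw [hsm, (f i).2]; rfl }
    have hΦ : Function.Injective Φ := by
      rw [injective_iff_map_eq_zero]
      intro z hz
      exact hf z fun i hi => congrFun hz ⟨i, hi⟩
    have : IsNoetherian (MvPolynomial (Fin d) k) A := isNoetherian_of_injective Φ hΦ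
    obtain ⟨s, hs⟩ := IsNoetherian.noetherian (⊤ : Submodule (MvPolynomial (Fin d) k) A)
    refine ⟨s, fun z => ?_⟩
    have : z ∈ Submodule.span (MvPolynomial (Fin d) k) (s : Set A) := hs ▸ trivial
    obtain ⟨g, -, hg⟩ := Submodule.mem_span_finset.1 this
    exact ⟨g, by rw [← hg]; exact Finset.sum_congr rfl fun b _ => hsm _ _⟩

end VR2
end E1

namespace E1

section VQ
universe u
variable {R : Type u} [CommRing R]

theorem mem_Fr_iff {J : Ideal R} {i E : ℕ} (hE : 0 < E) {x : R} :
    x ∈ Fr J i E ↔ x ^ E ∈ F J i := by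
  rw [mem_Fr, mem_F]
  constructor
  · rintro ⟨N, h⟩
    refine ⟨N, fun n => ?_⟩
    have := h (E * n)
    rw [pow_mul] at this
    rwa [show i * (E * n) / E = i * n by
      rw [show i * (E * n) = E * (i * n) by ring, Nat.mul_div_cancel_left _ hE]] at this
  · rintro ⟨N, h⟩
    refine ⟨N + i, fun n => ?_⟩
    have h1 := h (n / E)
    rw [← pow_mul] at h1
    have h2 : i * n / E ≤ i * (n / E) + i := by
      rw [Nat.div_le_iff_le_mul_add_pred hE]
      have := Nat.div_add_mod n E
      have h3 := Nat.mod_lt n hE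
      calc i * n = i * (E * (n / E)) + i * (n % E) := by rw [← mul_add, this]
        _ ≤ i * (E * (n/E)) + i * E := by gcongr
        _ = E * (i * (n / E) + i) := by ring
        _ ≤ _ := Nat.le_add_right _ _
    have h4 : x ^ n = x ^ (E * (n / E)) * x ^ (n % E) := by
      rw [← pow_add, Nat.div_add_mod]
    rw [h4]
    exact Ideal.mul_mem_right _ _ (Ideal.pow_le_pow_right (by omega) h1)

theorem Fr_zero {J : Ideal R} {E : ℕ} (hE : 0 < E) (x : R) : x ∈ Fr J 0 E := by
  rw [mem_Fr_iff hE, F_zero]; trivial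

theorem Fr_anti (J : Ideal R) {E : ℕ} (hE : 0 < E) {k l : ℕ} (h : k ≤ l) :
    Fr J l E ≤ Fr J k E := fun x hx => by
  rw [mem_Fr_iff hE] at *
  exact F_anti J h hx

theorem mul_mem_Fr {J : Ideal R} {E : ℕ} (hE : 0 < E) {k l : ℕ} {x y : R}
    (hx : x ∈ Fr J k E) (hy : y ∈ Fr J l E) : x * y ∈ Fr J (k + l) E := by
  rw [mem_Fr_iff hE] at *
  rw [mul_pow]
  exact mul_mem_F hx hy

theorem F_le_Fr {J : Ideal R} {E : ℕ} (hE : 0 < E) (n : ℕ) : F J n ≤ Fr J (n * E) E := fun x hx => by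
  rw [mem_Fr_iff hE]
  exact pow_mem_F hx E

theorem Fr_le_F {J : Ideal R} {E : ℕ} (hE : 0 < E) (n : ℕ) : Fr J (n * E) E ≤ F J n := fun x hx => by
  rw [mem_Fr_iff hE] at hx
  exact F_of_pow_mem hE hx

theorem pow_le_Fr {J : Ideal R} {E : ℕ} (hE : 0 < E) (n : ℕ) : J ^ n ≤ Fr J (n * E) E :=
  (pow_le_F J n).trans (F_le_Fr hE n)

/-- the extended Rees-type subring -/
def Sr (J : Ideal R) (E : ℕ) (hE : 0 < E) : Subring R[X] where
  carrier := {p | ∀ i, p.coeff i ∈ Fr J i E}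
  mul_mem' := fun {p q} hp hq i => by
    rw [Polynomial.coeff_mul]
    refine Ideal.sum_mem _ fun uv huv => ?_
    rw [← Finset.HasAntidiagonal.mem_antidiagonal.1 huv]
    exact mul_mem_Fr hE (hp _) (hq _)
  one_mem' := fun i => by
    rw [Polynomial.coeff_one]
    split_ifs with h
    · subst h; exact Fr_zero hE _
    · exact zero_mem _
  add_mem' := fun {p q} hp hq i => by
    rw [Polynomial.coeff_add]; exact add_mem (hp i) (hq i)
  zero_mem' := fun i => by simp
  neg_mem' := fun {p} hp i => by
    rw [Polynomial.coeff_neg]; exact neg_mem (hp i)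

def Ir (J : Ideal R) (E : ℕ) (hE : 0 < E) : Ideal (Sr J E hE) where
  carrier := {p | ∀ i, p.1.coeff i ∈ Fr J (i + 1) E}
  add_mem' := fun {p q} hp hq i => by
    show (p.1 + q.1).coeff i ∈ _
    rw [Polynomial.coeff_add]; exact add_mem (hp i) (hq i)
  zero_mem' := fun i => by simp
  smul_mem' := fun c p hp i => by
    show (c.1 * p.1).coeff i ∈ _
    rw [Polynomial.coeff_mul]
    refine Ideal.sum_mem _ fun uv huv => ?_
    rw [← Finset.HasAntidiagonal.mem_antidiagonal.1 huv, add_assoc]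
    exact mul_mem_Fr hE (c.2 _) (hp _)

abbrev Ar (J : Ideal R) (E : ℕ) (hE : 0 < E) : Type u := Sr J E hE ⧸ Ir J E hE

/-- the quotient map -/
noncomputable def mkA (J : Ideal R) (E : ℕ) (hE : 0 < E) : Sr J E hE →+* Ar J E hE :=
  Ideal.Quotient.mk (Ir J E hE)

theorem mkA_surj (J : Ideal R) (E : ℕ) (hE : 0 < E) : Function.Surjective (mkA J E hE) :=
  Ideal.Quotient.mk_surjective

theorem mkA_eq_zero {J : Ideal R} {E : ℕ} {hE : 0 < E} {p : Sr J E hE} :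
    mkA J E hE p = 0 ↔ ∀ i, p.1.coeff i ∈ Fr J (i + 1) E :=
  Ideal.Quotient.eq_zero_iff_mem

variable {J : Ideal R} {E : ℕ} {hE : 0 < E}

theorem mono_mem_Sr (hE : 0 < E) {i : ℕ} {x : R} (hx : x ∈ Fr J i E) : C x * X ^ i ∈ Sr J E hE := fun n => by
  rw [Polynomial.coeff_C_mul_X_pow]
  split_ifs with h
  · subst h; exact hx
  · exact zero_mem _

/-- truncation: nonzero elements have a representative with nonzero leading symbol -/
theorem exists_lead {z : Ar J E hE} (hz : z ≠ 0) :
    ∃ p : Sr J E hE, mkA J E hE p = z ∧ ∃ i, p.1.natDegree ≤ i ∧ p.1.coeff i ∉ Fr J (i + 1) E := by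
  obtain ⟨p, rfl⟩ := mkA_surj J E hE z
  obtain ⟨n, hn⟩ : ∃ n, p.1.natDegree ≤ n := ⟨_, le_rfl⟩
  induction n generalizing p with
  | zero =>
    by_cases h : p.1.coeff 0 ∈ Fr J 1 E
    · exfalso
      apply hz
      rw [mkA_eq_zero]
      intro i
      rcases Nat.eq_zero_or_pos i with rfl | hi
      · exact h
      · rw [Polynomial.coeff_eq_zero_of_natDegree_lt (by omega)]; exact zero_mem _
    · exact ⟨p, rfl, 0, hn, h⟩
  | succ n ih =>
    by_cases h : p.1.coeff (n + 1) ∈ Fr J (n + 1 + 1) E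
    · let t : Sr J E hE := ⟨C (p.1.coeff (n+1)) * X ^ (n+1), mono_mem_Sr hE (p.2 _)⟩
      have ht : mkA J E hE t = 0 := by
        rw [mkA_eq_zero]
        intro i
        show (C (p.1.coeff (n+1)) * X ^ (n+1)).coeff i ∈ _
        rw [Polynomial.coeff_C_mul_X_pow]
        split_ifs with h'
        · subst h'; exact h
        · exact zero_mem _
      have e1 : mkA J E hE (p - t) = mkA J E hE p := by rw [map_sub, ht, sub_zero]
      have := ih (p - t) (by rwa [e1]) (by
        rw [Polynomial.natDegree_le_iff_coeff_eq_zero]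
        intro N hN
        show (p.1 - C (p.1.coeff (n+1)) * X ^ (n+1)).coeff N = 0
        rw [Polynomial.coeff_sub, Polynomial.coeff_C_mul_X_pow]
        split_ifs with h'
        · subst h'; simp
        · rw [Polynomial.coeff_eq_zero_of_natDegree_lt (by omega), sub_zero])
      rwa [e1] at this
    · exact ⟨p, rfl, n + 1, hn, h⟩

end VQ

section VQ2
universe u
variable {R : Type u} [CommRing R] {d : ℕ} {a : Fin d → R} {E : ℕ}

/-- `φ ↦ φ(a T^E)` -/
noncomputable def evT (a : Fin d → R) (E : ℕ) : MvPolynomial (Fin d) R →+* R[X] :=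
  MvPolynomial.eval₂Hom Polynomial.C (fun j => C (a j) * X ^ E)

theorem evT_C (r : R) : evT a E (MvPolynomial.C r) = C r := by simp [evT]

theorem evT_monomial (α : Fin d →₀ ℕ) (r : R) :
    evT a E (MvPolynomial.monomial α r) = C (r * mon a α) * X ^ (α.degree * E) := by
  rw [evT, MvPolynomial.coe_eval₂Hom, MvPolynomial.eval₂_monomial, Finsupp.prod_fintype _ _ (by simp)]
  simp only [mul_pow, Finset.prod_mul_distrib, ← pow_mul, Finset.prod_pow_eq_pow_sum, C_mul, mon,
    map_prod, C_pow, mul_assoc, Finsupp.degree_eq_sum, Finset.sum_mul]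
  simp only [mul_comm]

theorem evT_homog {n : ℕ} {Φ : MvPolynomial (Fin d) R} (h : Φ.IsHomogeneous n) :
    evT a E Φ = C (MvPolynomial.eval a Φ) * X ^ (n * E) := by
  conv_lhs => rw [Φ.as_sum]
  rw [map_sum, MvPolynomial.eval_eq', map_sum, Finset.sum_mul]
  refine Finset.sum_congr rfl fun α hα => ?_
  rw [evT_monomial, show α.degree = n from ?_]
  · rfl
  · rw [Finsupp.degree_eq_weight_one]; exact h (MvPolynomial.mem_support_iff.1 hα)

theorem evT_coeff (hE : 0 < E) (φ : MvPolynomial (Fin d) R) (n : ℕ) :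
    (evT a E φ).coeff (n * E) = MvPolynomial.eval a (MvPolynomial.homogeneousComponent n φ) := by
  induction φ using MvPolynomial.induction_on' with
  | add p q hp hq => simp [hp, hq]
  | monomial α r =>
    rw [evT_monomial, Polynomial.coeff_C_mul_X_pow]
    split_ifs with h
    · have : α.degree = n := (Nat.eq_of_mul_eq_mul_right hE h).symm
      rw [MvPolynomial.homogeneousComponent_of_mem (MvPolynomial.isHomogeneous_monomial r this),
        if_pos rfl, MvPolynomial.eval_monomial, mon, Finsupp.prod_fintype _ _ (by simp)]
    · rw [MvPolynomial.homogeneousComponent_of_mem (MvPolynomial.isHomogeneous_monomial r rfl),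
        if_neg, map_zero]
      rintro rfl; exact h rfl

theorem evT_coeff_dvd (φ : MvPolynomial (Fin d) R) {u : ℕ} (hu : ¬ E ∣ u) :
    (evT a E φ).coeff u = 0 := by
  induction φ using MvPolynomial.induction_on' with
  | add p q hp hq => simp [hp, hq]
  | monomial α r =>
    rw [evT_monomial, Polynomial.coeff_C_mul_X_pow, if_neg]
    rintro rfl; exact hu (Dvd.intro_left _ rfl)

theorem evT_coeff_mem (hE : 0 < E) (φ : MvPolynomial (Fin d) R) {u n : ℕ} (hu : n * E ≤ u) :
    (evT a E φ).coeff u ∈ sp a ^ n := by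
  by_cases h : E ∣ u
  · obtain ⟨v, rfl⟩ := h
    rw [mul_comm E v, evT_coeff hE]
    have : n ≤ v := by
      rw [mul_comm E v] at hu
      exact Nat.le_of_mul_le_mul_right hu hE
    exact Ideal.pow_le_pow_right this (eval_mem_pow (MvPolynomial.homogeneousComponent_isHomogeneous v φ))
  · rw [evT_coeff_dvd φ h]; exact zero_mem _

theorem evT_natDegree (φ : MvPolynomial (Fin d) R) : (evT a E φ).natDegree ≤ φ.totalDegree * E := by
  conv_lhs => rw [φ.as_sum]
  rw [map_sum]
  refine Polynomial.natDegree_sum_le_of_forall_le _ _ fun α hα => ?_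
  rw [evT_monomial]
  refine (Polynomial.natDegree_C_mul_X_pow_le _ _).trans ?_
  gcongr
  rw [Finsupp.degree_eq_sum]
  have := MvPolynomial.le_totalDegree hα
  rwa [Finsupp.sum_fintype _ _ (by simp)] at this

theorem evT_mem (hE : 0 < E) (φ : MvPolynomial (Fin d) R) : evT a E φ ∈ Sr (sp a) E hE := fun u => by
  by_cases h : E ∣ u
  · obtain ⟨v, rfl⟩ := h
    rw [mul_comm E v]
    exact pow_le_Fr hE v (evT_coeff_mem hE φ le_rfl)
  · rw [evT_coeff_dvd φ h]; exact zero_mem _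

theorem evT_mem_I [IsLocalRing R] (hE : 0 < E) (hm : F (sp a) 1 = maximalIdeal R)
    (φ : MvPolynomial (Fin d) R) (h : ∀ α, φ.coeff α ∈ maximalIdeal R) (u : ℕ) :
    (evT a E φ).coeff u ∈ Fr (sp a) (u + 1) E := by
  rw [φ.as_sum, map_sum, Polynomial.finsetSum_coeff]
  refine Ideal.sum_mem _ fun α _ => ?_
  rw [evT_monomial, Polynomial.coeff_C_mul_X_pow]
  split_ifs with hu
  · subst hu
    rw [add_comm, add_comm]
    refine Fr_anti _ hE (show _ ≤ (1 + α.degree) * E by nlinarith) (F_le_Fr hE _ ?_)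
    exact mul_mem_F (hm ▸ h α) (pow_le_F _ _ (mon_mem α))
  · exact zero_mem _

noncomputable def ev0 (a : Fin d → R) (E : ℕ) (hE : 0 < E) :
    MvPolynomial (Fin d) R →+* Ar (sp a) E hE :=
  (mkA (sp a) E hE).comp ((evT a E).codRestrict (Sr (sp a) E hE) (evT_mem hE))

theorem ev0_eq (hE : 0 < E) (φ : MvPolynomial (Fin d) R) :
    ev0 a E hE φ = mkA (sp a) E hE ⟨evT a E φ, evT_mem hE φ⟩ := rfl

theorem exists_rho [IsLocalRing R] (hE : 0 < E) (hm : F (sp a) 1 = maximalIdeal R) :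
    ∃ ρ : MvPolynomial (Fin d) (ResidueField R) →+* Ar (sp a) E hE,
      ∀ φ, ρ (MvPolynomial.map (residue R) φ) = ev0 a E hE φ := by
  have hs : Function.Surjective (MvPolynomial.map (σ := Fin d) (residue R)) :=
    MvPolynomial.map_surjective _ residue_surjective
  have hk : RingHom.ker (MvPolynomial.map (σ := Fin d) (residue R)) ≤ RingHom.ker (ev0 a E hE) := by
    intro φ hφ
    rw [RingHom.mem_ker] at hφ ⊢
    rw [ev0_eq, mkA_eq_zero]
    refine evT_mem_I hE hm φ fun α => ?_
    have := congrArg (MvPolynomial.coeff α) hφ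
    rw [MvPolynomial.coeff_map, MvPolynomial.coeff_zero] at this
    rwa [residue_eq_zero_iff] at this
  refine ⟨RingHom.liftOfSurjective _ hs ⟨ev0 a E hE, hk⟩, fun φ => ?_⟩
  exact RingHom.congr_fun (RingHom.liftOfSurjective_comp _ hs ⟨ev0 a E hE, hk⟩) φ

noncomputable def rho [IsLocalRing R] (hE : 0 < E) (hm : F (sp a) 1 = maximalIdeal R) :
    MvPolynomial (Fin d) (ResidueField R) →+* Ar (sp a) E hE := (exists_rho hE hm).choose

theorem rho_map [IsLocalRing R] (hE : 0 < E) (hm : F (sp a) 1 = maximalIdeal R) (φ) :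
    rho hE hm (MvPolynomial.map (residue R) φ) = mkA (sp a) E hE ⟨evT a E φ, evT_mem hE φ⟩ :=
  (exists_rho hE hm).choose_spec φ

theorem exists_lift_deg [IsLocalRing R] (g : MvPolynomial (Fin d) (ResidueField R)) :
    ∃ φ : MvPolynomial (Fin d) R, MvPolynomial.map (residue R) φ = g ∧ φ.totalDegree ≤ g.totalDegree := by
  classical
  choose l hl using residue_surjective (R := R)
  refine ⟨∑ α ∈ g.support, MvPolynomial.monomial α (l (g.coeff α)), ?_, ?_⟩
  · rw [map_sum]
    conv_rhs => rw [g.as_sum]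
    exact Finset.sum_congr rfl fun α _ => by rw [MvPolynomial.map_monomial, hl]
  · refine MvPolynomial.totalDegree_finsetSum_le fun α hα => ?_
    refine (MvPolynomial.totalDegree_monomial_le _ _).trans ?_
    exact MvPolynomial.le_totalDegree hα

theorem form_cancel [IsLocalRing R] (hE : 0 < E) (hQ : QR a) {N0 : ℕ} (hN0 : maximalIdeal R ^ N0 ≤ sp a)
    {n : ℕ} {Φ : MvPolynomial (Fin d) R} (hΦ : Φ.IsHomogeneous n) (hu : ∃ α, IsUnit (Φ.coeff α))
    {x : R} {i : ℕ} (h : MvPolynomial.eval a Φ * x ∈ Fr (sp a) (n * E + i) E) :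
    x ∈ Fr (sp a) i E := by
  rw [mem_Fr_iff hE] at h ⊢
  rw [mul_pow] at h
  have hs := (isSym_eval (a := a) hΦ).pow E
  refine mem_F_of_mul_mem hQ hs ?_ (by rwa [add_comm i])
  have h0 : ∀ τ, MvPolynomial.map (Ideal.Quotient.mk (sp a)) Φ * τ = 0 → τ = 0 := fun τ hτ =>
    nzd_of_unit_coeff (un_quot hN0) _ τ (by
      obtain ⟨α, hα⟩ := hu
      exact ⟨α, by rw [MvPolynomial.coeff_map]; exact hα.map _⟩) hτ
  clear h hs hE
  induction E with
  | zero => intro τ hτ; simpa using hτ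
  | succ E ih => 
    intro τ hτ
    rw [pow_succ, mul_assoc] at hτ
    exact h0 _ (ih _ hτ)

theorem rho_tf [IsLocalRing R] (hE : 0 < E) (hm : F (sp a) 1 = maximalIdeal R) (hQ : QR a)
    {N0 : ℕ} (hN0 : maximalIdeal R ^ N0 ≤ sp a) (g : MvPolynomial (Fin d) (ResidueField R))
    (z : Ar (sp a) E hE) (h : rho hE hm g * z = 0) : g = 0 ∨ z = 0 := by
  by_contra hcon
  push Not at hcon
  obtain ⟨hg, hz⟩ := hcon
  obtain ⟨φ, rfl, hφ⟩ := exists_lift_deg g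
  obtain ⟨p, rfl, i, hi, hpi⟩ := exists_lead hz
  rw [rho_map, ← map_mul, mkA_eq_zero] at h
  set n := (MvPolynomial.map (residue R) φ).totalDegree with hn
  have h1 := h (n * E + i)
  change (evT a E φ * p.1).coeff (n * E + i) ∈ _ at h1
  rw [Polynomial.coeff_mul_add_eq_of_natDegree_le ((evT_natDegree φ).trans (Nat.mul_le_mul_right E hφ)) hi,
    evT_coeff hE, add_assoc] at h1
  apply hpi
  refine form_cancel hE hQ hN0 (MvPolynomial.homogeneousComponent_isHomogeneous n φ) ?_ h1
  obtain ⟨α, hα, hd⟩ : ∃ α ∈ (MvPolynomial.map (residue R) φ).support, α.degree = n := by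
    have hne : (MvPolynomial.map (residue R) φ).support.Nonempty := by
      rwa [Finset.nonempty_iff_ne_empty, Ne, MvPolynomial.support_eq_empty]
    obtain ⟨α, hα, h⟩ := Finset.exists_mem_eq_sup _ hne (fun s : Fin d →₀ ℕ => s.sum fun _ e => e)
    refine ⟨α, hα, ?_⟩
    rw [hn, MvPolynomial.totalDegree, h, Finsupp.degree_eq_sum, Finsupp.sum_fintype _ _ (by simp)]
  refine ⟨α, ?_⟩
  rw [MvPolynomial.coeff_homogeneousComponent, if_pos hd]
  rw [MvPolynomial.mem_support_iff, MvPolynomial.coeff_map] at hα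
  exact (residue_ne_zero_iff_isUnit _).1 hα

end VQ2
end E1

namespace E1

section VQ3
universe u
variable {R : Type u} [CommRing R] {d : ℕ} {a : Fin d → R} {E : ℕ}

theorem integral_of_eqn {P A : Type*} [CommRing P] [CommRing A] (ρ : P →+* A) (y : A) (n : ℕ)
    (g : ℕ → P) (h : y ^ n + ∑ j ∈ Finset.Icc 1 n, ρ (g j) * y ^ (n - j) = 0) :
    ρ.IsIntegralElem y := by
  refine ⟨Polynomial.X ^ n + ∑ j ∈ Finset.Icc 1 n, Polynomial.C (g j) * Polynomial.X ^ (n - j), ?_, ?_⟩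
  · rcases Nat.eq_zero_or_pos n with rfl | hn
    · simp
    · apply Polynomial.monic_X_pow_add
      refine (Polynomial.degree_sum_le _ _).trans_lt ?_
      rw [Finset.sup_lt_iff (by exact WithBot.bot_lt_coe n)]
      intro j hj
      rw [Finset.mem_Icc] at hj
      refine (Polynomial.degree_C_mul_X_pow_le _ _).trans_lt ?_
      exact_mod_cast (by omega : n - j < n)
  · rw [Polynomial.eval₂_add, Polynomial.eval₂_finsetSum, Polynomial.eval₂_X_pow, ← h]
    congr 1
    refine Finset.sum_congr rfl fun j _ => ?_
    rw [Polynomial.eval₂_mul, Polynomial.eval₂_C, Polynomial.eval₂_X_pow]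

theorem integral_of_pow {P A : Type*} [CommRing P] [CommRing A] (ρ : P →+* A) (y : A) {n : ℕ}
    (hn : 0 < n) (h : ρ.IsIntegralElem (y ^ n)) : ρ.IsIntegralElem y := by
  letI := ρ.toAlgebra
  exact IsIntegral.of_pow (R := P) hn h

theorem integral_sum {P A ι : Type*} [CommRing P] [CommRing A] (ρ : P →+* A) (s : Finset ι)
    (f : ι → A) (h : ∀ i, ρ.IsIntegralElem (f i)) : ρ.IsIntegralElem (∑ i ∈ s, f i) := by
  letI := ρ.toAlgebra
  exact IsIntegral.sum (R := P) f fun i _ => h i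

theorem rho_int [IsLocalRing R] [IsNoetherianRing R] (hE : 0 < E) (hm : F (sp a) 1 = maximalIdeal R)
    (z : Ar (sp a) E hE) : (rho hE hm).IsIntegralElem z := by
  have hmono : ∀ (i : ℕ) (x : R) (hx : x ∈ Fr (sp a) i E),
      (rho hE hm).IsIntegralElem (mkA (sp a) E hE ⟨C x * X ^ i, mono_mem_Sr hE hx⟩) := by
    intro i x hx
    apply integral_of_pow _ _ hE
    have hx' := hx
    rw [mem_Fr_iff hE] at hx'
    obtain ⟨N, hN⟩ := mem_F.1 hx'
    obtain ⟨n, -, c, hc, hs⟩ := int_of_pow_mem hN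
    have hc' : ∀ j ∈ Finset.Icc 1 n, ∃ Φ : MvPolynomial (Fin d) R, Φ.IsHomogeneous (i * j) ∧
        MvPolynomial.eval a Φ = c j := fun j hj => by
      have := hc j hj
      rw [← pow_mul] at this
      exact (Ideal.mem_span_pow_iff_exists_isHomogeneous a _).1 this
    choose! Φ hΦ1 hΦ2 using hc'
    apply integral_of_eqn _ _ n (fun j => MvPolynomial.map (residue R) (Φ j))
    simp only [rho_map]
    rw [← map_pow, ← map_pow]
    simp only [← map_pow, ← map_mul]
    rw [← map_sum, ← map_add]
    convert map_zero (mkA (sp a) E hE) using 2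
    apply Subtype.ext
    have h2 : ∀ j ∈ Finset.Icc 1 n, evT a E (Φ j) * ((C x * X ^ i : R[X]) ^ E) ^ (n - j)
        = C (c j * (x ^ E) ^ (n - j)) * X ^ (i * E * n) := by
      intro j hj
      rw [evT_homog (hΦ1 j hj), hΦ2 j hj]
      rw [Finset.mem_Icc] at hj
      have : i * E * n = i * j * E + i * E * (n - j) := by
        obtain ⟨k, rfl⟩ := Nat.exists_eq_add_of_le hj.2
        rw [Nat.add_sub_cancel_left]; ring
      rw [this, pow_add, mul_pow, mul_pow, C_mul, C_pow, C_pow, ← pow_mul X, ← pow_mul X]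
      ring
    have h3 : ((C x * X ^ i : R[X]) ^ E) ^ n = C ((x ^ E) ^ n) * X ^ (i * E * n) := by
      rw [mul_pow, mul_pow, C_pow, C_pow, ← pow_mul X, ← pow_mul X]
    have h4 : ((C x * X ^ i : R[X]) ^ E) ^ n +
        ∑ j ∈ Finset.Icc 1 n, evT a E (Φ j) * ((C x * X ^ i : R[X]) ^ E) ^ (n - j) = 0 := by
      rw [Finset.sum_congr rfl h2, h3, ← Finset.sum_mul, ← add_mul, ← map_sum, ← C_add, hs]
      simp
    refine Eq.trans ?_ h4
    push_cast
    rfl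
  obtain ⟨p, rfl⟩ := mkA_surj _ _ hE z
  have hp : p = ∑ i ∈ p.1.support, ⟨C (p.1.coeff i) * X ^ i, mono_mem_Sr hE (p.2 i)⟩ := by
    apply Subtype.ext
    push_cast
    conv_lhs => rw [p.1.as_sum_support_C_mul_X_pow]
  rw [hp, map_sum]
  exact integral_sum _ _ _ fun i => hmono i _ (p.2 i)

theorem sum_card_Ex (hd : 0 < d) (n : ℕ) :
    ∑ m ∈ Finset.range (n + 1), (Ex d m).card = (n + d).choose d := by
  induction n with
  | zero => simp [card_Ex d 0 hd]
  | succ n ih =>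
    rw [Finset.sum_range_succ, ih, card_Ex _ _ hd]
    obtain ⟨d, rfl⟩ := Nat.exists_eq_succ_of_ne_zero hd.ne'
    rw [show n + 1 + (d + 1) = (n + d + 1) + 1 by ring, Nat.choose_succ_succ]
    rw [Nat.add_sub_cancel, Nat.succ_sub_one]
    rw [show n + d.succ = n + d + 1 by omega, add_comm]

theorem asymp_contra (hd : 0 < d) (e D : ℕ)
    (h : ∀ n, (e + 1) * (n + d).choose d ≤ e * (n + D + d).choose d) : False := by
  set K := D + d with hK
  set M := d * (e + 1) with hM
  have hM0 : 0 < M := by positivity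
  have hK0 : 0 < K := by omega
  obtain ⟨n, hn⟩ : ∃ n, n + 1 = M * K := ⟨M * K - 1, Nat.sub_add_cancel (Nat.mul_pos hM0 hK0)⟩
  have h1 := Nat.mul_le_mul_left d.factorial (h n)
  rw [Nat.mul_left_comm, Nat.mul_left_comm (d.factorial) e, ← Nat.ascFactorial_eq_factorial_mul_choose,
    ← Nat.ascFactorial_eq_factorial_mul_choose] at h1
  have h2 : (n + 1) ^ d ≤ (n + 1).ascFactorial d := by
    have := Nat.pow_succ_le_ascFactorial (n + 1) d
    exact this
  have h3 := Nat.ascFactorial_le_pow_add (n + D) d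
  have h4 : (e + 1) * (M * K) ^ d ≤ e * ((M + 1) * K) ^ d := by
    rw [← hn]
    calc _ ≤ _ := Nat.mul_le_mul_left _ h2
      _ ≤ _ := h1
      _ ≤ _ := Nat.mul_le_mul_left _ h3
      _ ≤ _ := by
        gcongr
        rw [add_mul, ← hn]; omega
  rw [mul_pow M, mul_pow (M + 1), ← mul_assoc, ← mul_assoc] at h4
  have h5 : (e + 1) * M ^ d ≤ e * (M + 1) ^ d := Nat.le_of_mul_le_mul_right h4 (pow_pos hK0 d)
  have h6 : ((e : ℝ) + 1) * (M : ℝ) ^ d ≤ e * ((M : ℝ) + 1) ^ d := by exact_mod_cast h5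
  have hMp : (0 : ℝ) < (M : ℝ) + 1 := by positivity
  have h7 := one_add_mul_le_pow (a := -(1 / ((M : ℝ) + 1))) (by
    have : 1 / ((M : ℝ) + 1) ≤ 1 := by rw [div_le_one hMp]; linarith [Nat.cast_nonneg (α := ℝ) M]
    linarith) d
  have h8 : (1 + -(1 / ((M : ℝ) + 1))) = M / (M + 1) := by field_simp; ring
  rw [h8, div_pow, le_div_iff₀ (pow_pos hMp d)] at h7
  have h9 : ((e : ℝ) + 1) * (1 + d * -(1 / ((M : ℝ) + 1))) ≤ e := by
    have hp := pow_pos hMp d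
    have : ((e : ℝ) + 1) * (1 + d * -(1 / ((M : ℝ) + 1))) * ((M : ℝ) + 1) ^ d ≤ e * ((M : ℝ) + 1) ^ d := by
      refine le_trans ?_ h6
      rw [mul_assoc]
      exact mul_le_mul_of_nonneg_left h7 (by positivity)
    exact le_of_mul_le_mul_right this hp
  have h10 : (M : ℝ) = d * (e + 1) := by rw [hM]; push_cast; ring
  have h11 : ((e : ℝ) + 1) * (d * (1 / ((M : ℝ) + 1))) < 1 := by
    rw [← mul_assoc, mul_one_div, div_lt_one hMp, h10]; linarith [mul_comm (e + 1 : ℝ) d]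
  linarith

theorem quot_sum_aux {ι : Type*} [Fintype ι] (N K : Ideal R) (c : ι → R) (x : ι → N)
    (h : ∑ i, c i • (Submodule.Quotient.mk (x i) : idealQuot N K) = 0) : ∑ i, c i * (x i).1 ∈ K := by
  have h1 : (Submodule.comap N.subtype K).mkQ (∑ i, c i • x i) = 0 := by
    rw [map_sum, ← h]
    rfl
  rw [Submodule.mkQ_apply, Submodule.Quotient.mk_eq_zero, Submodule.mem_comap] at h1
  simpa using h1

theorem rho_rank [IsLocalRing R] [IsNoetherianRing R] (hE : 0 < E) (hd : 0 < d)
    (hm : F (sp a) 1 = maximalIdeal R) (hQ : QR a) (e : ℕ) (he : len (sp a) = e)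
    (z : Fin (e + 1) → Ar (sp a) E hE) :
    ∃ g : Fin (e + 1) → MvPolynomial (Fin d) (ResidueField R), g ≠ 0 ∧
      ∑ i, rho hE hm (g i) * z i = 0 := by
  classical
  by_contra hcon
  push Not at hcon
  choose p hp using fun i => mkA_surj (sp a) E hE (z i)
  obtain ⟨D, hD⟩ : ∃ D, ∀ i, (p i).1.natDegree ≤ D :=
    ⟨Finset.univ.sup fun i => (p i).1.natDegree, fun i =>
      Finset.le_sup (f := fun i => (p i).1.natDegree) (Finset.mem_univ i)⟩
  apply asymp_contra hd e D
  intro n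
  let T : Finset (Fin d →₀ ℕ) := (Finset.range (n + 1)).biUnion (Ex d)
  have hT : T.card = (n + d).choose d := by
    rw [Finset.card_biUnion, sum_card_Ex hd]
    intro x _ y _ hxy
    rw [Function.onFun, Finset.disjoint_left]
    intro α h1 h2
    rw [mem_Ex] at h1 h2
    exact hxy (h1.symm.trans h2)
  have hTd : ∀ α ∈ T, α.degree ≤ n := by
    intro α hα
    obtain ⟨m, h1, h2⟩ := Finset.mem_biUnion.1 hα
    rw [mem_Ex] at h2
    have := Finset.mem_range.1 h1
    omega
  let ι := Fin (e + 1) × T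
  let M := n * E + D + 1
  let W := fun i => Fr (sp a) i E
  let q : ι → Sr (sp a) E hE := fun x => ⟨evT a E (MvPolynomial.monomial x.2.1 1), evT_mem hE _⟩ * p x.1
  let v : ι → ((i : Fin M) → idealQuot (W i) (W (i + 1))) := fun x i =>
    Submodule.Quotient.mk ⟨(q x).1.coeff i, (q x).2 i⟩
  let Ψ := Fintype.linearCombination R v
  have hker : ∀ c, Ψ c = 0 → ∀ x, c x ∈ maximalIdeal R := by
    intro c hc
    let φ : Fin (e + 1) → MvPolynomial (Fin d) R := fun j => ∑ α : T, MvPolynomial.monomial α.1 (c (j, α))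
    have hcoef : ∀ i, (∑ j, evT a E (φ j) * (p j).1).coeff i = ∑ x : ι, c x * (q x).1.coeff i := by
      intro i
      rw [Fintype.sum_prod_type, Polynomial.finsetSum_coeff]
      refine Finset.sum_congr rfl fun j _ => ?_
      rw [map_sum, Finset.sum_mul, Polynomial.finsetSum_coeff]
      refine Finset.sum_congr rfl fun α _ => ?_
      have : (q (j, α)).1 = evT a E (MvPolynomial.monomial α.1 1) * (p j).1 := rfl
      rw [this, evT_monomial, evT_monomial, ← Polynomial.coeff_C_mul, C_mul, one_mul]
      congr 1; ring
    have hz0 : ∑ j, rho hE hm (MvPolynomial.map (residue R) (φ j)) * z j = 0 := by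
      simp only [rho_map, ← hp, ← map_mul]
      rw [← map_sum, mkA_eq_zero]
      intro i
      have : (∑ j, (⟨evT a E (φ j), evT_mem hE _⟩ : Sr (sp a) E hE) * p j).1 =
        ∑ j, evT a E (φ j) * (p j).1 := by push_cast; rfl
      rw [this, hcoef]
      by_cases hi : i < M
      · have := congrFun hc ⟨i, hi⟩
        rw [Fintype.linearCombination_apply, Finset.sum_apply] at this
        exact quot_sum_aux (W i) (W (i + 1)) c (fun x => ⟨(q x).1.coeff i, (q x).2 i⟩) this
      · rw [Finset.sum_eq_zero]
        · exact zero_mem _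
        intro x _
        rw [Polynomial.coeff_eq_zero_of_natDegree_lt, mul_zero]
        have h1 : (q x).1 = evT a E (MvPolynomial.monomial x.2.1 1) * (p x.1).1 := rfl
        rw [h1, evT_monomial]
        have h2 := (Polynomial.natDegree_C_mul_X_pow_le (1 * mon a x.2.1) (x.2.1.degree * E))
        have h3 := hTd _ x.2.2
        have h4 := Nat.mul_le_mul_right E h3
        refine (Polynomial.natDegree_mul_le.trans (add_le_add h2 (hD x.1))).trans_lt ?_
        have h5 : M = n * E + D + 1 := rfl
        omega
    have hg : (fun j => MvPolynomial.map (residue R) (φ j)) = 0 := by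
      by_contra hne
      exact hcon _ hne hz0
    rintro ⟨j, α⟩
    have h1 := congrArg (MvPolynomial.coeff α.1) (congrFun hg j)
    rw [MvPolynomial.coeff_map, Pi.zero_apply, MvPolynomial.coeff_zero, residue_eq_zero_iff,
      MvPolynomial.coeff_sum] at h1
    simp only [MvPolynomial.coeff_monomial, Subtype.val_inj] at h1
    simpa using h1
  have hlen1 : (Fintype.card ι : ℕ∞) ≤ Module.length R ((i : Fin M) → idealQuot (W i) (W (i + 1))) := by
    let k := R ⧸ maximalIdeal R
    let θ : (ι → R) →ₗ[R] (ι → k) := LinearMap.pi fun x => (maximalIdeal R).mkQ ∘ₗ LinearMap.proj x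
    have hθ : Function.Surjective θ := by
      intro y
      choose l hl using fun x => Submodule.mkQ_surjective (maximalIdeal R) (y x)
      exact ⟨l, funext hl⟩
    have hle : LinearMap.ker Ψ ≤ LinearMap.ker θ := by
      intro c hc
      rw [LinearMap.mem_ker] at hc ⊢
      funext x
      exact (Submodule.Quotient.mk_eq_zero _).2 (hker c hc x)
    have h1 := Module.length_le_of_surjective ((LinearMap.ker Ψ).liftQ θ hle) (by
      intro y
      obtain ⟨c, rfl⟩ := hθ y
      exact ⟨Submodule.Quotient.mk c, rfl⟩)
    have h2 := Module.length_le_of_injective ((LinearMap.ker Ψ).liftQ Ψ le_rfl) (by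
      rw [← LinearMap.ker_eq_bot]; exact Submodule.ker_liftQ_eq_bot _ _ _ le_rfl)
    refine le_trans ?_ (h1.trans h2)
    rw [Module.length_pi_of_fintype]
    have hk : Module.length R k = 1 := len_maximal
    rw [Finset.sum_congr rfl fun _ _ => hk]
    simp
  have hlen2 : Module.length R ((i : Fin M) → idealQuot (W i) (W (i + 1))) = len (W M) := by
    rw [Module.length_pi_of_fintype, Fin.sum_univ_eq_sum_range (fun i => Module.length R (idealQuot (W i) (W (i + 1)))) M]
    induction M with
    | zero => 
      rw [Finset.sum_range_zero, eq_comm, len_eq_zero]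
      exact Ideal.eq_top_iff_one _ |>.2 (Fr_zero hE 1)
    | succ M ih =>
      rw [Finset.sum_range_succ, ih, ← mlen_idealQuot (W M) (W (M + 1)), add_comm,
        sup_eq_left.2 (Fr_anti _ hE (Nat.le_succ M))]
  have hlen3 : len (W M) ≤ len (sp a ^ (n + D + 1)) := len_anti
    ((pow_le_Fr hE _).trans (Fr_anti _ hE (show n * E + D + 1 ≤ (n + D + 1) * E by nlinarith)))
  rw [len_pow_eq hQ hd, he] at hlen3
  have := hlen1.trans (hlen2.le.trans hlen3)
  rw [Fintype.card_prod, Fintype.card_fin, Fintype.card_coe, hT] at this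
  rw [show n + D + 1 + d - 1 = n + D + d by omega] at this
  rw [mul_comm e]
  exact_mod_cast this

end VQ3
end E1

namespace E1

section VQ4
universe u
variable {R : Type u} [CommRing R] {d : ℕ} {a : Fin d → R} {E : ℕ}

theorem val_exists [IsNoetherianRing R] {J : Ideal R} {b : R} (hb : b ∈ J)
    (hbn : b ∈ nonZeroDivisors R) (x : R) (c : ℝ)
    (hc : ∀ N j : ℕ, 0 < N → x ^ N ∈ F J j → (j : ℝ) ≤ c * N) :
    ∃ v : ℝ, 0 ≤ v ∧ ∀ N j : ℕ, 0 < N → (x ^ N ∈ F J j ↔ (j : ℝ) ≤ N * v) := by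
  let S : Set ℝ := {r | ∃ N j : ℕ, 0 < N ∧ x ^ N ∈ F J j ∧ r = j / N}
  have hbdd : BddAbove S := by
    refine ⟨c, ?_⟩
    rintro r ⟨N, j, hN, hx, rfl⟩
    have hN' : (0 : ℝ) < N := by exact_mod_cast hN
    rw [div_le_iff₀ hN']
    exact hc N j hN hx
  have h0 : (0 : ℝ) ∈ S := ⟨1, 0, one_pos, by rw [F_zero]; trivial, by simp⟩
  refine ⟨sSup S, le_csSup hbdd h0, fun N j hN => ⟨fun h => ?_, fun h => ?_⟩⟩
  · have hN' : (0 : ℝ) < N := by exact_mod_cast hN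
    rw [mul_comm, ← div_le_iff₀ hN']
    exact le_csSup hbdd ⟨N, j, hN, h, rfl⟩
  · refine F_of_asymp hb hbn fun q => ?_
    rcases Nat.eq_zero_or_pos (j * q) with h0 | hpos
    · rw [h0, F_zero]; trivial
    have hq : 0 < q := Nat.pos_of_mul_pos_left hpos
    have hq' : (0 : ℝ) < q := by exact_mod_cast hq
    have hN' : (0 : ℝ) < N := by exact_mod_cast hN
    have h1 : (((j * q - 1 : ℕ) : ℝ)) / (N * q) < sSup S := by
      rw [Nat.cast_sub hpos, div_lt_iff₀ (by positivity)]
      push_cast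
      nlinarith
    obtain ⟨r, ⟨N', j', hN1, hx, rfl⟩, hr⟩ := exists_lt_of_lt_csSup ⟨0, h0⟩ h1
    have hN1' : (0 : ℝ) < N' := by exact_mod_cast hN1
    rw [div_lt_div_iff₀ (by positivity) hN1'] at hr
    have hr' : (j * q - 1) * N' < j' * (N * q) := by exact_mod_cast hr
    rw [← pow_mul]
    refine F_of_pow_mem hN1 ?_
    have := pow_mem_F hx (N * q)
    rw [← pow_mul, mul_comm N', pow_mul] at this
    exact F_anti _ hr'.le this

theorem distinct_floor (e : ℕ) (v : ℝ) (hv : 0 ≤ v) (hIntg : ∀ n : ℤ, (e.factorial : ℝ) * v ≠ n) :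
    ∃ q : ℕ, 0 < q ∧ ∀ j j' : Fin (e + 1), j ≠ j' →
      ⌊((j : ℕ) * q : ℝ) * v⌋₊ % q ≠ ⌊((j' : ℕ) * q : ℝ) * v⌋₊ % q := by
  let f : ℕ → ℝ := fun j => j * v - ⌊(j : ℝ) * v⌋₊
  have hf0 : ∀ j, 0 ≤ f j := fun j => sub_nonneg.2 (Nat.floor_le (by positivity))
  have hf1 : ∀ j, f j < 1 := fun j => by have := Nat.lt_floor_add_one ((j : ℝ) * v); simp only [f]; linarith
  have hlt : ∀ j j' : ℕ, j < j' → j' ≤ e → f j ≠ f j' := by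
    intro j j' hjj hj' heq
    have hdvd : j' - j ∣ e.factorial := Nat.dvd_factorial (by omega) (by omega)
    obtain ⟨k, hk⟩ := hdvd
    apply hIntg (k * (⌊(j' : ℝ) * v⌋₊ - ⌊(j : ℝ) * v⌋₊))
    rw [hk]
    simp only [f] at heq
    push_cast [Nat.cast_sub hjj.le]
    linear_combination (-(k : ℝ)) * heq
  have hne : ∀ j j' : Fin (e + 1), j ≠ j' → f j ≠ f j' := by
    intro j j' h
    rcases lt_or_gt_of_ne (fun hh => h (Fin.ext hh) : (j : ℕ) ≠ j') with h1 | h1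
    · exact hlt _ _ h1 (by omega)
    · exact (hlt _ _ h1 (by omega)).symm
  have hev : ∀ᶠ q : ℕ in Filter.atTop, ∀ jj : Fin (e + 1) × Fin (e + 1), jj.1 ≠ jj.2 →
      1 ≤ q * |f jj.1 - f jj.2| := by
    rw [Filter.eventually_all]
    intro jj
    by_cases h : jj.1 = jj.2
    · exact Filter.Eventually.of_forall fun _ h' => (h' h).elim
    · have hpos : 0 < |f jj.1 - f jj.2| := abs_pos.2 (sub_ne_zero.2 (hne _ _ h))
      obtain ⟨q0, hq0⟩ := exists_nat_ge (1 / |f jj.1 - f jj.2|)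
      rw [Filter.eventually_atTop]
      refine ⟨q0, fun q hq _ => ?_⟩
      rw [div_le_iff₀ hpos] at hq0
      refine hq0.trans ?_
      gcongr
  obtain ⟨q, hq, hq0⟩ := (hev.and (Filter.eventually_gt_atTop 0)).exists
  have hq' : (0 : ℝ) < q := by exact_mod_cast hq0
  have hmod : ∀ j : ℕ, ⌊((j : ℕ) * q : ℝ) * v⌋₊ % q = ⌊q * f j⌋₊ := by
    intro j
    have h1 : ((j : ℕ) * q : ℝ) * v = q * f j + ((q * ⌊(j : ℝ) * v⌋₊ : ℕ) : ℝ) := by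
      simp only [f]; push_cast; ring
    rw [h1, Nat.floor_add_natCast (mul_nonneg hq'.le (hf0 j)), Nat.add_mul_mod_self_left, Nat.mod_eq_of_lt]
    rw [Nat.floor_lt (mul_nonneg hq'.le (hf0 j))]
    nlinarith [hf1 j]
  refine ⟨q, hq0, fun j j' h heq => ?_⟩
  rw [hmod, hmod] at heq
  have h1 := hq (j, j') h
  have h2 := Nat.floor_le (mul_nonneg hq'.le (hf0 j))
  have h3 := Nat.floor_le (mul_nonneg hq'.le (hf0 j'))
  have h4 := Nat.lt_floor_add_one (q * f j)
  have h5 := Nat.lt_floor_add_one (q * f j')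
  rw [heq] at h2 h4
  rw [← abs_of_pos hq', ← abs_mul, mul_sub] at h1
  simp only at h1
  have : |(q : ℝ) * f j - q * f j'| < 1 := abs_lt.2 ⟨by linarith, by linarith⟩
  linarith

theorem indep_of_distinct [IsLocalRing R] (hE : 0 < E) (hm : F (sp a) 1 = maximalIdeal R) (hQ : QR a)
    {N0 : ℕ} (hN0 : maximalIdeal R ^ N0 ≤ sp a) {ι : Type*} [Fintype ι]
    (x : ι → R) (i : ι → ℕ) (hx : ∀ j, x j ∈ Fr (sp a) (i j) E) (hx' : ∀ j, x j ∉ Fr (sp a) (i j + 1) E)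
    (hi : ∀ j j', j ≠ j' → i j % E ≠ i j' % E) (g : ι → MvPolynomial (Fin d) (ResidueField R))
    (h : ∑ j, rho hE hm (g j) * mkA (sp a) E hE ⟨C (x j) * X ^ (i j), mono_mem_Sr hE (hx j)⟩ = 0) :
    g = 0 := by
  classical
  choose φ hφ using fun j => MvPolynomial.map_surjective (σ := Fin d) (residue R) residue_surjective (g j)
  simp only [← hφ, rho_map, ← map_mul] at h
  rw [← map_sum, mkA_eq_zero] at h
  have e1 : (∑ j, (⟨evT a E (φ j), evT_mem hE _⟩ : Sr (sp a) E hE) *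
      ⟨C (x j) * X ^ (i j), mono_mem_Sr hE (hx j)⟩).1 =
        ∑ j, evT a E (φ j) * (C (x j) * X ^ (i j)) := by push_cast; rfl
  have hvan : ∀ j u, u % E ≠ i j % E → (evT a E (φ j) * (C (x j) * X ^ (i j))).coeff u = 0 := by
    intro j u hu
    rw [← mul_assoc, Polynomial.coeff_mul_X_pow']
    split_ifs with hle
    · rw [Polynomial.coeff_mul_C, evT_coeff_dvd, zero_mul]
      intro hdv
      apply hu
      exact ((Nat.modEq_iff_dvd' hle).2 hdv).symm
    · rfl
  funext j
  have hz : rho hE hm (g j) * mkA (sp a) E hE ⟨C (x j) * X ^ (i j), mono_mem_Sr hE (hx j)⟩ = 0 := by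
    rw [← hφ, rho_map, ← map_mul, mkA_eq_zero]
    intro u
    show (evT a E (φ j) * (C (x j) * X ^ (i j))).coeff u ∈ _
    by_cases hu : u % E = i j % E
    · have := h u
      rw [e1, Polynomial.finsetSum_coeff, Finset.sum_eq_single j] at this
      · exact this
      · intro j' _ hne
        exact hvan j' u (by rw [hu]; exact hi _ _ hne.symm)
      · simp
    · rw [hvan j u hu]; exact zero_mem _
  refine (rho_tf hE hm hQ hN0 _ _ hz).resolve_right ?_
  rw [mkA_eq_zero]
  intro h
  apply hx' j
  have := h (i j)
  rw [Polynomial.coeff_C_mul_X_pow, if_pos rfl] at this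
  exact this

theorem val_round [IsLocalRing R] [IsNoetherianRing R] (hd : 0 < d)
    (hm : F (sp a) 1 = maximalIdeal R) (hQ : QR a) {N0 : ℕ} (hN0 : maximalIdeal R ^ N0 ≤ sp a)
    (e : ℕ) (he : len (sp a) = e) {b : R} (hb : b ∈ sp a) (hbn : b ∈ nonZeroDivisors R)
    (x : R) (i n : ℕ) (hn : 0 < n) (h : x ^ (e.factorial * n) ∈ F (sp a) (i * n + 1)) :
    x ^ e.factorial ∈ F (sp a) (i + 1) := by
  by_contra hcon
  set E := e.factorial with hEdef
  have hE : 0 < E := Nat.factorial_pos e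
  have hE' : (0 : ℝ) < E := by exact_mod_cast hE
  obtain ⟨v, hv0, hv⟩ := val_exists hb hbn x ((i + 1) / E) (by
    intro N j hN hx
    by_contra hlt
    push Not at hlt
    apply hcon
    have h1 := pow_mem_F hx E
    rw [← pow_mul, mul_comm N E, pow_mul] at h1
    refine F_of_pow_mem hN (F_anti _ ?_ h1)
    rw [div_mul_eq_mul_div, div_lt_iff₀ hE'] at hlt
    exact_mod_cast hlt.le)
  have hlt : (E : ℝ) * v < i + 1 := by
    by_contra hge
    push Not at hge
    apply hcon
    rw [hv _ _ hE]
    exact_mod_cast hge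
  have hgt : (i : ℝ) < E * v := by
    rw [hv _ _ (Nat.mul_pos hE hn)] at h
    push_cast at h
    have hn' : (0 : ℝ) < n := by exact_mod_cast hn
    by_contra hle
    push Not at hle
    nlinarith
  obtain ⟨q, hq, hdist⟩ := distinct_floor e v hv0 (by
    intro k hk
    rw [← hEdef] at hk
    rw [hk] at hlt hgt
    have h1 : (i : ℤ) < k := by exact_mod_cast hgt
    have h2 : k < (i : ℤ) + 1 := by exact_mod_cast hlt
    omega)
  have h1 : (1 : R) ∉ F (sp a) 1 := by
    rw [hm]; exact (Ideal.ne_top_iff_one _).1 Ideal.IsPrime.ne_top'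
  have hx1 : ∀ j : Fin (e + 1), x ^ (j : ℕ) ∈ Fr (sp a) ⌊((j : ℕ) * q : ℝ) * v⌋₊ q := by
    intro j
    rw [mem_Fr_iff hq, ← pow_mul]
    rcases Nat.eq_zero_or_pos (j : ℕ) with h0 | hpos
    · rw [h0]; simp [F_zero]
    · rw [hv _ _ (Nat.mul_pos hpos hq)]
      push_cast
      exact Nat.floor_le (by positivity)
  have hx2 : ∀ j : Fin (e + 1), x ^ (j : ℕ) ∉ Fr (sp a) (⌊((j : ℕ) * q : ℝ) * v⌋₊ + 1) q := by
    intro j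
    rw [mem_Fr_iff hq, ← pow_mul]
    rcases Nat.eq_zero_or_pos (j : ℕ) with h0 | hpos
    · rw [h0]; simpa using h1
    · rw [hv _ _ (Nat.mul_pos hpos hq)]
      push_cast
      exact not_le.2 (Nat.lt_floor_add_one _)
  obtain ⟨g, hg, hs⟩ := rho_rank hq hd hm hQ e he
    (fun j => mkA (sp a) q hq ⟨C (x ^ (j : ℕ)) * X ^ _, mono_mem_Sr hq (hx1 j)⟩)
  exact hg (indep_of_distinct hq hm hQ hN0 _ _ hx1 hx2 hdist g hs)

theorem Ar_reduced [IsLocalRing R] [IsNoetherianRing R] (hd : 0 < d)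
    (hm : F (sp a) 1 = maximalIdeal R) (hQ : QR a) {N0 : ℕ} (hN0 : maximalIdeal R ^ N0 ≤ sp a)
    (e : ℕ) (he : len (sp a) = e) {b : R} (hb : b ∈ sp a) (hbn : b ∈ nonZeroDivisors R) :
    IsReduced (Ar (sp a) e.factorial (Nat.factorial_pos e)) := by
  constructor
  rintro z ⟨n, hz⟩
  have hE := Nat.factorial_pos e
  by_contra hne
  obtain ⟨p, rfl, i, hi, hpi⟩ := exists_lead hne
  have hz' : mkA (sp a) e.factorial hE p ^ (n + 1) = 0 := by rw [pow_succ, hz, zero_mul]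
  rw [← map_pow, mkA_eq_zero] at hz'
  have h1 := hz' ((n + 1) * i)
  have h2 : ((p ^ (n + 1) : Sr (sp a) e.factorial hE) : R[X]) = p.1 ^ (n + 1) := rfl
  rw [h2, Polynomial.coeff_pow_of_natDegree_le hi, mem_Fr_iff hE, ← pow_mul] at h1
  apply hpi
  rw [mem_Fr_iff hE]
  refine val_round hd hm hQ hN0 e he hb hbn _ i (n + 1) n.succ_pos ?_
  rwa [mul_comm i, mul_comm e.factorial]

theorem bdd_main [IsLocalRing R] [IsNoetherianRing R] (hd : 0 < d)
    (hm : F (sp a) 1 = maximalIdeal R) (hQ : QR a) {N0 : ℕ} (hN0 : maximalIdeal R ^ N0 ≤ sp a)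
    (hred : IsReduced (AdicCompletion (maximalIdeal R) R))
    {b : R} (hb : b ∈ sp a) (hbn : b ∈ nonZeroDivisors R) : Bdd (sp a) := by
  classical
  obtain ⟨e, he⟩ : ∃ e : ℕ, len (sp a) = e := by
    obtain ⟨e, he⟩ := ENat.ne_top_iff_exists.1 (len_ne_top hN0)
    exact ⟨e, he.symm⟩
  have hE := Nat.factorial_pos e
  set E := e.factorial with hEdef
  haveI : IsReduced (Ar (sp a) E hE) := Ar_reduced hd hm hQ hN0 e he hb hbn
  obtain ⟨s, hs⟩ := claimN (rho hE hm) (rho_tf hE hm hQ hN0) (rho_int hE hm) e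
    (rho_rank hE hd hm hQ e he)
  choose p hp using mkA_surj (sp a) E hE
  obtain ⟨B, hB⟩ : ∃ B, ∀ z ∈ s, (p z).1.natDegree ≤ B :=
    ⟨s.sup fun z => (p z).1.natDegree, fun z hz => Finset.le_sup (f := fun z => (p z).1.natDegree) hz⟩
  have hstep : ∀ n i, n * E + B ≤ i → Fr (sp a) i E ≤ sp a ^ n ⊔ Fr (sp a) (i + 1) E := by
    intro n i hi x hx
    obtain ⟨g, hg⟩ := hs (mkA (sp a) E hE ⟨C x * X ^ i, mono_mem_Sr hE hx⟩)
    choose φ hφ using fun z => MvPolynomial.map_surjective (σ := Fin d) (residue R) residue_surjective (g z)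
    have h1 : mkA (sp a) E hE (⟨C x * X ^ i, mono_mem_Sr hE hx⟩ -
        ∑ z ∈ s, ⟨evT a E (φ z), evT_mem hE _⟩ * p z) = 0 := by
      rw [map_sub, map_sum, hg, sub_eq_zero]
      refine Finset.sum_congr rfl fun z _ => ?_
      rw [map_mul, hp, ← rho_map hE hm, hφ]
    rw [mkA_eq_zero] at h1
    have h2 := h1 i
    have e1 : ((⟨C x * X ^ i, mono_mem_Sr hE hx⟩ -
        ∑ z ∈ s, ⟨evT a E (φ z), evT_mem hE _⟩ * p z : Sr (sp a) E hE) : R[X]) =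
        C x * X ^ i - ∑ z ∈ s, evT a E (φ z) * (p z).1 := by push_cast; rfl
    rw [e1, Polynomial.coeff_sub, Polynomial.coeff_C_mul_X_pow, if_pos rfl, Polynomial.finsetSum_coeff] at h2
    have h3 : ∑ z ∈ s, (evT a E (φ z) * (p z).1).coeff i ∈ sp a ^ n := by
      refine Ideal.sum_mem _ fun z hz => ?_
      rw [Polynomial.coeff_mul]
      refine Ideal.sum_mem _ fun uv huv => ?_
      rw [Finset.HasAntidiagonal.mem_antidiagonal] at huv
      by_cases hv : uv.2 ≤ B
      · exact Ideal.mul_mem_right _ _ (evT_coeff_mem hE _ (by omega))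
      · rw [Polynomial.coeff_eq_zero_of_natDegree_lt (p := (p z).1) (by have := hB z hz; omega), mul_zero]
        exact zero_mem _
    have := add_mem (Ideal.mem_sup_left h3) (Ideal.mem_sup_right (S := sp a ^ n) h2)
    simpa using this
  have hiter : ∀ n i l, n * E + B ≤ i → Fr (sp a) i E ≤ sp a ^ n ⊔ Fr (sp a) (i + l) E := by
    intro n i l hi
    induction l with
    | zero => exact le_sup_right
    | succ l ih =>
      refine ih.trans (sup_le le_sup_left ?_)
      exact hstep n (i + l) (by omega)
  have hJm : sp a ≤ maximalIdeal R := by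
    rw [← hm]; have := pow_le_F (sp a) 1; rwa [pow_one] at this
  refine ⟨B, fun n => ?_⟩
  obtain ⟨β, hβ⟩ := chev hred hJm hN0 n
  have h1 : F (sp a) (n + B) ≤ Fr (sp a) ((n + B) * E) E := F_le_Fr hE _
  have hle : n * E + B ≤ (n + B) * E := by nlinarith
  refine h1.trans ((hiter n _ (β * E) hle).trans (sup_le le_rfl ?_))
  exact (Fr_anti _ hE (Nat.le_add_left _ _)).trans ((Fr_le_F hE β).trans hβ)

end VQ4
end E1

namespace E1
section PT
universe u
variable {R : Type u} [CommRing R]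

/-- `x` is a nonzerodivisor modulo `K`. -/
def Nz (K : Ideal R) (x : R) : Prop := ∀ r, r * x ∈ K → r ∈ K

theorem mem_sup_sp {I : Ideal R} {x y : R} :
    y ∈ I ⊔ Ideal.span {x} ↔ ∃ i ∈ I, ∃ c, y = i + x * c := by
  rw [Submodule.mem_sup]
  constructor
  · rintro ⟨i, hi, z, hz, rfl⟩
    obtain ⟨c, rfl⟩ := Ideal.mem_span_singleton'.1 hz
    exact ⟨i, hi, c, by ring⟩
  · rintro ⟨i, hi, c, rfl⟩
    exact ⟨i, hi, x * c, Ideal.mem_span_singleton.2 ⟨c, rfl⟩, rfl⟩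

theorem Nz.swap {I : Ideal R} {x y : R} (hx : Nz I x) (hy : Nz (I ⊔ Ideal.span {x}) y) :
    Nz (I ⊔ Ideal.span {y}) x := by
  intro r hr
  obtain ⟨i, hi, s, hs⟩ := mem_sup_sp.1 hr
  have h1 : s * y ∈ I ⊔ Ideal.span {x} :=
    mem_sup_sp.2 ⟨-i, neg_mem hi, r, by linear_combination -hs⟩
  obtain ⟨j, hj, c, hc⟩ := mem_sup_sp.1 (hy _ h1)
  have h2 : (r - y * c) * x ∈ I := by
    have : (r - y * c) * x = i + y * j := by rw [hc] at hs; linear_combination hs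
    rw [this]; exact add_mem hi (I.mul_mem_left _ hj)
  exact mem_sup_sp.2 ⟨_, hx _ h2, c, by ring⟩

variable [IsLocalRing R]

/-- no socle -/
def NS (K : Ideal R) : Prop := ∀ u, (∀ r ∈ maximalIdeal R, r * u ∈ K) → u ∈ K

theorem Nz.ns {K : Ideal R} {x : R} (hx : x ∈ maximalIdeal R) (h : Nz K x) : NS K :=
  fun u hu => h u (by rw [mul_comm]; exact hu x hx)

theorem NS.exch {I : Ideal R} {a x : R} (hxm : x ∈ maximalIdeal R) (ha : Nz I a) (hx : Nz I x)
    (h : NS (I ⊔ Ideal.span {x})) : NS (I ⊔ Ideal.span {a}) := by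
  intro u hu
  obtain ⟨i, hi, v, hv⟩ := mem_sup_sp.1 (hu x hxm)
  have hvs : v ∈ I ⊔ Ideal.span {x} := by
    apply h
    intro r hr
    obtain ⟨i', hi', w, hw⟩ := mem_sup_sp.1 (hu r hr)
    have : (r * v - x * w) * a ∈ I := by
      have e : (r * v - x * w) * a = x * i' - r * i := by linear_combination x * hw - r * hv
      rw [e]; exact sub_mem (I.mul_mem_left _ hi') (I.mul_mem_left _ hi)
    exact mem_sup_sp.2 ⟨_, ha _ this, w, by ring⟩
  obtain ⟨j, hj, c, hc⟩ := mem_sup_sp.1 hvs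
  have h2 : (u - a * c) * x ∈ I := by
    have e : (u - a * c) * x = i + a * j := by rw [hc] at hv; linear_combination hv
    rw [e]; exact add_mem hi (I.mul_mem_left _ hj)
  exact mem_sup_sp.2 ⟨_, hx _ h2, c, by ring⟩

theorem NS.hom {K : Ideal R} (h : NS K) (f : (R ⧸ maximalIdeal R) →ₗ[R] (R ⧸ K)) : f = 0 := by
  obtain ⟨u, hu⟩ := Ideal.Quotient.mk_surjective (f 1)
  have key : f 1 = 0 := by
    rw [← hu, Ideal.Quotient.eq_zero_iff_mem]
    apply h
    intro r hr
    rw [← Ideal.Quotient.eq_zero_iff_mem, map_mul, hu]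
    change r • f 1 = 0
    rw [← map_smul]
    have : r • (1 : R ⧸ maximalIdeal R) = 0 := by
      change Ideal.Quotient.mk _ (r * 1) = 0
      rw [Ideal.Quotient.eq_zero_iff_mem, mul_one]; exact hr
    rw [this, map_zero]
  ext
  simpa using key

theorem Nz_of_reg {K : Ideal R} {y : R} (h : IsSMulRegular (R ⧸ K) y) : Nz K y := by
  intro r hr
  rw [← Ideal.Quotient.eq_zero_iff_mem]
  apply h
  change Ideal.Quotient.mk K (y * r) = y • 0
  rw [smul_zero]
  rw [Ideal.Quotient.eq_zero_iff_mem, mul_comm]; exact hr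

theorem exists_nz3 [IsNoetherianRing R] {K1 K2 K3 : Ideal R} (h1 : NS K1) (h2 : NS K2)
    (h3 : NS K3) : ∃ y ∈ maximalIdeal R, Nz K1 y ∧ Nz K2 y ∧ Nz K3 y := by
  have hs : Subsingleton ((R ⧸ maximalIdeal R) →ₗ[R] ((R ⧸ K1) × (R ⧸ K2) × (R ⧸ K3))) := by
    apply subsingleton_of_forall_eq 0
    intro f
    have e1 := h1.hom ((LinearMap.fst R _ _).comp f)
    have e2 := h2.hom ((LinearMap.fst R _ _).comp ((LinearMap.snd R _ _).comp f))
    have e3 := h3.hom ((LinearMap.snd R _ _).comp ((LinearMap.snd R _ _).comp f))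
    apply LinearMap.ext
    intro z
    refine Prod.ext (LinearMap.congr_fun e1 z) (Prod.ext (LinearMap.congr_fun e2 z)
      (LinearMap.congr_fun e3 z))
  obtain ⟨y, hy, hr⟩ := IsSMulRegular.subsingleton_linearMap_iff.1 hs
  rw [Ideal.annihilator_quotient] at hy
  refine ⟨y, hy, Nz_of_reg ?_, Nz_of_reg ?_, Nz_of_reg ?_⟩
  · intro p q hpq
    exact (Prod.ext_iff.1 (@hr (p, 0, 0) (q, 0, 0) (by
      simp only [Prod.smul_mk, smul_zero]; exact Prod.ext hpq rfl))).1
  · intro p q hpq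
    have := (@hr (0, p, 0) (0, q, 0) (by
      simp only [Prod.smul_mk, smul_zero]; exact Prod.ext rfl (Prod.ext hpq rfl)))
    exact (Prod.ext_iff.1 (Prod.ext_iff.1 this).2).1
  · intro p q hpq
    have := (@hr (0, 0, p) (0, 0, q) (by
      simp only [Prod.smul_mk, smul_zero]; exact Prod.ext rfl (Prod.ext rfl hpq)))
    exact (Prod.ext_iff.1 (Prod.ext_iff.1 this).2).2

/-- depth of `R/I` is at least `n`. -/
def DG : ℕ → Ideal R → Prop
  | 0, I => I ≠ ⊤
  | n + 1, I => ∃ x ∈ maximalIdeal R, Nz I x ∧ DG n (I ⊔ Ideal.span {x})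

theorem DG.ne_top : ∀ {n : ℕ} {I : Ideal R}, DG n I → I ≠ ⊤
  | 0, _, h => h
  | n + 1, I, ⟨x, _, _, h⟩ => fun hI => h.ne_top (by rw [hI, top_sup_eq])

theorem DG.ns {n : ℕ} {I : Ideal R} : DG (n + 1) I → NS I
  | ⟨_, hx, h, _⟩ => h.ns hx

theorem DG.G [IsNoetherianRing R] : ∀ (n : ℕ) {I : Ideal R} {a : R}, DG (n + 1) I →
    a ∈ maximalIdeal R → Nz I a → DG n (I ⊔ Ideal.span {a})
  | 0, I, a, h, ham, ha => by
    have hI := h.ne_top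
    intro ht
    have : I ⊔ Ideal.span {a} ≤ maximalIdeal R :=
      sup_le (le_maximalIdeal hI) ((Ideal.span_singleton_le_iff_mem _).2 ham)
    rw [ht] at this
    exact (maximalIdeal.isMaximal R).ne_top (top_le_iff.1 this)
  | n + 1, I, a, h, ham, ha => by
    obtain ⟨x, hxm, hx, hD⟩ := h
    obtain ⟨y, hym, hy1, hy2, hy3⟩ := exists_nz3 (hx.ns hxm) hD.ns (NS.exch hxm ha hx hD.ns)
    have s1 := DG.G n hD hym hy2
    have s2 : DG (n + 1) (I ⊔ Ideal.span {y}) :=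
      ⟨x, hxm, hx.swap hy2, by rwa [sup_right_comm] at s1⟩
    have s3 := DG.G n s2 ham (ha.swap hy3)
    exact ⟨y, hym, hy3, by rwa [sup_right_comm] at s3⟩

theorem DG.coheight [IsNoetherianRing R] : ∀ (n : ℕ) {I : Ideal R} (p : PrimeSpectrum R) (u : R),
    DG n I → (∀ r, r ∈ p.asIdeal ↔ r * u ∈ I) → (n : ℕ∞) ≤ Order.coheight p
  | 0, _, _, _, _, _ => by simp
  | n + 1, I, p, u, ⟨x, hxm, hx, hD⟩, hp => by
    have huI : u ∉ I := fun h => p.2.ne_top ((Ideal.eq_top_iff_one _).2 ((hp 1).2 (by simpa)))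
    have hxp : x ∉ p.asIdeal := fun h => huI (hx u (by rw [mul_comm]; exact (hp x).1 h))
    let K : Ideal R :=
      { carrier := {v | ∀ r ∈ p.asIdeal, r * v ∈ I}
        zero_mem' := fun r _ => by simp
        add_mem' := fun {v w} hv hw r hr => by rw [mul_add]; exact add_mem (hv r hr) (hw r hr)
        smul_mem' := fun c v hv r hr => by
          rw [smul_eq_mul, mul_left_comm]; exact I.mul_mem_left _ (hv r hr) }
    have huK : u ∈ K := fun r hr => (hp r).1 hr
    have hnot : ¬ K ≤ I ⊔ Ideal.span {x} := by
      intro hle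
      have h1 : K ≤ I ⊔ maximalIdeal R • K := by
        intro v hv
        obtain ⟨i, hi, c, rfl⟩ := mem_sup_sp.1 (hle hv)
        refine Submodule.add_mem_sup hi (Submodule.smul_mem_smul hxm ?_)
        intro r hr
        apply hx
        have := hv r hr
        have e : r * c * x = r * (i + x * c) - r * i := by ring
        rw [e]; exact sub_mem this (I.mul_mem_left _ hi)
      have h2 := Submodule.le_of_le_smul_of_le_jacobson_bot
        (IsNoetherian.noetherian K) (maximalIdeal_le_jacobson _) h1
      exact huI (h2 huK)
    obtain ⟨v, hvK, hv⟩ := Set.not_subset.1 hnot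
    have hv0 : (Ideal.Quotient.mk (I ⊔ Ideal.span {x}) v) ≠ 0 := by
      rwa [Ne, Ideal.Quotient.eq_zero_iff_mem]
    obtain ⟨P, hP, hle⟩ := exists_le_isAssociatedPrime_of_isNoetherianRing R
      (Ideal.Quotient.mk (I ⊔ Ideal.span {x}) v) hv0
    obtain ⟨hPp, w, hw⟩ := isAssociatedPrime_iff.1 hP
    obtain ⟨w, rfl⟩ := Ideal.Quotient.mk_surjective w
    have hmem : ∀ (z r : R), r ∈ (⊥ : Submodule R (R ⧸ (I ⊔ Ideal.span {x}))).colon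
        {Ideal.Quotient.mk (I ⊔ Ideal.span {x}) z} ↔ r * z ∈ I ⊔ Ideal.span {x} := by
      intro z r
      rw [Submodule.mem_colon_singleton, Submodule.mem_bot, ← Ideal.Quotient.eq_zero_iff_mem]
      rfl
    have hIH := DG.coheight n (⟨P, hPp⟩ : PrimeSpectrum R) w hD (fun r => by
      change r ∈ P ↔ _
      rw [hw, hmem])
    have hlt : p < (⟨P, hPp⟩ : PrimeSpectrum R) := by
      refine lt_of_le_of_ne ?_ ?_
      · intro r hr
        exact hle ((hmem _ _).2 (Ideal.mem_sup_left (hvK r hr)))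
      · intro he
        apply hxp
        rw [he]
        apply hle
        rw [hmem]
        exact Ideal.mem_sup_right (Ideal.mem_span_singleton.2 ⟨v, rfl⟩)
    have := Order.coheight_add_one_le hlt
    push_cast
    exact le_trans (add_le_add_left hIH 1) this

theorem coheight_le_of [IsNoetherianRing R] (p : PrimeSpectrum R) (s : Finset R)
    (hs : (s : Set R) ⊆ maximalIdeal R)
    (h : ∃ N, maximalIdeal R ^ N ≤ p.asIdeal ⊔ Ideal.span (s : Set R)) :
    Order.coheight p ≤ s.card := by
  classical
  let A := R ⧸ p.asIdeal
  have hsur : Function.Surjective (Ideal.Quotient.mk p.asIdeal) := Ideal.Quotient.mk_surjective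
  haveI : IsLocalRing A := IsLocalRing.of_surjective' _ hsur
  have hpm : p.asIdeal ≤ maximalIdeal R := le_maximalIdeal p.2.ne_top
  have hmap : (maximalIdeal R).map (Ideal.Quotient.mk p.asIdeal) = maximalIdeal A :=
    by
      haveI : IsLocalHom (Ideal.Quotient.mk p.asIdeal) := IsLocalHom.of_surjective _ hsur
      apply le_antisymm
      · exact ((IsLocalRing.local_hom_TFAE (Ideal.Quotient.mk p.asIdeal)).out 0 2).1 this
      · intro y hy
        obtain ⟨r, rfl⟩ := hsur y
        apply Ideal.mem_map_of_mem
        rw [mem_maximalIdeal, mem_nonunits_iff]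
        intro hu
        exact (mem_maximalIdeal _).1 hy (hu.map _)
  let s' : Finset A := s.image (Ideal.Quotient.mk p.asIdeal)
  have hspan : Ideal.span (s' : Set A) = (Ideal.span (s : Set R)).map (Ideal.Quotient.mk p.asIdeal) := by
    rw [Ideal.map_span, Finset.coe_image]
  obtain ⟨N, hN⟩ := h
  have hN' : maximalIdeal A ^ N ≤ Ideal.span (s' : Set A) := by
    rw [← hmap, ← Ideal.map_pow, hspan]
    refine (Ideal.map_mono hN).trans ?_
    rw [Ideal.map_sup, Ideal.map_quotient_self, bot_sup_eq]
  have hmin : maximalIdeal A ∈ (Ideal.span (s' : Set A)).minimalPrimes := by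
    refine ⟨⟨inferInstance, ?_⟩, ?_⟩
    · rw [hspan, ← hmap]
      exact Ideal.map_mono (Ideal.span_le.2 hs)
    · rintro q ⟨hq, hle⟩ _
      haveI := hq
      exact Ideal.IsPrime.le_of_pow_le (hN'.trans hle)
  have h1 := Ideal.height_le_card_of_mem_minimalPrimes_span_finset hmin
  have h2 : (Order.coheight p : WithBot ℕ∞) = ringKrullDim A := by
    rw [Order.coheight_eq_krullDim_Ici, ringKrullDim_quotient]
    have : PrimeSpectrum.zeroLocus (p.asIdeal : Set R) = Set.Ici p := by
      ext q; rfl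
    rw [this]
  have h3 : ringKrullDim A = (maximalIdeal A).height := by
    rw [IsLocalRing.maximalIdeal_height_eq_ringKrullDim]
  rw [h3] at h2
  have h4 : Order.coheight p = (maximalIdeal A).height := by exact_mod_cast h2
  rw [h4]
  refine h1.trans ?_
  exact_mod_cast Finset.card_image_le

end PT
end E1

namespace E1
section PT2
universe u
variable {R : Type u} [CommRing R]

theorem reg_iff_Nz {K : Ideal R} {y : R} : IsSMulRegular (R ⧸ K) y ↔ Nz K y := by
  constructor
  · intro h r hr
    rw [← Ideal.Quotient.eq_zero_iff_mem]
    apply h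
    change Ideal.Quotient.mk K (y * r) = y • 0
    rw [smul_zero]
    rw [Ideal.Quotient.eq_zero_iff_mem, mul_comm]; exact hr
  · intro h p q hpq
    obtain ⟨p, rfl⟩ := Ideal.Quotient.mk_surjective p
    obtain ⟨q, rfl⟩ := Ideal.Quotient.mk_surjective q
    rw [Ideal.Quotient.mk_eq_mk_iff_sub_mem]
    apply h
    have h2 : Ideal.Quotient.mk K (y * p) = Ideal.Quotient.mk K (y * q) := hpq
    rw [Ideal.Quotient.mk_eq_mk_iff_sub_mem] at h2
    convert h2 using 1
    ring

theorem reg_iff_Nz' {K : Ideal R} {y : R} :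
    IsSMulRegular (R ⧸ (K • (⊤ : Submodule R R))) y ↔ Nz K y := by
  have e : (K • (⊤ : Submodule R R)) = K := by simp
  rw [e]; exact reg_iff_Nz

theorem ofList_take_succ (rs : List R) (i : ℕ) (hi : i < rs.length) :
    Ideal.ofList (rs.take (i + 1)) = Ideal.ofList (rs.take i) ⊔ Ideal.span {rs[i]} := by
  rw [List.take_succ_eq_append_getElem hi, Ideal.ofList_append, Ideal.ofList_singleton]

variable [IsLocalRing R]

theorem DG.pred : ∀ {n : ℕ} {I : Ideal R}, DG (n + 1) I → DG n I
  | 0, _, h => h.ne_top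
  | _ + 1, _, ⟨x, hx, h, hD⟩ => ⟨x, hx, h, hD.pred⟩

theorem DG.mono {n m : ℕ} (h : m ≤ n) {I : Ideal R} (hD : DG n I) : DG m I := by
  induction n, h using Nat.le_induction with
  | base => exact hD
  | succ n _ ih => exact ih hD.pred

theorem DG.of_list (rs : List R) (hm : ∀ x ∈ rs, x ∈ maximalIdeal R)
    (hr : RingTheory.Sequence.IsRegular R rs) :
    ∀ k i, k + i = rs.length → DG k (Ideal.ofList (rs.take i)) := by
  intro k
  induction k with
  | zero =>
    intro i hi ht
    have : Ideal.ofList (rs.take i) ≤ maximalIdeal R := by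
      refine Ideal.span_le.2 fun x hx => hm x (List.mem_of_mem_take hx)
    rw [ht] at this
    exact (maximalIdeal.isMaximal R).ne_top (top_le_iff.1 this)
  | succ k ih =>
    intro i hi
    have hlt : i < rs.length := by omega
    refine ⟨rs[i], hm _ (List.getElem_mem hlt), reg_iff_Nz'.1 (hr.regular_mod_prev i hlt), ?_⟩
    rw [← ofList_take_succ]
    exact ih (i + 1) (by omega)

theorem DG_of_CM {d : ℕ} (hd : 0 < d) (hdim : ringKrullDim R = d) (hCM : IsCMLocal R) :
    DG d (⊥ : Ideal R) := by
  unfold IsCMLocal at hCM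
  rw [hdim] at hCM
  have h1 : rdepth R (maximalIdeal R) R = (d : ℕ∞) := by exact_mod_cast hCM
  have h2 : ((d - 1 : ℕ) : ℕ∞) < rdepth R (maximalIdeal R) R := by
    rw [h1]; exact_mod_cast (by omega : d - 1 < d)
  unfold rdepth at h2
  obtain ⟨n, ⟨rs, hn, hm, hr⟩, hlt⟩ := lt_sSup_iff.1 h2
  rw [← hn] at hlt
  have hlt' : d - 1 < rs.length := by exact_mod_cast hlt
  have := DG.of_list rs hm hr rs.length 0 (by simp)
  simp only [List.take_zero, Ideal.ofList_nil] at this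
  exact this.mono (by omega)

variable {d : ℕ} {a : Fin d → R}

theorem Ji_succ (i : Fin d) : Ji a (i.val + 1) = Ji a i.val ⊔ Ideal.span {a i} := by
  unfold Ji
  rw [← Ideal.span_union]
  congr 1
  ext x
  constructor
  · rintro ⟨j, hj, rfl⟩
    have hj' : j.val < i.val + 1 := hj
    by_cases h : j = i
    · right; rw [h]; rfl
    · left
      refine ⟨j, ?_, rfl⟩
      have : j.val ≠ i.val := fun h' => h (Fin.ext h')
      change j.val < i.val
      omega
  · rintro (⟨j, hj, rfl⟩ | hx)
    · exact ⟨j, Nat.lt_succ_of_lt hj, rfl⟩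
    · rw [hx]; exact ⟨i, Nat.lt_succ_self _, rfl⟩

theorem Nz_step [IsNoetherianRing R] (ha : ∀ i, a i ∈ maximalIdeal R) {N : ℕ}
    (hN : maximalIdeal R ^ N ≤ sp a) (i : Fin d) (hD : DG (d - i.val) (Ji a i.val)) :
    Nz (Ji a i.val) (a i) := by
  classical
  by_contra hcon
  unfold Nz at hcon
  push Not at hcon
  obtain ⟨v, hv1, hv⟩ := hcon
  have hv0 : (Ideal.Quotient.mk (Ji a i.val) v) ≠ 0 := by
    rwa [Ne, Ideal.Quotient.eq_zero_iff_mem]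
  obtain ⟨P, hP, hle⟩ := exists_le_isAssociatedPrime_of_isNoetherianRing R
    (Ideal.Quotient.mk (Ji a i.val) v) hv0
  obtain ⟨hPp, w, hw⟩ := isAssociatedPrime_iff.1 hP
  obtain ⟨w, rfl⟩ := Ideal.Quotient.mk_surjective w
  have hmem : ∀ (z r : R), r ∈ (⊥ : Submodule R (R ⧸ (Ji a i.val))).colon
      {Ideal.Quotient.mk (Ji a i.val) z} ↔ r * z ∈ Ji a i.val := by
    intro z r
    rw [Submodule.mem_colon_singleton, Submodule.mem_bot, ← Ideal.Quotient.eq_zero_iff_mem]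
    rfl
  have h1 := DG.coheight _ (⟨P, hPp⟩ : PrimeSpectrum R) w hD (fun r => by
    change r ∈ P ↔ _
    rw [hw, hmem])
  let s : Finset R := (Finset.univ.filter (fun j : Fin d => i < j)).image a
  have haP : a i ∈ P := hle ((hmem _ _).2 (by rw [mul_comm]; exact hv1))
  have hJP : Ji a i.val ≤ P := by
    intro r hr
    rw [hw, hmem]
    exact Ideal.mul_mem_right _ _ hr
  have h2 := coheight_le_of (⟨P, hPp⟩ : PrimeSpectrum R) s (by
      intro x hx
      obtain ⟨j, -, rfl⟩ := Finset.mem_image.1 hx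
      exact ha j) ⟨N, hN.trans (by
      refine Ideal.span_le.2 ?_
      rintro _ ⟨j, rfl⟩
      rcases lt_trichotomy j i with h | h | h
      · exact Ideal.mem_sup_left (hJP (Ideal.subset_span ⟨j, h, rfl⟩))
      · rw [h]; exact Ideal.mem_sup_left haP
      · refine Ideal.mem_sup_right (Ideal.subset_span ?_)
        exact Finset.mem_coe.2 (Finset.mem_image.2 ⟨j, by simp [h], rfl⟩))⟩
  have h3 : d - i.val ≤ s.card := by exact_mod_cast h1.trans h2
  have h4 : s.card ≤ (Finset.univ.filter (fun j : Fin d => i < j)).card := Finset.card_image_le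
  have h5 : (Finset.univ.filter (fun j : Fin d => i < j)).card = d - 1 - i.val := by
    have : (Finset.univ.filter (fun j : Fin d => i < j)) = Finset.Ioi i := by ext; simp
    rw [this, Fin.card_Ioi]
  have := i.2
  omega

theorem DG_Ji [IsNoetherianRing R] (ha : ∀ i, a i ∈ maximalIdeal R) {N : ℕ}
    (hN : maximalIdeal R ^ N ≤ sp a) (hD : DG d (⊥ : Ideal R)) :
    ∀ i ≤ d, DG (d - i) (Ji a i) := by
  intro i
  induction i with
  | zero =>
    intro _
    have : Ji a 0 = ⊥ := by simp [Ji]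
    rw [this]; exact hD
  | succ i ih =>
    intro hi
    have h1 := ih (by omega)
    have h2 := Nz_step ha hN ⟨i, hi⟩ h1
    have e : d - i = (d - (i + 1)) + 1 := by omega
    rw [e] at h1
    have := DG.G _ h1 (ha ⟨i, hi⟩) h2
    have e2 := Ji_succ (a := a) ⟨i, hi⟩
    change Ji a (i + 1) = Ji a i ⊔ _ at e2
    rw [e2]
    exact this

theorem Nz_all [IsNoetherianRing R] (ha : ∀ i, a i ∈ maximalIdeal R) {N : ℕ}
    (hN : maximalIdeal R ^ N ≤ sp a) (hD : DG d (⊥ : Ideal R)) (i : Fin d) :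
    Nz (Ji a i.val) (a i) :=
  Nz_step ha hN i (DG_Ji ha hN hD i.val i.2.le)

theorem ofList_take_ofFn (i : ℕ) : Ideal.ofList ((List.ofFn a).take i) = Ji a i := by
  unfold Ji Ideal.ofList
  congr 1
  ext x
  simp only [Set.mem_ofPred_eq, Set.mem_image, List.mem_take_iff_getElem]
  constructor
  · rintro ⟨j, hj, rfl⟩
    simp only [List.length_ofFn] at hj
    exact ⟨⟨j, by omega⟩, by simp; omega, by simp⟩
  · rintro ⟨j, hj, rfl⟩
    have := j.2
    exact ⟨j.val, by simp; omega, by simp⟩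

theorem isRegular_ofFn [IsNoetherianRing R] (ha : ∀ i, a i ∈ maximalIdeal R)
    (h : ∀ i : Fin d, Nz (Ji a i.val) (a i)) : RingTheory.Sequence.IsRegular R (List.ofFn a) := by
  refine ⟨⟨?_⟩, ?_⟩
  · intro i hi
    have hi' : i < d := by simpa using hi
    rw [ofList_take_ofFn, reg_iff_Nz', List.getElem_ofFn]
    exact h ⟨i, hi'⟩
  · intro ht
    have e : Ideal.ofList (List.ofFn a) ≤ maximalIdeal R := by
      refine Ideal.span_le.2 fun x hx => ?_
      obtain ⟨j, rfl⟩ := (List.mem_ofFn' a x).1 hx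
      exact ha j
    have e2 : (Ideal.ofList (List.ofFn a) • (⊤ : Submodule R R)) = Ideal.ofList (List.ofFn a) := by simp
    rw [e2] at ht
    rw [← ht] at e
    exact (maximalIdeal.isMaximal R).ne_top (top_le_iff.1 e)

end PT2
end E1

namespace E1
section PU
universe u

theorem final_bound {R : Type u} [CommRing R] [IsLocalRing R] [IsNoetherianRing R]
    (d : ℕ) (hd : 3 ≤ d) (hdim : ringKrullDim R = d)
    (hCM : IsCMLocal R) (hAU : AnalyticallyUnramified R)
    (t : ℕ) (ht : CMTypeData R d t)
    (I J : Ideal R) (hIm : intCl I = maximalIdeal R)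
    (hJ : IsMinimalReduction d J I)
    (L : ℕ → ℕ) (e : ℕ → ℤ) (hHilb : NormalHilbertData d I L e)
    (he3 : e 3 = 0) (ℓ : ℕ)
    (hℓ : mlen R (idealQuot (intCl (I ^ 2)) (J * intCl I)) = (ℓ : WithBot ℕ∞))
    (hne : (t : ℤ) ≠ (ℓ : ℤ)) :
    e 1 < e 0 - 1 + t := by
  obtain ⟨hJI, ⟨a, hJa⟩, N, hN⟩ := hJ
  have hJs : J = sp a := hJa
  subst hJs
  have hF : ∀ k, intCl (I ^ k) = F (sp a) k := fun k => by
    rw [← F_eq_intCl, F_eq_of_reduction hJI hN]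
  have hm : F (sp a) 1 = maximalIdeal R := by rw [← hF 1, pow_one, hIm]
  have hle : sp a ≤ maximalIdeal R := by
    rw [← hm]; have := pow_le_F (sp a) 1; rwa [pow_one] at this
  have ha : ∀ i, a i ∈ maximalIdeal R := fun i => hle (Ideal.subset_span ⟨i, rfl⟩)
  obtain ⟨N0, hN0⟩ : ∃ N0, maximalIdeal R ^ N0 ≤ sp a := by
    apply Ideal.exists_pow_le_of_le_radical_of_fg
    · intro x hx
      rw [← hm] at hx
      obtain ⟨M, hM⟩ := mem_F.1 hx
      refine ⟨M + 1, ?_⟩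
      have := hM (M + 1)
      rwa [show 1 * (M + 1) - M = 1 by omega, pow_one] at this
    · exact IsNoetherian.noetherian _
  have hNz := Nz_all ha hN0 (DG_of_CM (by omega) hdim hCM)
  have hQ : QR a := qr_of_regular fun i r hr => hNz i r hr
  have hb : a ⟨0, by omega⟩ ∈ nonZeroDivisors R := by
    rw [mem_nonZeroDivisors_iff_right]
    intro r hr
    have h0 : Ji a 0 = ⊥ := by simp [Ji]
    have := hNz ⟨0, by omega⟩ r
    change r * _ ∈ Ji a 0 → r ∈ Ji a 0 at this
    rw [h0] at this
    exact this hr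
  have hB : Bdd (sp a) :=
    bdd_main (by omega) hm hQ hN0 hAU (Ideal.subset_span ⟨_, rfl⟩) hb
  have hHD : HD a e := by
    obtain ⟨h1, M, h2⟩ := hHilb
    refine ⟨M, fun n hn => ⟨L n, ?_, h2 n hn⟩⟩
    have := h1 n
    rw [hF, mlen_quot] at this
    exact_mod_cast this
  have hset : Ideal.span {x | x ∈ List.ofFn a} = sp a := by
    unfold sp
    congr 1
    ext x
    exact List.mem_ofFn' a x
  have htt := ht (List.ofFn a) (by simp) (fun x hx => by
    obtain ⟨j, rfl⟩ := (List.mem_ofFn' a x).1 hx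
    exact ha j) (isRegular_ofFn ha hNz)
  rw [hset, mlen_eq_length] at htt
  have htt' : Module.length R (idealQuot ((sp a).colon (maximalIdeal R)) (sp a)) = (t : ℕ∞) := by
    exact_mod_cast htt
  have hS : ∀ x, x ∈ (sp a).colon (maximalIdeal R) ↔ ∀ r ∈ maximalIdeal R, r * x ∈ sp a := by
    intro x
    rw [Submodule.mem_colon]
    refine forall₂_congr fun r _ => ?_
    rw [smul_eq_mul, mul_comm]
  have h1 := mlen_idealQuot ((sp a).colon (maximalIdeal R)) (sp a)
  rw [htt', sup_eq_left.2 (fun x hx => (hS x).2 fun r _ => Ideal.mul_mem_left _ _ hx)] at h1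
  rw [hIm, hF, mlen_eq_length] at hℓ
  have hℓ' : Module.length R (idealQuot (F (sp a) 2) (sp a * maximalIdeal R)) = (ℓ : ℕ∞) := by
    exact_mod_cast hℓ
  have h2 := mlen_idealQuot (F (sp a) 2) (sp a * maximalIdeal R)
  have hle2 : sp a * maximalIdeal R ≤ F (sp a) 2 := by
    rw [Ideal.mul_le]
    intro x hx y hy
    rw [← hm] at hy
    have hx1 : x ∈ F (sp a) 1 := pow_le_F (sp a) 1 (by rwa [pow_one])
    exact mul_mem_F hx1 hy
  rw [hℓ', sup_eq_left.2 hle2] at h2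
  exact main_red hd hQ hB hN0 hm hHD he3 _ hS t ℓ (by rw [← h1, add_comm]) (by rw [← h2, add_comm])
    (by exact_mod_cast hne)

end PU
end E1

theorem e1_strict_upper_bound
    (R : Type*) [CommRing R] [IsLocalRing R] [IsNoetherianRing R]
    (d : ℕ) (hd : 3 ≤ d) (hdim : ringKrullDim R = d)
    (hCM : IsCMLocal R) (hAU : AnalyticallyUnramified R)
    (hres : Infinite (ResidueField R))
    (t : ℕ) (ht : CMTypeData R d t)
    (I J : Ideal R) (hIm : intCl I = maximalIdeal R)
    (hJ : IsMinimalReduction d J I)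
    (L : ℕ → ℕ) (e : ℕ → ℤ) (hHilb : NormalHilbertData d I L e)
    (he3 : e 3 = 0)
    -- `ℓ = λ(Ī²/JĪ)`
    (ℓ : ℕ)
    (hℓ : mlen R (idealQuot (intCl (I ^ 2)) (J * intCl I)) = (ℓ : WithBot ℕ∞))
    (hne : (t : ℤ) ≠ (ℓ : ℤ)) :
    e 1 < e 0 - 1 + t := by
  exact E1.final_bound d hd hdim hCM hAU t ht I J hIm hJ L e hHilb he3 ℓ hℓ hne
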